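/- Let 𝔾' be obtained from 𝔾 by a stabilization of type X:SW, with splitting GC•(𝔾₄') = I₄ ⊕ N₄. The map 𝓗_{X₂}^{I₄} : (N₄, ∂_{N₄}^{N₄}) → (I₄, ∂_{I₄}^{I₄})⟦−1,−1⟧ is a chain homotopy equivalence of bigraded chain complexes. -/

import Mathlib

/-!
Combinatorial model of toroidal grid diagrams, their 4-fold covers, and the
double-point enhanced grid complex (over 𝔽 = ℤ/2ℤ), following Lipshitz and
Ozsváth–Szabó–Sarkar conventions.

* The torus is modelled by `ZMod n × ZMod n`: the horizontal circle `α_j` and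
  vertical circle `β_k` meet at the point `(k, j)`; the square `(k, j)` is the
  one with south-west corner at the point `(k, j)`;  the `O`- and `X`-markings
  of column `k` occupy squares `(k, Orow k)` and `(k, Xrow k)`.
* A grid state is a bijection (column ↦ row), i.e. a permutation of `ZMod n`.
* The 4-fold cover `𝔾₄` lives on `ZMod (2n) × ZMod (2n)`, with the covering
  map `pr` reducing coordinates mod `n`.  A grid state of `𝔾₄` is the preimage
  of a grid state of `𝔾`, so grid states of `𝔾₄` are canonically identified
  with grid states of `𝔾`; similarly the free module `GC` underlying both
  `GC•(𝔾)` and `GC•(𝔾₄)` is the same, and the identification `J₄` is the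
  identity map.
* Rectangles are recorded by their two vertical circles (west/east) and two
  horizontal circles (south/north); "rectangle from x₄ to y₄" is the boundary
  condition `∂(∂_α(r + Nr + Er + NEr)) = y₄ - x₄` (and the `∂_β` analogue),
  expressed via corner-point indicator functions.  Each `N,E`-equivalence class
  of rectangles in `𝔾₄` contains exactly one *normalized* representative
  (west circle and south circle in the first fundamental domain), so sums over
  equivalence classes are sums over normalized representatives.
-/

noncomputable section

open scoped Classical

namespace GridHomology

/-- the ground field `𝔽 = ℤ/2ℤ` -/
abbrev F : Type := ZMod 2

/-- A toroidal grid diagram of grid number `n`. -/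
structure GridDiagram (n : ℕ) where
  Orow : ZMod n → ZMod n
  Xrow : ZMod n → ZMod n
  hO : Function.Bijective Orow
  hX : Function.Bijective Xrow
  hOX : ∀ i, Orow i ≠ Xrow i

/-- A grid state: one point on each horizontal and each vertical circle. -/
abbrev GridState (n : ℕ) := Equiv.Perm (ZMod n)

instance twoMulNeZero (n : ℕ) [NeZero n] : NeZero (2 * n) :=
  ⟨fun h => NeZero.ne n (by omega)⟩

/-- membership in the cyclic (going east/north) interval `[u, v)` -/
def inIco {m : ℕ} (u v k : ZMod m) : Prop := (k - u).val < (v - u).val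

/-- membership in the open cyclic interval `(u, v)` -/
def inIoo {m : ℕ} (u v k : ZMod m) : Prop :=
  0 < (k - u).val ∧ (k - u).val < (v - u).val

instance {m : ℕ} (u v k : ZMod m) : Decidable (inIco u v k) :=
  inferInstanceAs (Decidable (_ < _))

instance {m : ℕ} (u v k : ZMod m) : Decidable (inIoo u v k) :=
  inferInstanceAs (Decidable (_ ∧ _))

/-- Rectangle data on the `m × m` torus: west and east vertical circles,
south and north horizontal circles. -/
structure Rect (m : ℕ) where
  cW : ZMod m
  cE : ZMod m
  rS : ZMod m
  rN : ZMod m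
deriving DecidableEq

instance (m : ℕ) [NeZero m] : Fintype (Rect m) :=
  Fintype.ofEquiv (ZMod m × ZMod m × ZMod m × ZMod m)
    { toFun := fun p => ⟨p.1, p.2.1, p.2.2.1, p.2.2.2⟩
      invFun := fun r => ⟨r.cW, r.cE, r.rS, r.rN⟩
      left_inv := fun _ => rfl
      right_inv := fun _ => rfl }

/-- local multiplicity of a rectangle at a square of the torus -/
def Rect.mult {m : ℕ} (r : Rect m) (sq : ZMod m × ZMod m) : ℕ :=
  if inIco r.cW r.cE sq.1 ∧ inIco r.rS r.rN sq.2 then 1 else 0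

/-- `r` is an (embedded, not necessarily empty) rectangle from `x` to `y` in `𝔾`:
its south-west and north-east corners lie in `x`, its south-east and north-west
corners lie in `y`, and `x`, `y` agree away from the two vertical circles of `r`. -/
def IsRectFrom {m : ℕ} (x y : GridState m) (r : Rect m) : Prop :=
  r.cW ≠ r.cE ∧ r.rS ≠ r.rN ∧
  x r.cW = r.rS ∧ x r.cE = r.rN ∧ y r.cW = r.rN ∧ y r.cE = r.rS ∧
  ∀ k, k ≠ r.cW → k ≠ r.cE → x k = y k

/-- point-measure of a rectangle in `𝔾` at a grid state `w`: the sum over the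
points of `w` of the average of the four adjacent local multiplicities -/
def Rect.pm {m : ℕ} [NeZero m] (w : GridState m) (r : Rect m) : ℚ :=
  (∑ k : ZMod m, ((r.mult (k - 1, w k - 1) + r.mult (k, w k - 1) +
      r.mult (k - 1, w k) + r.mult (k, w k) : ℕ) : ℚ)) / 4

/-- `m(r) = #(Int r ∩ x)` -/
def Rect.intCount {m : ℕ} [NeZero m] (x : GridState m) (r : Rect m) : ℕ :=
  (Finset.univ.filter fun k => inIoo r.cW r.cE k ∧ inIoo r.rS r.rN (x k)).card

/-- `O_i(r)` in `𝔾` -/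
def Ocount {m : ℕ} (G : GridDiagram m) (r : Rect m) (i : ZMod m) : ℕ :=
  r.mult (i, G.Orow i)

/-- `X_i(r)` in `𝔾` -/
def Xcount {m : ℕ} (G : GridDiagram m) (r : Rect m) (i : ZMod m) : ℕ :=
  r.mult (i, G.Xrow i)

/-- `r ∩ 𝕏 = ∅` -/
def XDisjoint {m : ℕ} (G : GridDiagram m) (r : Rect m) : Prop :=
  ∀ i, Xcount G r i = 0

/-! ### The 4-fold cover -/

/-- the covering projection `π₄ : 𝔾₄ → 𝔾` on coordinates -/
def pr {n : ℕ} (a : ZMod (2 * n)) : ZMod n :=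
  ZMod.castHom (dvd_mul_left n 2) (ZMod n) a

/-- indicator function (as a formal sum of points) of the lifted grid state `x₄` -/
def stInd {n : ℕ} (x : GridState n) (p : ZMod (2 * n) × ZMod (2 * n)) : ℤ :=
  if x (pr p.1) = pr p.2 then 1 else 0

/-- `∂(∂_α r)` as a formal sum of points: `SE + NW − SW − NE` -/
def cornerA {m : ℕ} (r : Rect m) (p : ZMod m × ZMod m) : ℤ :=
  (if p = (r.cE, r.rS) then 1 else 0) + (if p = (r.cW, r.rN) then 1 else 0)
    - (if p = (r.cW, r.rS) then 1 else 0) - (if p = (r.cE, r.rN) then 1 else 0)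

/-- `∂(∂_β r)` as a formal sum of points: `NE + SW − SE − NW` -/
def cornerB {m : ℕ} (r : Rect m) (p : ZMod m × ZMod m) : ℤ :=
  (if p = (r.cE, r.rN) then 1 else 0) + (if p = (r.cW, r.rS) then 1 else 0)
    - (if p = (r.cE, r.rS) then 1 else 0) - (if p = (r.cW, r.rN) then 1 else 0)

/-- northward translation `N` by `n` rows -/
def trN {n : ℕ} (r : Rect (2 * n)) : Rect (2 * n) :=
  ⟨r.cW, r.cE, r.rS + (n : ZMod (2 * n)), r.rN + (n : ZMod (2 * n))⟩

/-- eastward translation `E` by `n` columns -/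
def trE {n : ℕ} (r : Rect (2 * n)) : Rect (2 * n) :=
  ⟨r.cW + (n : ZMod (2 * n)), r.cE + (n : ZMod (2 * n)), r.rS, r.rN⟩

/-- `r` is a rectangle from `x₄` to `y₄` in the 4-fold diagram `𝔾₄`:
`∂(∂_α (r + Nr + Er + NEr)) = y₄ − x₄` and `∂(∂_β (r + Nr + Er + NEr)) = x₄ − y₄`. -/
def IsRect4From {n : ℕ} (x y : GridState n) (r : Rect (2 * n)) : Prop :=
  r.cW ≠ r.cE ∧ r.rS ≠ r.rN ∧
  (∀ p, cornerA r p + cornerA (trN r) p + cornerA (trE r) p + cornerA (trN (trE r)) p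
      = stInd y p - stInd x p) ∧
  (∀ p, cornerB r p + cornerB (trN r) p + cornerB (trE r) p + cornerB (trN (trE r)) p
      = stInd x p - stInd y p)

/-- the canonical (normalized) representative of each `{r, Nr, Er, NEr}`
equivalence class: west and south coordinates lie in the first fundamental domain -/
def normal4 {n : ℕ} (r : Rect (2 * n)) : Prop := r.cW.val < n ∧ r.rS.val < n

instance {n : ℕ} (r : Rect (2 * n)) : Decidable (normal4 r) :=
  inferInstanceAs (Decidable (_ ∧ _))

/-- `O_i[r₄]`: total multiplicity of `r₄` at the four lifts of `O_i` -/
def O4count {n : ℕ} [NeZero n] (G : GridDiagram n) (r : Rect (2 * n)) (i : ZMod n) : ℕ :=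
  ∑ p : ZMod (2 * n) × ZMod (2 * n),
    if pr p.1 = i ∧ pr p.2 = G.Orow i then r.mult p else 0

/-- `X_i[r₄]` -/
def X4count {n : ℕ} [NeZero n] (G : GridDiagram n) (r : Rect (2 * n)) (i : ZMod n) : ℕ :=
  ∑ p : ZMod (2 * n) × ZMod (2 * n),
    if pr p.1 = i ∧ pr p.2 = G.Xrow i then r.mult p else 0

/-- `r₄ ∩ π₄⁻¹(𝕏) = ∅` -/
def XDisjoint4 {n : ℕ} [NeZero n] (G : GridDiagram n) (r : Rect (2 * n)) : Prop :=
  ∀ i, X4count G r i = 0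

/-- point-measure of a domain (an integer-valued multiplicity function on the
squares of `𝔾₄`) at the lifted grid state `w₄` -/
def pm4 {n : ℕ} [NeZero n] (w : GridState n) (ψ : ZMod (2 * n) × ZMod (2 * n) → ℤ) : ℚ :=
  (∑ p : ZMod (2 * n) × ZMod (2 * n),
    if w (pr p.1) = pr p.2 then
      ((ψ (p.1 - 1, p.2 - 1) + ψ (p.1, p.2 - 1) + ψ (p.1 - 1, p.2) + ψ p : ℤ) : ℚ)
    else 0) / 4

/-- a rectangle of `𝔾₄` viewed as a domain -/
def Rect.dom4 {n : ℕ} (r : Rect (2 * n)) : ZMod (2 * n) × ZMod (2 * n) → ℤ :=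
  fun p => (r.mult p : ℤ)

/-- point-measure `p_{w₄}[r₄]` of a rectangle of `𝔾₄` -/
def rpm4 {n : ℕ} [NeZero n] (w : GridState n) (r : Rect (2 * n)) : ℚ :=
  pm4 w r.dom4

/-- `m[r₄] = (p_{x₄}[r₄] + p_{y₄}[r₄] − 1)/2`, as a rational number -/
def mQ4 {n : ℕ} [NeZero n] (x y : GridState n) (r : Rect (2 * n)) : ℚ :=
  (rpm4 x r + rpm4 y r - 1) / 2

/-- `m[r₄]` as a natural number (the exponent of `v`) -/
def m4 {n : ℕ} [NeZero n] (x y : GridState n) (r : Rect (2 * n)) : ℕ :=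
  (⌊mQ4 x y r⌋).toNat

/-! ### Maslov and Alexander gradings (via the planar counting function `J`) -/

/-- the points of a planar fundamental domain associated to `f`, in doubled
coordinates (grid states at even positions, markings at odd positions) -/
def ptsOf {m : ℕ} [NeZero m] (f : ZMod m → ZMod m) (off : ℕ) : Finset (ℕ × ℕ) :=
  Finset.univ.image fun k => (2 * k.val + off, 2 * (f k).val + off)

/-- `I(P,Q)`: pairs `(p,q)` with `q` strictly above and strictly to the right of `p` -/
def Icnt (P Q : Finset (ℕ × ℕ)) : ℕ :=
  ∑ p ∈ P, (Q.filter fun q => p.1 < q.1 ∧ p.2 < q.2).card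

/-- `J(P,Q) = (I(P,Q) + I(Q,P))/2` -/
def Jq (P Q : Finset (ℕ × ℕ)) : ℚ := ((Icnt P Q : ℚ) + (Icnt Q P : ℚ)) / 2

/-- the Maslov-type grading `J(x,x) − 2 J(x,P) + J(P,P) + 1` for markings `P` -/
def MaslovOf {m : ℕ} [NeZero m] (f : ZMod m → ZMod m) (x : GridState m) : ℚ :=
  Jq (ptsOf (⇑x) 0) (ptsOf (⇑x) 0) - 2 * Jq (ptsOf (⇑x) 0) (ptsOf f 1)
    + Jq (ptsOf f 1) (ptsOf f 1) + 1

/-- the Maslov grading `M(x) = M_𝕆(x)` -/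
def MaslovO {m : ℕ} [NeZero m] (G : GridDiagram m) (x : GridState m) : ℚ :=
  MaslovOf G.Orow x

/-- `M_𝕏(x)` -/
def MaslovX {m : ℕ} [NeZero m] (G : GridDiagram m) (x : GridState m) : ℚ :=
  MaslovOf G.Xrow x

/-- the Alexander grading `A(x) = (M_𝕆(x) − M_𝕏(x) − (n−1))/2` -/
def Alex {m : ℕ} [NeZero m] (G : GridDiagram m) (x : GridState m) : ℚ :=
  (MaslovO G x - MaslovX G x - ((m : ℚ) - 1)) / 2

/-! ### The double-point enhanced grid complex -/

/-- the ring `𝔽[V₁, …, V_n, v]`: `V_i = X (some i)`, `v = X none` -/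
abbrev Rng (n : ℕ) : Type := MvPolynomial (Option (ZMod n)) F

/-- the free `𝔽[V₁,…,V_n,v]`-module on the set of grid states; it underlies both
`GC•(𝔾)` and `GC•(𝔾₄)` (their grid states being canonically identified) -/
abbrev GC (n : ℕ) := GridState n →₀ Rng n

/-- the variable `V_i` -/
def Vv {n : ℕ} (i : ZMod n) : Rng n := MvPolynomial.X (some i)

/-- the double-point variable `v` -/
def vV {n : ℕ} : Rng n := MvPolynomial.X none

/-- the `𝔽[V₁,…,V_n,v]`-linear map determined by values on grid states -/
def basisMap {n : ℕ} (f : GridState n → GC n) : GC n →ₗ[Rng n] GC n :=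
  Finsupp.lsum (Rng n) fun x => LinearMap.toSpanSingleton (Rng n) (GC n) (f x)

/-- the weight `V₁^{O₁[r₄]} ⋯ V_n^{O_n[r₄]} v^{m[r₄]}` of a rectangle of `𝔾₄` -/
def wt4 {n : ℕ} [NeZero n] (G : GridDiagram n) (x y : GridState n) (r : Rect (2 * n)) :
    Rng n :=
  (∏ i : ZMod n, Vv i ^ O4count G r i) * vV ^ m4 x y r

/-- the differential `∂₄•` of `GC•(𝔾₄)`: counts `N,E`-equivalence classes of
rectangles (via their normalized representatives) disjoint from `π₄⁻¹(𝕏)` -/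
def diff4 {n : ℕ} [NeZero n] (G : GridDiagram n) : GC n →ₗ[Rng n] GC n :=
  basisMap fun x => ∑ y : GridState n,
    ∑ r ∈ Finset.univ.filter
        (fun r : Rect (2 * n) => IsRect4From x y r ∧ normal4 r ∧ XDisjoint4 G r),
      Finsupp.single y (wt4 G x y r)

/-- the weight of a rectangle of `𝔾` -/
def wtB {n : ℕ} [NeZero n] (G : GridDiagram n) (x : GridState n) (r : Rect n) : Rng n :=
  (∏ i : ZMod n, Vv i ^ Ocount G r i) * vV ^ Rect.intCount x r

/-- the differential `∂•` of the double-point enhanced grid complex `GC•(𝔾)` -/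
def diffB {n : ℕ} [NeZero n] (G : GridDiagram n) : GC n →ₗ[Rng n] GC n :=
  basisMap fun x => ∑ y : GridState n,
    ∑ r ∈ Finset.univ.filter
        (fun r : Rect n => IsRectFrom x y r ∧ XDisjoint G r),
      Finsupp.single y (wtB G x r)

/-- `z` is homogeneous of bidegree `(d, s)` for the (Maslov, Alexander) bigrading
extended by `M(V₁^{k₁}⋯V_n^{k_n} v^m ⋅ x) = M(x) − 2Σkᵢ + 2m`,
`A(V₁^{k₁}⋯V_n^{k_n} v^m ⋅ x) = A(x) − Σkᵢ`. -/
def IsHomog {n : ℕ} [NeZero n] (G : GridDiagram n) (z : GC n) (d s : ℚ) : Prop :=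
  ∀ (y : GridState n) (k : Option (ZMod n) →₀ ℕ), MvPolynomial.coeff k (z y) ≠ 0 →
    (MaslovO G y - 2 * ∑ i : ZMod n, (k (some i) : ℚ) + 2 * (k none : ℚ) = d) ∧
    (Alex G y - ∑ i : ZMod n, (k (some i) : ℚ) = s)

/-- a linear map is homogeneous of degree `(a, b)` -/
def MapHomog {n : ℕ} [NeZero n] (G G' : GridDiagram n) (φ : GC n →ₗ[Rng n] GC n)
    (a b : ℚ) : Prop :=
  ∀ z d s, IsHomog G z d s → IsHomog G' (φ z) (d + a) (s + b)

/-- `𝔾` represents a knot: following the link (column `i` joins its `O` to the `X`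
in the same row, etc.) visits every column -/
def IsKnot {n : ℕ} (G : GridDiagram n) : Prop :=
  ∀ i j : ZMod n, ∃ k : ℕ,
    (((Equiv.ofBijective G.Orow G.hO).trans (Equiv.ofBijective G.Xrow G.hX).symm) ^ k) i = j

/-- the homotopy operator `𝓗_{X_j}•` counting equivalence classes of rectangles in
`𝔾₄` crossing the lifts of `X_j` exactly once and no other `X`-marking -/
def HXmap {n : ℕ} [NeZero n] (G : GridDiagram n) (j : ZMod n) : GC n →ₗ[Rng n] GC n :=
  basisMap fun x => ∑ y : GridState n,
    ∑ r ∈ Finset.univ.filter (fun r : Rect (2 * n) =>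
        IsRect4From x y r ∧ normal4 r ∧ X4count G r j = 1 ∧
        ∀ k, k ≠ j → X4count G r k = 0),
      Finsupp.single y (wt4 G x y r)

/-! ### Commutation moves, pentagons and hexagons

`𝔾` and `𝔾'` differ by commuting the (adjacent) columns `c−1` and `c`; they are
drawn on a common torus, sharing all markings and all circles except that the
vertical circle `β_c` of `𝔾` is replaced in `𝔾'` by a curve `γ_c` which passes
to the west of the marking line within the rows of the cyclic interval
`J = [h₁, h₂)` (which contains the markings of column `c−1`) and to the east of
it in the complementary rows (which contain the markings of column `c`);
`γ_c` crosses `β_c` at two points `a` (just south of the row-circle `h₂`) and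
`b` (just south of `h₁`).  Grid states of `𝔾'` are again recorded as
permutations (the `γ`-point in row `j` replacing the `β_c`-point). -/

structure CommData (n : ℕ) where
  G : GridDiagram n
  G' : GridDiagram n
  c : ZMod n
  h₁ : ZMod n
  h₂ : ZMod n
  hne : h₁ ≠ h₂
  hOA : inIco h₁ h₂ (G.Orow (c - 1))
  hXA : inIco h₁ h₂ (G.Xrow (c - 1))
  hOB : ¬ inIco h₁ h₂ (G.Orow c)
  hXB : ¬ inIco h₁ h₂ (G.Xrow c)
  hO'A : G'.Orow (c - 1) = G.Orow c
  hO'B : G'.Orow c = G.Orow (c - 1)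
  hX'A : G'.Xrow (c - 1) = G.Xrow c
  hX'B : G'.Xrow c = G.Xrow (c - 1)
  hO' : ∀ k, k ≠ c - 1 → k ≠ c → G'.Orow k = G.Orow k
  hX' : ∀ k, k ≠ c - 1 → k ≠ c → G'.Xrow k = G.Xrow k

/-- Pentagon data in the 4-fold torus `T₄`: the underlying rectangle
`I₄(p)` of `𝔾₄`, the side of the curved edge (`left = true` means the curved
vertical edge is the east edge of the rectangle), and the lifted height `hh`
of the crossing point (`a` or `b`) serving as the fifth corner. -/
structure Pent (n : ℕ) where
  rect : Rect (2 * n)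
  left : Bool
  hh : ZMod (2 * n)
deriving DecidableEq

instance (n : ℕ) [NeZero n] : Fintype (Pent n) :=
  Fintype.ofEquiv (Rect (2 * n) × Bool × ZMod (2 * n))
    { toFun := fun p => ⟨p.1, p.2.1, p.2.2⟩
      invFun := fun p => ⟨p.rect, p.left, p.hh⟩
      left_inv := fun _ => rfl
      right_inv := fun _ => rfl }

/-- the distinguished vertical edge lies on a lift of the curved circle -/
def onCedge {n : ℕ} (C : CommData n) (p : Pent n) : Prop :=
  if p.left then pr p.rect.cE = C.c else pr p.rect.cW = C.c

/-- the crossing point (at height just below the row circle `h`) lies strictly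
inside the vertical extent of the rectangle -/
def heightOK {n : ℕ} (r : Rect (2 * n)) (h : ZMod (2 * n)) : Prop :=
  0 < (h - r.rS).val ∧ (h - r.rS).val ≤ (r.rN - r.rS).val

/-- a pentagon from `x₄ ∈ S₄(𝔾₄)` to `y₄' ∈ S₄(𝔾₄')` (with fifth corner at a
lift of the distinguished point `a`) -/
def IsPentA {n : ℕ} (C : CommData n) (x y' : GridState n) (p : Pent n) : Prop :=
  IsRect4From x y' p.rect ∧ pr p.hh = C.h₂ ∧ onCedge C p ∧ heightOK p.rect p.hh

/-- a pentagon from `y₄' ∈ S₄(𝔾₄')` to `x₄ ∈ S₄(𝔾₄)` (fifth corner at a lift of `b`) -/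
def IsPentB {n : ℕ} (C : CommData n) (y' x : GridState n) (p : Pent n) : Prop :=
  IsRect4From y' x p.rect ∧ pr p.hh = C.h₁ ∧ onCedge C p ∧ heightOK p.rect p.hh

/-- the rows along which the boundary of the pentagon runs along `γ` rather than `β_c` -/
def detourA {n : ℕ} [NeZero n] (p : Pent n) : Finset (ZMod (2 * n)) :=
  if p.left then Finset.univ.filter (fun j => inIco p.rect.rS p.hh j)
  else Finset.univ.filter (fun j => inIco p.hh p.rect.rN j)

def detourB {n : ℕ} [NeZero n] (p : Pent n) : Finset (ZMod (2 * n)) :=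
  if p.left then Finset.univ.filter (fun j => inIco p.hh p.rect.rN j)
  else Finset.univ.filter (fun j => inIco p.rect.rS p.hh j)

/-- marking-count correction along a curved edge: in a detour row `j`, if `γ` is
west (`π₄ j ∈ J`) the bigon sliver carries the column-`(c−1)` marking, otherwise
it carries the column-`c` marking; the sliver is gained or lost according to
whether the region lies east (`east = true`) or west of the curved circle. -/
def adj {n : ℕ} [NeZero n] (C : CommData n) (f : ZMod n → ZMod n) (east : Bool)
    (D : Finset (ZMod (2 * n))) (i : ZMod n) : ℤ :=
  ∑ j ∈ D,
    if inIco C.h₁ C.h₂ (pr j) then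
      (if i = C.c - 1 ∧ f (C.c - 1) = pr j then (if east then 1 else -1) else 0)
    else
      (if i = C.c ∧ f C.c = pr j then (if east then -1 else 1) else 0)

/-- `O_i[p₄]` for a pentagon counted by `P•` -/
def pentOA {n : ℕ} [NeZero n] (C : CommData n) (p : Pent n) (i : ZMod n) : ℤ :=
  (O4count C.G p.rect i : ℤ) + adj C C.G.Orow (!p.left) (detourA p) i

def pentXA {n : ℕ} [NeZero n] (C : CommData n) (p : Pent n) (i : ZMod n) : ℤ :=
  (X4count C.G p.rect i : ℤ) + adj C C.G.Xrow (!p.left) (detourA p) i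

def pentXDisjA {n : ℕ} [NeZero n] (C : CommData n) (p : Pent n) : Prop :=
  ∀ i, pentXA C p i = 0

def pentOB {n : ℕ} [NeZero n] (C : CommData n) (p : Pent n) (i : ZMod n) : ℤ :=
  (O4count C.G p.rect i : ℤ) + adj C C.G.Orow (!p.left) (detourB p) i

def pentXB {n : ℕ} [NeZero n] (C : CommData n) (p : Pent n) (i : ZMod n) : ℤ :=
  (X4count C.G p.rect i : ℤ) + adj C C.G.Xrow (!p.left) (detourB p) i

def pentXDisjB {n : ℕ} [NeZero n] (C : CommData n) (p : Pent n) : Prop :=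
  ∀ i, pentXB C p i = 0

/-- the weight `V₁^{O₁[p₄]}⋯V_n^{O_n[p₄]} v^{m[p₄]}`, with `m[p₄] = m[I₄(p₄)]` -/
def pentWtA {n : ℕ} [NeZero n] (C : CommData n) (x y' : GridState n) (p : Pent n) : Rng n :=
  (∏ i : ZMod n, Vv i ^ (pentOA C p i).toNat) * vV ^ m4 x y' p.rect

def pentWtB {n : ℕ} [NeZero n] (C : CommData n) (y' x : GridState n) (p : Pent n) : Rng n :=
  (∏ i : ZMod n, Vv i ^ (pentOB C p i).toNat) * vV ^ m4 y' x p.rect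

/-- the pentagon-counting map `P• : GC•(𝔾₄) → GC•(𝔾₄')` -/
def Pmap {n : ℕ} [NeZero n] (C : CommData n) : GC n →ₗ[Rng n] GC n :=
  basisMap fun x => ∑ y' : GridState n,
    ∑ p ∈ Finset.univ.filter (fun p : Pent n =>
        IsPentA C x y' p ∧ normal4 p.rect ∧ pentXDisjA C p),
      Finsupp.single y' (pentWtA C x y' p)

/-- the pentagon-counting map `(P•)' : GC•(𝔾₄') → GC•(𝔾₄)` -/
def P'map {n : ℕ} [NeZero n] (C : CommData n) : GC n →ₗ[Rng n] GC n :=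
  basisMap fun y' => ∑ x : GridState n,
    ∑ p ∈ Finset.univ.filter (fun p : Pent n =>
        IsPentB C y' x p ∧ normal4 p.rect ∧ pentXDisjB C p),
      Finsupp.single x (pentWtB C y' x p)

/-- Hexagon data: the underlying rectangle `I₄(h₄)` of `𝔾₄`, the side of its
curved edge, and the lifted heights of its two crossing-point corners
(`ha` a lift of `a`, `hb` a lift of `b`). -/
structure Hex (n : ℕ) where
  rect : Rect (2 * n)
  left : Bool
  ha : ZMod (2 * n)
  hb : ZMod (2 * n)
deriving DecidableEq

instance (n : ℕ) [NeZero n] : Fintype (Hex n) :=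
  Fintype.ofEquiv (Rect (2 * n) × Bool × ZMod (2 * n) × ZMod (2 * n))
    { toFun := fun p => ⟨p.1, p.2.1, p.2.2.1, p.2.2.2⟩
      invFun := fun p => ⟨p.rect, p.left, p.ha, p.hb⟩
      left_inv := fun _ => rfl
      right_inv := fun _ => rfl }

def onCedgeH {n : ℕ} (C : CommData n) (h : Hex n) : Prop :=
  if h.left then pr h.rect.cE = C.c else pr h.rect.cW = C.c

/-- a hexagon from `x₄` to `y₄` (both states of `𝔾₄`) -/
def IsHex {n : ℕ} (C : CommData n) (x y : GridState n) (h : Hex n) : Prop :=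
  IsRect4From x y h.rect ∧ pr h.ha = C.h₂ ∧ pr h.hb = C.h₁ ∧ onCedgeH C h ∧
  heightOK h.rect h.ha ∧ heightOK h.rect h.hb

/-- the rows between the two crossing-point corners of a hexagon -/
def detourH {n : ℕ} [NeZero n] (h : Hex n) : Finset (ZMod (2 * n)) :=
  if (h.ha - h.rect.rS).val < (h.hb - h.rect.rS).val then
    Finset.univ.filter (fun j => inIco h.ha h.hb j)
  else Finset.univ.filter (fun j => inIco h.hb h.ha j)

def hexO {n : ℕ} [NeZero n] (C : CommData n) (h : Hex n) (i : ZMod n) : ℤ :=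
  (O4count C.G h.rect i : ℤ) + adj C C.G.Orow (!h.left) (detourH h) i

def hexX {n : ℕ} [NeZero n] (C : CommData n) (h : Hex n) (i : ZMod n) : ℤ :=
  (X4count C.G h.rect i : ℤ) + adj C C.G.Xrow (!h.left) (detourH h) i

def hexXDisj {n : ℕ} [NeZero n] (C : CommData n) (h : Hex n) : Prop :=
  ∀ i, hexX C h i = 0

def hexWt {n : ℕ} [NeZero n] (C : CommData n) (x y : GridState n) (h : Hex n) : Rng n :=
  (∏ i : ZMod n, Vv i ^ (hexO C h i).toNat) * vV ^ m4 x y h.rect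

/-- the hexagon-counting map `H• : GC•(𝔾₄) → GC•(𝔾₄)` -/
def Hmap {n : ℕ} [NeZero n] (C : CommData n) : GC n →ₗ[Rng n] GC n :=
  basisMap fun x => ∑ y : GridState n,
    ∑ h ∈ Finset.univ.filter (fun h : Hex n =>
        IsHex C x y h ∧ normal4 h.rect ∧ hexXDisj C h),
      Finsupp.single y (hexWt C x y h)

/-! ### Double-point enhanced grid homology -/

def cycles {n : ℕ} [NeZero n] (G : GridDiagram n) : Submodule (Rng n) (GC n) :=
  LinearMap.ker (diffB G)

def bdrIn {n : ℕ} [NeZero n] (G : GridDiagram n) : Submodule (Rng n) ↥(cycles G) :=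
  Submodule.comap (cycles G).subtype (LinearMap.range (diffB G))

instance GHquotInst {n : ℕ} [NeZero n] (G : GridDiagram n) :
    HasQuotient ↥(cycles G) (Submodule (Rng n) ↥(cycles G)) :=
  Submodule.hasQuotient (R := Rng n) (M := ↥(cycles G))

/-- the double-point enhanced grid homology `GH•(𝔾)` -/
abbrev GH {n : ℕ} [NeZero n] (G : GridDiagram n) := ↥(cycles G) ⧸ bdrIn G

/-- a homology class is homogeneous of degree `(d,s)` if it has a homogeneous
cycle representative -/
def GHhomog {n : ℕ} [NeZero n] (G : GridDiagram n) (h : GH G) (d s : ℚ) : Prop :=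
  ∃ w : ↥(cycles G), (Submodule.Quotient.mk w : GH G) = h ∧ IsHomog G (w : GC n) d s

/-! ### Commutation and stabilization moves as relations on grid diagrams -/

/-- `𝔾` and `𝔾'` differ by a column commutation move -/
def IsColComm {n : ℕ} (G G' : GridDiagram n) : Prop :=
  ∃ C : CommData n, C.G = G ∧ C.G' = G'

/-- the transposed grid diagram (exchanging the roles of rows and columns) -/
def GridDiagram.transpose {n : ℕ} (G : GridDiagram n) : GridDiagram n where
  Orow := ⇑(Equiv.ofBijective G.Orow G.hO).symm
  Xrow := ⇑(Equiv.ofBijective G.Xrow G.hX).symm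
  hO := (Equiv.ofBijective G.Orow G.hO).symm.bijective
  hX := (Equiv.ofBijective G.Xrow G.hX).symm.bijective
  hOX := by
    intro i h
    apply G.hOX ((Equiv.ofBijective G.Orow G.hO).symm i)
    have h1 : G.Orow ((Equiv.ofBijective G.Orow G.hO).symm i) = i :=
      Equiv.ofBijective_apply_symm_apply G.Orow G.hO i
    have h2 : G.Xrow ((Equiv.ofBijective G.Xrow G.hX).symm i) = i :=
      Equiv.ofBijective_apply_symm_apply G.Xrow G.hX i
    rw [h1, h, h2]

/-- `𝔾` and `𝔾'` differ by a row commutation move -/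
def IsRowComm {n : ℕ} (G G' : GridDiagram n) : Prop :=
  IsColComm G.transpose G'.transpose

/-- collapse map identifying `a` and `a+1` (used to destabilize) -/
def coll {n : ℕ} (a k : ZMod (n + 1)) : ZMod n :=
  (a.val : ZMod n) + (((k - a).val - 1 : ℕ) : ZMod n)

/-- `𝔾'` is obtained from `𝔾` by a stabilization with new 2×2 block at columns
`c', c'+1` and rows `r', r'+1`; the empty square of the block sits at the corner
selected by `(ec, er)` (east column?, north row?), and `xty` records whether the
block carries two `X`-markings (type `X:·`) or two `O`-markings (type `O:·`).
E.g. `(ec, er, xty) = (false, false, true)` is type `X:SW`, with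
`O₁ = (c'+1, r'+1)`, `X₁ = (c', r'+1)`, `X₂ = (c'+1, r')`. -/
def IsStabAt {n : ℕ} (G : GridDiagram n) (G' : GridDiagram (n + 1))
    (c' r' : ZMod (n + 1)) (ec er xty : Bool) : Prop :=
  (if xty then
    G'.Orow (if ec then c' else c' + 1) = (if er then r' else r' + 1) ∧
    G'.Xrow (if ec then c' + 1 else c') = (if er then r' else r' + 1) ∧
    G'.Xrow (if ec then c' else c' + 1) = (if er then r' + 1 else r') ∧
    G.Xrow (c'.val : ZMod n) = (r'.val : ZMod n) ∧
    G.Orow (c'.val : ZMod n) = coll r' (G'.Orow (if ec then c' + 1 else c'))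
  else
    G'.Xrow (if ec then c' else c' + 1) = (if er then r' else r' + 1) ∧
    G'.Orow (if ec then c' + 1 else c') = (if er then r' else r' + 1) ∧
    G'.Orow (if ec then c' else c' + 1) = (if er then r' + 1 else r') ∧
    G.Orow (c'.val : ZMod n) = (r'.val : ZMod n) ∧
    G.Xrow (c'.val : ZMod n) = coll r' (G'.Xrow (if ec then c' + 1 else c'))) ∧
  (∀ k : ZMod (n + 1), k ≠ c' → k ≠ c' + 1 →
    G.Orow (coll c' k) = coll r' (G'.Orow k) ∧ G.Xrow (coll c' k) = coll r' (G'.Xrow k))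

/-- `𝔾'` is obtained from `𝔾` by a stabilization move of one of the standard types -/
def IsStab {n : ℕ} (G : GridDiagram n) (G' : GridDiagram (n + 1)) : Prop :=
  ∃ c' r' ec er xty, IsStabAt G G' c' r' ec er xty

/-! ### The stabilization machinery (type `X:SW`) for the 4-fold complexes -/

/-- projection of `GC•(𝔾₄')` onto the span `I₄` of states containing the
distinguished point `c = (c'+1, r'+1)` -/
def pI {n : ℕ} (c' r' : ZMod (n + 1)) : GC (n + 1) →ₗ[Rng (n + 1)] GC (n + 1) :=
  basisMap fun x => if x (c' + 1) = r' + 1 then Finsupp.single x 1 else 0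

/-- projection onto the complementary span `N₄` -/
def pN {n : ℕ} (c' r' : ZMod (n + 1)) : GC (n + 1) →ₗ[Rng (n + 1)] GC (n + 1) :=
  basisMap fun x => if x (c' + 1) = r' + 1 then 0 else Finsupp.single x 1

/-- the submodule `I₄` -/
def Isub {n : ℕ} (c' r' : ZMod (n + 1)) : Submodule (Rng (n + 1)) (GC (n + 1)) :=
  Finsupp.supported (Rng (n + 1)) (Rng (n + 1)) {x : GridState (n + 1) | x (c' + 1) = r' + 1}

/-- the submodule `N₄` -/
def Nsub {n : ℕ} (c' r' : ZMod (n + 1)) : Submodule (Rng (n + 1)) (GC (n + 1)) :=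
  Finsupp.supported (Rng (n + 1)) (Rng (n + 1)) {x : GridState (n + 1) | x (c' + 1) ≠ r' + 1}

/-- the components `∂_{I₄}^{I₄}`, `∂_{I₄}^{N₄}`, `∂_{N₄}^{N₄}` of `∂₄•` -/
def dII {n : ℕ} [NeZero (n + 1)] (G' : GridDiagram (n + 1)) (c' r' : ZMod (n + 1)) :
    GC (n + 1) →ₗ[Rng (n + 1)] GC (n + 1) :=
  pI c' r' ∘ₗ diff4 G' ∘ₗ pI c' r'

def dIN {n : ℕ} [NeZero (n + 1)] (G' : GridDiagram (n + 1)) (c' r' : ZMod (n + 1)) :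
    GC (n + 1) →ₗ[Rng (n + 1)] GC (n + 1) :=
  pN c' r' ∘ₗ diff4 G' ∘ₗ pI c' r'

def dNN {n : ℕ} [NeZero (n + 1)] (G' : GridDiagram (n + 1)) (c' r' : ZMod (n + 1)) :
    GC (n + 1) →ₗ[Rng (n + 1)] GC (n + 1) :=
  pN c' r' ∘ₗ diff4 G' ∘ₗ pN c' r'

/-- section of the column collapse map, avoiding the new column `c'+1` -/
def sect {n : ℕ} (a : ZMod (n + 1)) (k : ZMod n) : ZMod (n + 1) :=
  a + (if k - (a.val : ZMod n) = 0 then 0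
       else (((k - (a.val : ZMod n)).val + 1 : ℕ) : ZMod (n + 1)))

def stCollFun {n : ℕ} (c' r' : ZMod (n + 1)) (x : GridState (n + 1)) :
    ZMod n → ZMod n :=
  fun k => coll r' (x (sect c' k))

/-- the destabilized grid state `x` corresponding to `x' = x ∪ {c}` -/
def stColl {n : ℕ} (c' r' : ZMod (n + 1)) (x : GridState (n + 1)) : GridState n :=
  if h : Function.Bijective (stCollFun c' r' x) then Equiv.ofBijective _ h else 1

/-- the promoted module `GC•(𝔾₄)[V₁]`: the free `𝔽[V₁,…,V_n,v]`-module on the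
grid states of the destabilized diagram -/
abbrev GCP (n : ℕ) := GridState n →₀ Rng (n + 1)

def basisMapP {n : ℕ} (f : GridState n → GCP n) : GCP n →ₗ[Rng (n + 1)] GCP n :=
  Finsupp.lsum (Rng (n + 1)) fun x => LinearMap.toSpanSingleton (Rng (n + 1)) (GCP n) (f x)

/-- the identification `e₄` (extended by zero on `N₄`) -/
def e4map {n : ℕ} (c' r' : ZMod (n + 1)) : GC (n + 1) →ₗ[Rng (n + 1)] GCP n :=
  Finsupp.lsum (Rng (n + 1)) fun x =>
    LinearMap.toSpanSingleton (Rng (n + 1)) (GCP n)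
      (if x (c' + 1) = r' + 1 then Finsupp.single (stColl c' r' x) (1 : Rng (n + 1)) else 0)

/-- renaming of the variables of the destabilized diagram into those of `𝔾'` -/
def renUp {n : ℕ} (c' : ZMod (n + 1)) : Rng n →+* Rng (n + 1) :=
  (MvPolynomial.rename (Option.map (sect c')) :
      MvPolynomial (Option (ZMod n)) F →ₐ[F] MvPolynomial (Option (ZMod (n + 1))) F).toRingHom

/-- the differential of the promoted complex `GC•(𝔾₄)[V₁]` -/
def diffP {n : ℕ} [NeZero n] (G : GridDiagram n) (c' : ZMod (n + 1)) :
    GCP n →ₗ[Rng (n + 1)] GCP n :=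
  basisMapP fun x => ∑ y : GridState n,
    ∑ r ∈ Finset.univ.filter
        (fun r : Rect (2 * n) => IsRect4From x y r ∧ normal4 r ∧ XDisjoint4 G r),
      Finsupp.single y (renUp c' (wt4 G x y r))

/-- homogeneity on the promoted complex -/
def IsHomogP {n : ℕ} [NeZero n] (G : GridDiagram n) (z : GCP n) (d s : ℚ) : Prop :=
  ∀ (y : GridState n) (k : Option (ZMod (n + 1)) →₀ ℕ), MvPolynomial.coeff k (z y) ≠ 0 →
    (MaslovO G y - 2 * ∑ i : ZMod (n + 1), (k (some i) : ℚ) + 2 * (k none : ℚ) = d) ∧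
    (Alex G y - ∑ i : ZMod (n + 1), (k (some i) : ℚ) = s)

/-- the map counting equivalence classes of rectangles crossing `X₂` (the
`X`-marking of column `c'+1`) once and no other `X`-marking -/
def HX2map {n : ℕ} (G' : GridDiagram (n + 1)) (c' : ZMod (n + 1)) :
    GC (n + 1) →ₗ[Rng (n + 1)] GC (n + 1) :=
  basisMap fun x => ∑ y : GridState (n + 1),
    ∑ r ∈ Finset.univ.filter (fun r : Rect (2 * (n + 1)) =>
        IsRect4From x y r ∧ normal4 r ∧ X4count G' r (c' + 1) = 1 ∧
        ∀ k, k ≠ c' + 1 → X4count G' r k = 0),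
      Finsupp.single y (wt4 G' x y r)

/-- its component `𝓗_{X₂}^{I₄} : N₄ → I₄` -/
def hX2I {n : ℕ} (G' : GridDiagram (n + 1)) (c' r' : ZMod (n + 1)) :
    GC (n + 1) →ₗ[Rng (n + 1)] GC (n + 1) :=
  pI c' r' ∘ₗ HX2map G' c' ∘ₗ pN c' r'

/-- weight with the variable `V_j` evaluated at `1` -/
def wtNo {n : ℕ} [NeZero n] (G : GridDiagram n) (x y : GridState n) (j : ZMod n)
    (r : Rect (2 * n)) : Rng n :=
  (∏ i ∈ Finset.univ.erase j, Vv i ^ O4count G r i) * vV ^ m4 x y r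

/-- `𝓗_{O₁}•`: counts `X`-disjoint rectangles crossing `O₁` (the `O`-marking of
column `c'+1`) once, with `V₁` evaluated at `1` -/
def HO1map {n : ℕ} (G' : GridDiagram (n + 1)) (c' : ZMod (n + 1)) :
    GC (n + 1) →ₗ[Rng (n + 1)] GC (n + 1) :=
  basisMap fun x => ∑ y : GridState (n + 1),
    ∑ r ∈ Finset.univ.filter (fun r : Rect (2 * (n + 1)) =>
        IsRect4From x y r ∧ normal4 r ∧ XDisjoint4 G' r ∧ O4count G' r (c' + 1) = 1),
      Finsupp.single y (wtNo G' x y (c' + 1) r)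

/-- its component `I₄ → N₄` -/
def hO1N {n : ℕ} (G' : GridDiagram (n + 1)) (c' r' : ZMod (n + 1)) :
    GC (n + 1) →ₗ[Rng (n + 1)] GC (n + 1) :=
  pN c' r' ∘ₗ HO1map G' c' ∘ₗ pI c' r'

/-! ### Grid diagrams of arbitrary size, and the moves of Cromwell's theorem -/

/-- a grid diagram of unspecified (positive) grid number -/
structure GDS where
  sz : ℕ+
  D : GridDiagram (sz : ℕ)

instance (p : ℕ+) : NeZero (p : ℕ) := ⟨p.ne_zero⟩

/-- a single commutation or stabilization move -/
def MoveRel (A B : GDS) : Prop :=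
  (∃ h : (A.sz : ℕ) = (B.sz : ℕ),
      IsColComm (h ▸ A.D) B.D ∨ IsRowComm (h ▸ A.D) B.D) ∨
  (∃ h : (B.sz : ℕ) = (A.sz : ℕ) + 1, IsStab A.D (h ▸ B.D))

/-- connected by a finite sequence of commutation moves and
stabilization/destabilization moves -/
def ConnectedByMoves (A B : GDS) : Prop :=
  Relation.ReflTransGen (fun X Y => MoveRel X Y ∨ MoveRel Y X) A B

/-! ### cyclic order and arcs -/

theorem valSub {N : ℕ} [NeZero N] (k u : ZMod N) :
    (k - u).val = if u.val ≤ k.val then k.val - u.val else k.val + N - u.val := by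
  split_ifs with h
  · exact ZMod.val_sub h
  · have h1 : (u - k).val = u.val - k.val := ZMod.val_sub (by omega)
    have h2 : k - u = -(u - k) := by ring
    have h3 : u - k ≠ 0 := by
      intro h0; rw [h0, ZMod.val_zero] at h1; omega
    haveI : NeZero (u - k) := ⟨h3⟩
    rw [h2, ZMod.val_neg_of_ne_zero, h1]
    have := ZMod.val_lt u
    omega

theorem valNe {N : ℕ} [NeZero N] {a b : ZMod N} (h : a ≠ b) : a.val ≠ b.val :=
  fun hv => h (ZMod.val_injective N hv)

/-- cyclic order -/
def cyc {N : ℕ} (a b e : ZMod N) : Prop := inIoo a e b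

theorem cyc_rot {N : ℕ} [NeZero N] {a b e : ZMod N} (h : cyc a b e) : cyc b e a := by
  have ha := ZMod.val_lt a
  have hb := ZMod.val_lt b
  have he := ZMod.val_lt e
  simp only [cyc, inIoo, valSub] at *
  split_ifs at * <;> omega

theorem cyc_iff_rot {N : ℕ} [NeZero N] {a b e : ZMod N} : cyc a b e ↔ cyc b e a :=
  ⟨cyc_rot, fun h => cyc_rot (cyc_rot h)⟩

theorem cyc_flip {N : ℕ} [NeZero N] {a b e : ZMod N} (h1 : a ≠ b) (h2 : a ≠ e) (h3 : b ≠ e) :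
    cyc a e b ↔ ¬ cyc a b e := by
  have ha := ZMod.val_lt a
  have hb := ZMod.val_lt b
  have he := ZMod.val_lt e
  have h1 := valNe h1
  have h2 := valNe h2
  have h3 := valNe h3
  simp only [cyc, inIoo, valSub] at *
  split_ifs at * <;> omega

/-- the half open arc `[a,b)` -/
def arc {N : ℕ} [NeZero N] (a b : ZMod N) : Finset (ZMod N) := Finset.univ.filter (inIco a b)

theorem mem_arc {N : ℕ} [NeZero N] {a b k : ZMod N} : k ∈ arc a b ↔ inIco a b k := by
  simp [arc]

theorem self_mem_arc {N : ℕ} [NeZero N] {a b : ZMod N} (h : a ≠ b) : a ∈ arc a b := by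
  have h1 := valNe h
  have hb := ZMod.val_lt b
  have ha := ZMod.val_lt a
  rw [mem_arc]
  simp only [inIco, valSub]
  split_ifs at * <;> omega

theorem ioo_iff_ico {N : ℕ} [NeZero N] {a b k : ZMod N} (h : k ≠ a) :
    inIoo a b k ↔ inIco a b k := by
  have h1 := valNe h
  have hb := ZMod.val_lt b
  have ha := ZMod.val_lt a
  have hk := ZMod.val_lt k
  simp only [inIco, inIoo, valSub]
  split_ifs at * <;> omega

theorem arc_disj {N : ℕ} [NeZero N] {a b e : ZMod N} (h : cyc a b e) :
    Disjoint (arc a b) (arc b e) := by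
  rw [Finset.disjoint_left]
  intro k
  simp only [mem_arc]
  have ha := ZMod.val_lt a
  have hb := ZMod.val_lt b
  have he := ZMod.val_lt e
  have hk := ZMod.val_lt k
  simp only [cyc, inIoo, inIco, valSub] at *
  split_ifs at * <;> omega

theorem arc_union {N : ℕ} [NeZero N] {a b e : ZMod N} (h : cyc a b e) :
    arc a b ∪ arc b e = arc a e := by
  ext k
  simp only [mem_arc, Finset.mem_union]
  have ha := ZMod.val_lt a
  have hb := ZMod.val_lt b
  have he := ZMod.val_lt e
  have hk := ZMod.val_lt k
  simp only [cyc, inIoo, inIco, valSub] at *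
  split_ifs at * <;> omega

theorem arc_disj2 {N : ℕ} [NeZero N] (a b : ZMod N)  :
    Disjoint (arc a b) (arc b a) := by
  rw [Finset.disjoint_left]
  intro k
  simp only [mem_arc]
  have ha := ZMod.val_lt a
  have hb := ZMod.val_lt b
  have hk := ZMod.val_lt k
  simp only [inIco, valSub] at *
  split_ifs at * <;> omega

theorem arc_union2 {N : ℕ} [NeZero N] {a b : ZMod N} (h : a ≠ b) :
    arc a b ∪ arc b a = Finset.univ := by
  ext k
  simp only [mem_arc, Finset.mem_union, Finset.mem_univ, iff_true]
  have h1 := valNe h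
  have ha := ZMod.val_lt a
  have hb := ZMod.val_lt b
  have hk := ZMod.val_lt k
  simp only [inIco, valSub] at *
  split_ifs at * <;> omega

/-- product over a rectangle of squares -/
def PP {N : ℕ} [NeZero N] {R : Type*} [CommRing R] (u : ZMod N → ZMod N → R)
    (a b s t : ZMod N) : R := ∏ i ∈ arc a b, ∏ j ∈ arc s t, u i j

section PP
variable {N : ℕ} [NeZero N] {R : Type*} [CommRing R] (u : ZMod N → ZMod N → R)

theorem PP_col {a b e : ZMod N} (h : cyc a b e) (s t : ZMod N) :
    PP u a e s t = PP u a b s t * PP u b e s t := by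
  unfold PP
  rw [← arc_union h, Finset.prod_union (arc_disj h)]

theorem PP_row {s m t : ZMod N} (h : cyc s m t) (a b : ZMod N) :
    PP u a b s t = PP u a b s m * PP u a b m t := by
  unfold PP
  rw [← Finset.prod_mul_distrib]
  refine Finset.prod_congr rfl fun i _ => ?_
  rw [← arc_union h, Finset.prod_union (arc_disj h)]

theorem PP_colfull {a b : ZMod N} (h : a ≠ b) (s t : ZMod N) :
    PP u a b s t * PP u b a s t = ∏ j ∈ arc s t, ∏ i, u i j := by
  unfold PP
  rw [← Finset.prod_union (arc_disj2 a b), arc_union2 h, Finset.prod_comm]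

theorem PP_rowfull {s t : ZMod N} (h : s ≠ t) (a b : ZMod N) :
    PP u a b s t * PP u a b t s = ∏ i ∈ arc a b, ∏ j, u i j := by
  unfold PP
  rw [← Finset.prod_mul_distrib]
  refine Finset.prod_congr rfl fun i _ => ?_
  rw [← Finset.prod_union (arc_disj2 s t), arc_union2 h]

end PP

theorem arc_single {N : ℕ} [NeZero N] (p : ZMod N) (h : p ≠ p + 1) : arc p (p + 1) = {p} := by
  ext k
  have h1 : (1 : ZMod N).val = 1 := by
    have : N ≠ 1 := by
      rintro rfl
      exact h (Subsingleton.elim _ _)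
    have := NeZero.ne N
    exact ZMod.val_one'' (by omega)
  rw [mem_arc, Finset.mem_singleton, inIco, show p + 1 - p = 1 by ring, h1, Nat.lt_one_iff,
    ZMod.val_eq_zero, sub_eq_zero]

theorem eq_add_one_of_arc {N : ℕ} [NeZero N] {p b : ZMod N} (h : arc p b ⊆ {p}) (hb : p ≠ b) :
    b = p + 1 := by
  by_contra hne
  have hN : N ≠ 1 := by
    rintro rfl
    exact hb (Subsingleton.elim _ _)
  have h0 := NeZero.ne N
  have h1 : (1 : ZMod N).val = 1 := ZMod.val_one'' (by omega)
  have : p + 1 ∈ arc p b := by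
    rw [mem_arc, inIco, show p + 1 - p = 1 by ring, h1]
    have e1 : (b - p).val ≠ 0 := by
      rw [Ne, ZMod.val_eq_zero, sub_eq_zero]; exact fun h => hb h.symm
    have e2 : (b - p).val ≠ 1 := by
      intro h2
      rw [← h1] at h2
      have := ZMod.val_injective N h2
      exact hne (by rw [← this]; ring)
    omega
  have := Finset.mem_singleton.1 (h this)
  have h2 : (1 : ZMod N) = 0 := by simpa using this
  rw [h2, ZMod.val_zero] at h1
  omega

theorem not_cyc_succ {N : ℕ} [NeZero N] {p b : ZMod N} : ¬ cyc p b (p + 1) := by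
  intro h
  have hN : N ≠ 1 := by
    rintro rfl
    have h2 := h.1
    rw [Subsingleton.elim (b - p) 0, ZMod.val_zero] at h2
    omega
  have h0 := NeZero.ne N
  have h1 : (1 : ZMod N).val = 1 := ZMod.val_one'' (by omega)
  unfold cyc inIoo at h
  rw [show p + 1 - p = 1 by ring, h1] at h
  omega


/-! ### rectangle weights -/
section WW
set_option linter.unusedSectionVars false
variable {N : ℕ} [NeZero N] {R : Type*} [CommRing R]

/-- number of points of `x` in the interior of the torus rectangle from column `a` to `b` -/
def icnt (x : GridState N) (a b : ZMod N) : ℕ :=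
  (Finset.univ.filter fun k => inIoo a b k ∧ inIoo (x a) (x b) (x k)).card

/-- weight of the torus rectangle from column `a` to column `b` -/
def WW (u : ZMod N → ZMod N → R) (v : R) (x : GridState N) (a b : ZMod N) : R :=
  PP u a b (x a) (x b) * v ^ icnt x a b

/-- square weights absorbing the points of `x` away from the columns in `Sp` -/
def uh (u : ZMod N → ZMod N → R) (v : R) (Sp : Finset (ZMod N)) (x : GridState N)
    (i j : ZMod N) : R := u i j * if i ∉ Sp ∧ x i = j then v else 1

theorem WW_eq (u : ZMod N → ZMod N → R) (v : R) (Sp : Finset (ZMod N)) (x y : GridState N)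
    (hy : ∀ k, k ∉ Sp → y k = x k) (a b : ZMod N) (ha : a ∈ Sp) :
    WW u v y a b = PP (uh u v Sp x) a b (y a) (y b) *
      v ^ (Sp.filter fun k => inIoo a b k ∧ inIoo (y a) (y b) (y k)).card := by
  unfold WW PP uh
  simp only [Finset.prod_mul_distrib, mul_assoc]
  congr 1
  have h1 : ∏ i ∈ arc a b, ∏ j ∈ arc (y a) (y b), (if i ∉ Sp ∧ x i = j then v else 1)
      = v ^ (Finset.univ.filter
        fun k => k ∉ Sp ∧ inIoo a b k ∧ inIoo (y a) (y b) (y k)).card := by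
    rw [← Finset.prod_const, Finset.prod_filter, arc, Finset.prod_filter]
    refine Finset.prod_congr rfl fun i _ => ?_
    by_cases hi : i ∈ Sp
    · simp [hi]
    · have hia : i ≠ a := fun h => hi (h ▸ ha)
      have hya : y i ≠ y a := fun h => hia (y.injective h)
      rw [hy i hi] at hya
      simp only [ioo_iff_ico hia, ioo_iff_ico hya, hi, not_false_eq_true, true_and, Finset.prod_ite_eq, mem_arc, hy i hi]
      by_cases h1 : inIco a b i <;> simp [h1]
  rw [h1, ← pow_add]
  congr 1
  unfold icnt
  rw [← Finset.card_filter_add_card_filter_not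
    (s := Finset.univ.filter fun k => inIoo a b k ∧ inIoo (y a) (y b) (y k)) (fun k => k ∉ Sp)]
  congr 1
  · congr 1; ext k; simp [and_comm, and_left_comm]
  · congr 1; ext k; simp [and_comm, and_left_comm]

theorem not_ioo_left {a b : ZMod N} : ¬ inIoo a b a := by
  simp [inIoo]

theorem not_ioo_right {a b : ZMod N} : ¬ inIoo a b b := by
  simp [inIoo]

theorem WW3 (u : ZMod N → ZMod N → R) (v : R) (Sp : Finset (ZMod N)) (x y : GridState N)
    (hy : ∀ k, k ∉ Sp → y k = x k) (a b e : ZMod N) (hS : ∀ k, k ∈ Sp ↔ k = a ∨ k = b ∨ k = e) :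
    WW u v y a b = PP (uh u v Sp x) a b (y a) (y b) *
      (if cyc a e b ∧ cyc (y a) (y e) (y b) then v else 1) := by
  rw [WW_eq u v Sp x y hy a b ((hS a).2 (Or.inl rfl))]
  congr 1
  have : (Sp.filter fun k => inIoo a b k ∧ inIoo (y a) (y b) (y k))
      = if cyc a e b ∧ cyc (y a) (y e) (y b) then {e} else ∅ := by
    ext k
    simp only [Finset.mem_filter, hS]
    constructor
    · rintro ⟨rfl | rfl | rfl, h1, h2⟩
      · exact absurd h1 not_ioo_left
      · exact absurd h1 not_ioo_right
      · rw [if_pos ⟨h1, h2⟩]; simp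
    · intro h
      split_ifs at h with h1
      · rw [Finset.mem_singleton] at h
        subst h
        exact ⟨Or.inr (Or.inr rfl), h1⟩
      · simp at h
  rw [this]
  split_ifs <;> simp

end WW

/-- hypotheses on the square weights: all rows multiply to zero, all columns but `p` too -/
structure Good {N : ℕ} [NeZero N] {R : Type*} [CommRing R] (u : ZMod N → ZMod N → R)
    (p : ZMod N) (κ : R) : Prop where
  row : ∀ j, ∏ i, u i j = 0
  col : ∀ i, i ≠ p → ∏ j, u i j = 0
  colp : ∏ j, u p j = κ

section T
set_option linter.unusedSectionVars false
variable {N : ℕ} [NeZero N] {R : Type*} [CommRing R]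
  {u : ZMod N → ZMod N → R} {v κ : R} {p : ZMod N} {Sp : Finset (ZMod N)} {x : GridState N}

theorem uh_row (hu : Good u p κ) (j : ZMod N) : ∏ i, uh u v Sp x i j = 0 := by
  unfold uh
  rw [Finset.prod_mul_distrib, hu.row, zero_mul]

theorem uh_col (hu : Good u p κ) (i : ZMod N) (h : i ≠ p) : ∏ j, uh u v Sp x i j = 0 := by
  unfold uh
  rw [Finset.prod_mul_distrib, hu.col i h, zero_mul]

theorem uh_colp (hu : Good u p κ) (h : p ∈ Sp) : ∏ j, uh u v Sp x p j = κ := by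
  unfold uh
  simp [h, hu.colp]

theorem QZ (hu : Good u p κ) {a b s t : ZMod N} (h : a ≠ b) (h' : s ≠ t) :
    PP (uh u v Sp x) a b s t * PP (uh u v Sp x) b a s t = 0 := by
  rw [PP_colfull _ h]
  exact Finset.prod_eq_zero (self_mem_arc h') (uh_row hu s)

theorem QK (hu : Good u p κ) {a b s t : ZMod N} (h : a ≠ b) (h' : s ≠ t) (ha : a ∈ Sp) :
    PP (uh u v Sp x) a b s t * PP (uh u v Sp x) a b t s = if a = p ∧ b = p + 1 then κ else 0 := by
  rw [PP_rowfull _ h']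
  split_ifs with hc
  · obtain ⟨rfl, rfl⟩ := hc
    rw [arc_single _ h, Finset.prod_singleton, uh_colp hu ha]
  · by_cases hs : arc a b ⊆ {p}
    · have := Finset.mem_singleton.1 (hs (self_mem_arc h))
      subst this
      exact absurd ⟨rfl, eq_add_one_of_arc hs h⟩ hc
    · rw [Finset.not_subset] at hs
      obtain ⟨i, hi, hi'⟩ := hs
      exact Finset.prod_eq_zero hi (uh_col hu i (by simpa using hi'))

variable {a b e : ZMod N}

theorem sw_fix {k : ZMod N} (hS : ∀ k, k ∈ Sp ↔ k = a ∨ k = b ∨ k = e) :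
    k ∉ Sp → (x * Equiv.swap a b) k = x k := by
  intro hk
  rw [hS] at hk
  push Not at hk
  rw [Equiv.Perm.mul_apply, Equiv.swap_apply_of_ne_of_ne hk.1 hk.2.1]

/-- the four kinds of composites of rectangles sharing one column -/
theorem TT1 (hS : ∀ k, k ∈ Sp ↔ k = a ∨ k = b ∨ k = e) (h1 : a ≠ b) (h2 : a ≠ e) (h3 : b ≠ e) :
    WW u v x a b * WW u v (x * Equiv.swap a b) b e =
      PP (uh u v Sp x) a b (x a) (x b) * PP (uh u v Sp x) b e (x a) (x e) *
        (if cyc a b e then 1 else v) := by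
  rw [WW3 u v Sp x x (fun _ _ => rfl) a b e hS,
    WW3 u v Sp x (x * Equiv.swap a b) (fun k => sw_fix hS) b e a
      (fun k => by rw [hS]; tauto)]
  simp only [Equiv.Perm.mul_apply, Equiv.swap_apply_left, Equiv.swap_apply_right,
    Equiv.swap_apply_of_ne_of_ne h2.symm h3.symm]
  have hr := cyc_flip (x.injective.ne h1) (x.injective.ne h2) (x.injective.ne h3)
  have hc := cyc_flip h1 h2 h3
  have hc2 : cyc b a e ↔ ¬ cyc a b e :=
    cyc_iff_rot.trans hc
  by_cases c : cyc a b e <;> by_cases r : cyc (x a) (x b) (x e) <;>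
    simp [hr, hc, hc2, c, r] <;> ring

theorem TT2 (hS : ∀ k, k ∈ Sp ↔ k = a ∨ k = b ∨ k = e) (h1 : a ≠ b) (h2 : a ≠ e) (h3 : b ≠ e) :
    WW u v x a b * WW u v (x * Equiv.swap a b) e a =
      PP (uh u v Sp x) a b (x a) (x b) * PP (uh u v Sp x) e a (x e) (x b) *
        (if cyc a b e then 1 else v) := by
  rw [WW3 u v Sp x x (fun _ _ => rfl) a b e hS,
    WW3 u v Sp x (x * Equiv.swap a b) (fun k => sw_fix hS) e a b
      (fun k => by rw [hS]; tauto)]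
  simp only [Equiv.Perm.mul_apply, Equiv.swap_apply_left, Equiv.swap_apply_right,
    Equiv.swap_apply_of_ne_of_ne h2.symm h3.symm]
  have hr := cyc_flip (x.injective.ne h1) (x.injective.ne h2) (x.injective.ne h3)
  have hc := cyc_flip h1 h2 h3
  have hc2 : cyc e b a ↔ ¬ cyc a b e := by rw [← hc]; exact cyc_iff_rot.symm
  have hr2 : cyc (x e) (x a) (x b) ↔ cyc (x a) (x b) (x e) := cyc_iff_rot
  by_cases c : cyc a b e <;> by_cases r : cyc (x a) (x b) (x e) <;>
    simp [hr, hc, hc2, hr2, c, r] <;> ring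

theorem TT3 (hS : ∀ k, k ∈ Sp ↔ k = a ∨ k = b ∨ k = e) (h1 : a ≠ b) (h2 : a ≠ e) (h3 : b ≠ e) :
    WW u v x a b * WW u v (x * Equiv.swap a b) a e =
      PP (uh u v Sp x) a b (x a) (x b) * PP (uh u v Sp x) a e (x b) (x e) *
        (if cyc (x a) (x b) (x e) then 1 else v) := by
  rw [WW3 u v Sp x x (fun _ _ => rfl) a b e hS,
    WW3 u v Sp x (x * Equiv.swap a b) (fun k => sw_fix hS) a e b
      (fun k => by rw [hS]; tauto)]
  simp only [Equiv.Perm.mul_apply, Equiv.swap_apply_left, Equiv.swap_apply_right,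
    Equiv.swap_apply_of_ne_of_ne h2.symm h3.symm]
  have hr := cyc_flip (x.injective.ne h1) (x.injective.ne h2) (x.injective.ne h3)
  have hc := cyc_flip h1 h2 h3
  have hr2 : cyc (x b) (x a) (x e) ↔ ¬ cyc (x a) (x b) (x e) :=
    cyc_iff_rot.trans hr
  by_cases c : cyc a b e <;> by_cases r : cyc (x a) (x b) (x e) <;>
    simp [hr, hc, hr2, c, r] <;> ring

theorem TT4 (hS : ∀ k, k ∈ Sp ↔ k = a ∨ k = b ∨ k = e) (h1 : a ≠ b) (h2 : a ≠ e) (h3 : b ≠ e) :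
    WW u v x a b * WW u v (x * Equiv.swap a b) e b =
      PP (uh u v Sp x) a b (x a) (x b) * PP (uh u v Sp x) e b (x e) (x a) *
        (if cyc (x a) (x b) (x e) then 1 else v) := by
  rw [WW3 u v Sp x x (fun _ _ => rfl) a b e hS,
    WW3 u v Sp x (x * Equiv.swap a b) (fun k => sw_fix hS) e b a
      (fun k => by rw [hS]; tauto)]
  simp only [Equiv.Perm.mul_apply, Equiv.swap_apply_left, Equiv.swap_apply_right,
    Equiv.swap_apply_of_ne_of_ne h2.symm h3.symm]
  have hr := cyc_flip (x.injective.ne h1) (x.injective.ne h2) (x.injective.ne h3)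
  have hc := cyc_flip h1 h2 h3
  have hc2 : cyc e a b ↔ cyc a b e := cyc_iff_rot
  have hr2 : cyc (x e) (x b) (x a) ↔ ¬ cyc (x a) (x b) (x e) := by
    rw [← hr]; exact cyc_iff_rot.symm
  by_cases c : cyc a b e <;> by_cases r : cyc (x a) (x b) (x e) <;>
    simp [hr, hc, hc2, hr2, c, r] <;> ring

end T

section T3
variable {N : ℕ} [NeZero N] {R : Type*} [CommRing R]
  {u : ZMod N → ZMod N → R} {v κ : R} {p : ZMod N} {x : GridState N} {a b e : ZMod N}

theorem spec3 (a b e : ZMod N) : ∀ k, k ∈ ({a, b, e} : Finset (ZMod N)) ↔ k = a ∨ k = b ∨ k = e := by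
  intro k; simp

theorem L1_r (h1 : a ≠ b) (h2 : a ≠ e) (h3 : b ≠ e) (c : cyc a b e)
    (r : cyc (x a) (x b) (x e)) :
    WW u v x a b * WW u v (x * Equiv.swap a b) b e =
      WW u v x b e * WW u v (x * Equiv.swap b e) a e := by
  have hS := spec3 a b e
  rw [TT1 hS h1 h2 h3, TT4 (fun k => (hS k).trans (by tauto)) h3 h1.symm h2.symm, if_pos c,
    if_pos (cyc_rot r), PP_row _ r b e, PP_col _ c (x a) (x b)]
  ring

theorem L1_n (h1 : a ≠ b) (h2 : a ≠ e) (h3 : b ≠ e) (c : cyc a b e)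
    (r : cyc (x a) (x e) (x b)) :
    WW u v x a b * WW u v (x * Equiv.swap a b) b e =
      WW u v x a e * WW u v (x * Equiv.swap a e) a b := by
  have hS := spec3 a b e
  rw [TT1 hS h1 h2 h3, TT3 (fun k => (hS k).trans (by tauto)) h2 h1 h3.symm, if_pos c,
    if_pos r, PP_row _ r a b, PP_col _ c (x a) (x e)]
  ring

theorem L1_z (hu : Good u p κ) (h1 : a ≠ b) (h2 : a ≠ e) (h3 : b ≠ e) (c : cyc a e b) :
    WW u v x a b * WW u v (x * Equiv.swap a b) b e = 0 := by
  have hS := spec3 a b e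
  rw [TT1 hS h1 h2 h3]
  by_cases r : cyc (x a) (x b) (x e)
  · rw [PP_row _ r b e, PP_col _ (cyc_rot (cyc_rot c)) (x a) (x b)]
    linear_combination (PP (uh u v {a, b, e} x) a e (x a) (x b) *
      PP (uh u v {a, b, e} x) b e (x b) (x e) * (if cyc a b e then 1 else v)) *
      QZ (v := v) (x := x) (Sp := {a, b, e}) hu h1 (x.injective.ne h1)
  · have r' := (cyc_flip (x.injective.ne h1) (x.injective.ne h2) (x.injective.ne h3)).2 r
    rw [PP_row _ r' a b, PP_col _ (cyc_rot (cyc_rot c)) (x a) (x e)]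
    linear_combination (PP (uh u v {a, b, e} x) a b (x e) (x b) *
      PP (uh u v {a, b, e} x) a e (x a) (x e) * (if cyc a b e then 1 else v)) *
      QZ (v := v) (x := x) (Sp := {a, b, e}) hu h1 (x.injective.ne h2)

theorem L2_r (h1 : a ≠ b) (h2 : a ≠ e) (h3 : b ≠ e) (c : cyc a b e)
    (r : cyc (x a) (x b) (x e)) :
    WW u v x a b * WW u v (x * Equiv.swap a b) e a =
      WW u v x e a * WW u v (x * Equiv.swap e a) e b := by
  have hS := spec3 a b e
  have c' := cyc_rot (cyc_rot c)
  have r' := cyc_rot (cyc_rot r)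
  rw [TT2 hS h1 h2 h3, TT3 (fun k => (hS k).trans (by tauto)) h2.symm h3.symm h1, if_pos c,
    if_pos r', PP_row _ r' e a, PP_col _ c' (x a) (x b)]
  ring

theorem L2_n (h1 : a ≠ b) (h2 : a ≠ e) (h3 : b ≠ e) (c : cyc a b e)
    (r : cyc (x a) (x e) (x b)) :
    WW u v x a b * WW u v (x * Equiv.swap a b) e a =
      WW u v x e b * WW u v (x * Equiv.swap e b) a b := by
  have hS := spec3 a b e
  have c' := cyc_rot (cyc_rot c)
  rw [TT2 hS h1 h2 h3, TT4 (fun k => (hS k).trans (by tauto)) h3.symm h2.symm h1.symm, if_pos c,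
    if_pos (cyc_rot r), PP_row _ r a b, PP_col _ c' (x e) (x b)]
  ring

theorem L2_z (hu : Good u p κ) (h1 : a ≠ b) (h2 : a ≠ e) (h3 : b ≠ e) (c : cyc a e b) :
    WW u v x a b * WW u v (x * Equiv.swap a b) e a = 0 := by
  have hS := spec3 a b e
  rw [TT2 hS h1 h2 h3]
  by_cases r : cyc (x a) (x b) (x e)
  · -- rows `e, a, b`
    have r' := cyc_rot (cyc_rot r)
    rw [PP_row _ r' e a, PP_col _ (cyc_rot c) (x a) (x b)]
    linear_combination (PP (uh u v {a, b, e} x) e b (x a) (x b) *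
      PP (uh u v {a, b, e} x) e a (x e) (x a) * (if cyc a b e then 1 else v)) *
      QZ (v := v) (x := x) (Sp := {a, b, e}) hu h1 (x.injective.ne h1)
  · have r' := (cyc_flip (x.injective.ne h1) (x.injective.ne h2) (x.injective.ne h3)).2 r
    rw [PP_row _ r' a b, PP_col _ (cyc_rot c) (x e) (x b)]
    linear_combination (PP (uh u v {a, b, e} x) a b (x a) (x e) *
      PP (uh u v {a, b, e} x) e b (x e) (x b) * (if cyc a b e then 1 else v)) *
      QZ (v := v) (x := x) (Sp := {a, b, e}) hu h1 (x.injective.ne h3.symm)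

/-- wrapped composites, `c` case of the third kind -/
theorem L3_c (hu : Good u p κ) (h1 : a ≠ b) (h2 : a ≠ e) (h3 : b ≠ e) (c : cyc a b e)
    (r : cyc (x a) (x e) (x b)) :
    WW u v x a b * WW u v (x * Equiv.swap a b) a e =
      if a = p ∧ b = p + 1 then
        v * κ * (WW u v x b e * WW u v (x * Equiv.swap b e) a b) else 0 := by
  have hS := spec3 a b e
  have nr := (cyc_flip (x.injective.ne h1) (x.injective.ne h2) (x.injective.ne h3)).1 r
  have hK := QK (v := v) (x := x) (Sp := {a, b, e}) hu h1 (x.injective.ne h1) (by simp)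
  rw [TT3 hS h1 h2 h3, TT2 (fun k => (hS k).trans (by tauto)) h3 h1.symm h2.symm, if_neg nr,
    if_pos (cyc_rot c), PP_col _ c (x b) (x e), PP_row _ (cyc_rot (cyc_rot r)) a b,
    PP_row _ r a b]
  rw [PP_row _ r a b] at hK
  split_ifs at hK ⊢ with hp
  · linear_combination (v * PP (uh u v {a, b, e} x) a b (x a) (x e) *
      PP (uh u v {a, b, e} x) b e (x b) (x e)) * hK
  · linear_combination (v * PP (uh u v {a, b, e} x) a b (x a) (x e) *
      PP (uh u v {a, b, e} x) b e (x b) (x e)) * hK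

theorem L3_n (hu : Good u p κ) (h1 : a ≠ b) (h2 : a ≠ e) (h3 : b ≠ e) (c : cyc a e b)
    (r : cyc (x a) (x e) (x b)) :
    WW u v x a b * WW u v (x * Equiv.swap a b) a e =
      if a = p ∧ e = p + 1 then
        v * κ * (WW u v x a e * WW u v (x * Equiv.swap a e) e b) else 0 := by
  have hS := spec3 a b e
  have nr := (cyc_flip (x.injective.ne h1) (x.injective.ne h2) (x.injective.ne h3)).1 r
  have hK := QK (v := v) (x := x) (Sp := {a, b, e}) hu h2 (x.injective.ne h1) (by simp)
  rw [TT3 hS h1 h2 h3, TT1 (fun k => (hS k).trans (by tauto)) h2 h1 h3.symm, if_neg nr,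
    if_pos c, PP_col _ c (x a) (x b), PP_row _ (cyc_rot (cyc_rot r)) a e]
  split_ifs at hK ⊢ with hp
  · linear_combination (v * PP (uh u v {a, b, e} x) a e (x a) (x e) *
      PP (uh u v {a, b, e} x) e b (x a) (x b)) * hK
  · linear_combination (v * PP (uh u v {a, b, e} x) a e (x a) (x e) *
      PP (uh u v {a, b, e} x) e b (x a) (x b)) * hK

theorem L4_c (hu : Good u p κ) (h1 : a ≠ b) (h2 : a ≠ e) (h3 : b ≠ e) (c : cyc a b e)
    (r : cyc (x a) (x e) (x b)) :
    WW u v x a b * WW u v (x * Equiv.swap a b) e b =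
      if a = p ∧ b = p + 1 then
        v * κ * (WW u v x e a * WW u v (x * Equiv.swap e a) a b) else 0 := by
  have hS := spec3 a b e
  have nr := (cyc_flip (x.injective.ne h1) (x.injective.ne h2) (x.injective.ne h3)).1 r
  have hK := QK (v := v) (x := x) (Sp := {a, b, e}) hu h1 (x.injective.ne h1) (by simp)
  rw [TT4 hS h1 h2 h3, TT1 (fun k => (hS k).trans (by tauto)) h2.symm h3.symm h1, if_neg nr,
    if_pos (cyc_rot (cyc_rot c)), PP_col _ (cyc_rot (cyc_rot c)) (x e) (x a),
    PP_row _ (cyc_rot r) a b]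
  split_ifs at hK ⊢ with hp
  · linear_combination (v * PP (uh u v {a, b, e} x) a b (x e) (x b) *
      PP (uh u v {a, b, e} x) e a (x e) (x a)) * hK
  · linear_combination (v * PP (uh u v {a, b, e} x) a b (x e) (x b) *
      PP (uh u v {a, b, e} x) e a (x e) (x a)) * hK

theorem L4_n (hu : Good u p κ) (h1 : a ≠ b) (h2 : a ≠ e) (h3 : b ≠ e) (c : cyc a e b)
    (r : cyc (x a) (x e) (x b)) :
    WW u v x a b * WW u v (x * Equiv.swap a b) e b =
      if e = p ∧ b = p + 1 then
        v * κ * (WW u v x e b * WW u v (x * Equiv.swap e b) a e) else 0 := by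
  have hS := spec3 a b e
  have nr := (cyc_flip (x.injective.ne h1) (x.injective.ne h2) (x.injective.ne h3)).1 r
  have hK := QK (v := v) (x := x) (Sp := {a, b, e}) hu h3.symm (x.injective.ne h2) (by simp)
  have q1 := PP_row (uh u v {a, b, e} x) r e b
  have q2 := PP_row (uh u v {a, b, e} x) (cyc_rot r) e b
  rw [TT4 hS h1 h2 h3, TT2 (fun k => (hS k).trans (by tauto)) h3.symm h2.symm h1.symm, if_neg nr,
    if_pos (cyc_rot c), PP_col _ c (x a) (x b), q1]
  split_ifs at hK ⊢ with hp
  · linear_combination (v * PP (uh u v {a, b, e} x) a e (x a) (x b) *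
      PP (uh u v {a, b, e} x) e b (x e) (x b)) * hK
  · linear_combination (v * PP (uh u v {a, b, e} x) a e (x a) (x b) *
      PP (uh u v {a, b, e} x) e b (x e) (x b)) * hK

end T3

section T4
set_option linter.unusedSectionVars false
variable {N : ℕ} [NeZero N] {R : Type*} [CommRing R]

/-- correction factor for the thin column -/
def phi (v κ : R) (p a b : ZMod N) : R := 1 + if a = p ∧ b = p + 1 then v * κ else 0

theorem kphi (v : R) {κ : R} (hκ : κ * κ = 0) (p a b : ZMod N) : κ * phi v κ p a b = κ := by
  unfold phi
  split_ifs
  · linear_combination v * hκ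
  · ring

/-- composite of two rectangles, raw -/
def CR (u : ZMod N → ZMod N → R) (v : R) (Φ : GridState N → R) (x : GridState N)
    (a b c d : ZMod N) : R :=
  WW u v x a b * WW u v (x * Equiv.swap a b) c d *
    Φ (x * (Equiv.swap a b * Equiv.swap c d))

/-- composite of two rectangles, corrected -/
def CT (u : ZMod N → ZMod N → R) (v κ : R) (p : ZMod N) (Φ : GridState N → R) (x : GridState N)
    (a b c d : ZMod N) : R :=
  CR u v Φ x a b c d * (phi v κ p a b * phi v κ p c d)

theorem swapA {a b e : ZMod N} (h1 : a ≠ b) (h2 : a ≠ e) (h3 : b ≠ e) :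
    Equiv.swap a b * Equiv.swap b e = Equiv.swap b e * Equiv.swap a e := by
  ext k : 1
  simp only [Equiv.Perm.mul_apply, Equiv.swap_apply_def]
  grind

theorem swapB {a b e : ZMod N} (h1 : a ≠ b) (h2 : a ≠ e) (h3 : b ≠ e) :
    Equiv.swap a b * Equiv.swap b e = Equiv.swap a e * Equiv.swap a b := by
  ext k : 1
  simp only [Equiv.Perm.mul_apply, Equiv.swap_apply_def]
  grind

theorem swapC {a b e : ZMod N} (h1 : a ≠ b) (h2 : a ≠ e) (h3 : b ≠ e) :
    Equiv.swap a b * Equiv.swap e a = Equiv.swap e a * Equiv.swap e b := by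
  ext k : 1
  simp only [Equiv.Perm.mul_apply, Equiv.swap_apply_def]
  grind

theorem swapD {a b e : ZMod N} (h1 : a ≠ b) (h2 : a ≠ e) (h3 : b ≠ e) :
    Equiv.swap a b * Equiv.swap e a = Equiv.swap e b * Equiv.swap a b := by
  ext k : 1
  simp only [Equiv.Perm.mul_apply, Equiv.swap_apply_def]
  grind

theorem swapE {a b e : ZMod N} (h1 : a ≠ b) (h2 : a ≠ e) (h3 : b ≠ e) :
    Equiv.swap a b * Equiv.swap a e = Equiv.swap b e * Equiv.swap a b := by
  ext k : 1
  simp only [Equiv.Perm.mul_apply, Equiv.swap_apply_def]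
  grind

theorem swapF {a b e : ZMod N} (h1 : a ≠ b) (h2 : a ≠ e) (h3 : b ≠ e) :
    Equiv.swap a b * Equiv.swap a e = Equiv.swap a e * Equiv.swap e b := by
  ext k : 1
  simp only [Equiv.Perm.mul_apply, Equiv.swap_apply_def]
  grind

theorem swapG {a b e : ZMod N} (h1 : a ≠ b) (h2 : a ≠ e) (h3 : b ≠ e) :
    Equiv.swap a b * Equiv.swap e b = Equiv.swap e a * Equiv.swap a b := by
  ext k : 1
  simp only [Equiv.Perm.mul_apply, Equiv.swap_apply_def]
  grind

theorem swapH {a b e : ZMod N} (h1 : a ≠ b) (h2 : a ≠ e) (h3 : b ≠ e) :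
    Equiv.swap a b * Equiv.swap e b = Equiv.swap e b * Equiv.swap a e := by
  ext k : 1
  simp only [Equiv.Perm.mul_apply, Equiv.swap_apply_def]
  grind

variable {u : ZMod N → ZMod N → R} {v κ : R} {p : ZMod N} {x : GridState N}
  (Φ : GridState N → R) {a b e : ZMod N}

theorem phi_cyc (h : cyc a b e) : phi v κ p a e = 1 := by
  unfold phi
  rw [if_neg, add_zero]
  rintro ⟨rfl, rfl⟩
  exact not_cyc_succ h

theorem M1 (hu : Good u p κ) (hκ : κ * κ = 0) (h1 : a ≠ b) (h2 : a ≠ e) (h3 : b ≠ e) :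
    CT u v κ p Φ x a b b e =
      (if cyc a b e ∧ cyc (x a) (x b) (x e) then CT u v κ p Φ x b e a e else 0) +
      (if cyc a b e ∧ ¬ cyc (x a) (x b) (x e) then CT u v κ p Φ x a e a b else 0) +
      (if cyc a b e ∧ cyc (x a) (x b) (x e) ∧ a = p ∧ b = p + 1 then
        v * κ * CR u v Φ x a b b e else 0) +
      (if cyc a b e ∧ ¬ cyc (x a) (x b) (x e) ∧ b = p ∧ e = p + 1 then
        v * κ * CR u v Φ x a b b e else 0) := by
  by_cases c : cyc a b e
  · have hf : phi v κ p a e = 1 := phi_cyc c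
    by_cases r : cyc (x a) (x b) (x e)
    · simp only [c, r, true_and, not_true_eq_false, false_and, if_true, if_false, add_zero]
      unfold CT
      have e1 : CR u v Φ x b e a e = CR u v Φ x a b b e := by
        unfold CR
        rw [L1_r h1 h2 h3 c r, swapA h1 h2 h3]
      rw [e1, hf]
      have := kphi v hκ p b e
      generalize phi v κ p b e = f at *
      unfold phi
      split_ifs
      · linear_combination (CR u v Φ x a b b e) * v * this
      · ring
    · have r' := (cyc_flip (x.injective.ne h1) (x.injective.ne h2) (x.injective.ne h3)).2 r
      simp only [c, r, true_and, not_true_eq_false, not_false_eq_true,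
        false_and, if_true, if_false, add_zero, zero_add]
      unfold CT
      have e1 : CR u v Φ x a e a b = CR u v Φ x a b b e := by
        unfold CR
        rw [L1_n h1 h2 h3 c r', swapB h1 h2 h3]
      rw [e1, hf]
      have := kphi v hκ p a b
      generalize phi v κ p a b = f at *
      unfold phi
      split_ifs
      · linear_combination (CR u v Φ x a b b e) * v * this
      · ring
  · simp only [c, false_and, if_false, add_zero]
    unfold CT CR
    rw [L1_z hu h1 h2 h3 ((cyc_flip h1 h2 h3).2 c)]
    ring

theorem M2 (hu : Good u p κ) (hκ : κ * κ = 0) (h1 : a ≠ b) (h2 : a ≠ e) (h3 : b ≠ e) :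
    CT u v κ p Φ x a b e a =
      (if cyc a b e ∧ cyc (x a) (x b) (x e) then CT u v κ p Φ x e a e b else 0) +
      (if cyc a b e ∧ ¬ cyc (x a) (x b) (x e) then CT u v κ p Φ x e b a b else 0) +
      (if cyc a b e ∧ cyc (x a) (x b) (x e) ∧ a = p ∧ b = p + 1 then
        v * κ * CR u v Φ x a b e a else 0) +
      (if cyc a b e ∧ ¬ cyc (x a) (x b) (x e) ∧ e = p ∧ a = p + 1 then
        v * κ * CR u v Φ x a b e a else 0) := by
  by_cases c : cyc a b e
  · have hf : phi v κ p e b = 1 := phi_cyc (cyc_rot (cyc_rot c))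
    by_cases r : cyc (x a) (x b) (x e)
    · simp only [c, r, true_and, not_true_eq_false, false_and, if_true, if_false, add_zero]
      unfold CT
      have e1 : CR u v Φ x e a e b = CR u v Φ x a b e a := by
        unfold CR
        rw [L2_r h1 h2 h3 c r, swapC h1 h2 h3]
      rw [e1, hf]
      have := kphi v hκ p e a
      generalize phi v κ p e a = f at *
      unfold phi
      split_ifs
      · linear_combination (CR u v Φ x a b e a) * v * this
      · ring
    · have r' := (cyc_flip (x.injective.ne h1) (x.injective.ne h2) (x.injective.ne h3)).2 r
      simp only [c, r, true_and, not_true_eq_false, not_false_eq_true,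
        false_and, if_true, if_false, add_zero, zero_add]
      unfold CT
      have e1 : CR u v Φ x e b a b = CR u v Φ x a b e a := by
        unfold CR
        rw [L2_n h1 h2 h3 c r', swapD h1 h2 h3]
      rw [e1, hf]
      have := kphi v hκ p a b
      generalize phi v κ p a b = f at *
      unfold phi
      split_ifs
      · linear_combination (CR u v Φ x a b e a) * v * this
      · ring
  · simp only [c, false_and, if_false, add_zero]
    unfold CT CR
    rw [L2_z hu h1 h2 h3 ((cyc_flip h1 h2 h3).2 c)]
    ring

theorem M3 (hu : Good u p κ) (hκ : κ * κ = 0) (h1 : a ≠ b) (h2 : a ≠ e) (h3 : b ≠ e) :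
    CT u v κ p Φ x a b a e =
      (if cyc (x a) (x b) (x e) then CT u v κ p Φ x a b a e else 0) +
      (if cyc a b e ∧ ¬ cyc (x a) (x b) (x e) ∧ a = p ∧ b = p + 1 then
        v * κ * CR u v Φ x b e a b else 0) +
      (if ¬ cyc a b e ∧ ¬ cyc (x a) (x b) (x e) ∧ a = p ∧ e = p + 1 then
        v * κ * CR u v Φ x a e e b else 0) := by
  have k1 := kphi v hκ p a b
  have k2 := kphi v hκ p a e
  by_cases r : cyc (x a) (x b) (x e)
  · simp [r]
  · have r' := (cyc_flip (x.injective.ne h1) (x.injective.ne h2) (x.injective.ne h3)).2 r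
    by_cases c : cyc a b e
    · simp only [c, r, true_and, not_true_eq_false, not_false_eq_true,
        false_and, if_false, add_zero, zero_add]
      unfold CT CR
      generalize phi v κ p a b = f at *
      generalize phi v κ p a e = g at *
      rw [L3_c hu h1 h2 h3 c r', swapE h1 h2 h3]
      split_ifs
      · linear_combination v * (WW u v x b e * WW u v (x * Equiv.swap b e) a b) *
          Φ (x * (Equiv.swap b e * Equiv.swap a b)) * (g * k1 + k2)
      · ring
    · have c' := (cyc_flip h1 h2 h3).2 c
      simp only [c, r, true_and, not_false_eq_true,
        false_and, if_false, add_zero, zero_add]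
      unfold CT CR
      generalize phi v κ p a b = f at *
      generalize phi v κ p a e = g at *
      rw [L3_n hu h1 h2 h3 c' r', swapF h1 h2 h3]
      split_ifs
      · linear_combination v * (WW u v x a e * WW u v (x * Equiv.swap a e) e b) *
          Φ (x * (Equiv.swap a e * Equiv.swap e b)) * (g * k1 + k2)
      · ring

theorem M4 (hu : Good u p κ) (hκ : κ * κ = 0) (h1 : a ≠ b) (h2 : a ≠ e) (h3 : b ≠ e) :
    CT u v κ p Φ x a b e b =
      (if cyc (x a) (x b) (x e) then CT u v κ p Φ x a b e b else 0) +
      (if cyc a b e ∧ ¬ cyc (x a) (x b) (x e) ∧ a = p ∧ b = p + 1 then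
        v * κ * CR u v Φ x e a a b else 0) +
      (if ¬ cyc a b e ∧ ¬ cyc (x a) (x b) (x e) ∧ e = p ∧ b = p + 1 then
        v * κ * CR u v Φ x e b a e else 0) := by
  have k1 := kphi v hκ p a b
  have k2 := kphi v hκ p e b
  by_cases r : cyc (x a) (x b) (x e)
  · simp [r]
  · have r' := (cyc_flip (x.injective.ne h1) (x.injective.ne h2) (x.injective.ne h3)).2 r
    by_cases c : cyc a b e
    · simp only [c, r, true_and, not_true_eq_false, not_false_eq_true,
        false_and, if_false, add_zero, zero_add]
      unfold CT CR
      generalize phi v κ p a b = f at *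
      generalize phi v κ p e b = g at *
      rw [L4_c hu h1 h2 h3 c r', swapG h1 h2 h3]
      split_ifs
      · linear_combination v * (WW u v x e a * WW u v (x * Equiv.swap e a) a b) *
          Φ (x * (Equiv.swap e a * Equiv.swap a b)) * (g * k1 + k2)
      · ring
    · have c' := (cyc_flip h1 h2 h3).2 c
      simp only [c, r, true_and, not_false_eq_true,
        false_and, if_false, add_zero, zero_add]
      unfold CT CR
      generalize phi v κ p a b = f at *
      generalize phi v κ p e b = g at *
      rw [L4_n hu h1 h2 h3 c' r', swapH h1 h2 h3]
      split_ifs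
      · linear_combination v * (WW u v x e b * WW u v (x * Equiv.swap e b) a e) *
          Φ (x * (Equiv.swap e b * Equiv.swap a e)) * (g * k1 + k2)
      · ring

/-- sum over ordered triples of distinct columns -/
def S3 (f : ZMod N → ZMod N → ZMod N → R) : R :=
  ∑ a, ∑ b, ∑ e, if a ≠ b ∧ a ≠ e ∧ b ≠ e then f a b e else 0

theorem S3_rot (f : ZMod N → ZMod N → ZMod N → R) : S3 (fun a b e => f b e a) = S3 f := by
  unfold S3
  conv_lhs =>
    rw [Finset.sum_comm]
    enter [2, b]
    rw [Finset.sum_comm]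
  refine Finset.sum_congr rfl fun a _ => Finset.sum_congr rfl fun b _ =>
    Finset.sum_congr rfl fun e _ => ?_
  exact if_congr (by tauto) rfl rfl

theorem S3_flip (f : ZMod N → ZMod N → ZMod N → R) : S3 (fun a b e => f a e b) = S3 f := by
  unfold S3
  refine Finset.sum_congr rfl fun a _ => ?_
  rw [Finset.sum_comm]
  refine Finset.sum_congr rfl fun b _ =>
    Finset.sum_congr rfl fun e _ => ?_
  exact if_congr (by tauto) rfl rfl

theorem S3_add (f g : ZMod N → ZMod N → ZMod N → R) :
    S3 (fun a b e => f a b e + g a b e) = S3 f + S3 g := by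
  unfold S3
  simp only [← Finset.sum_add_distrib]
  refine Finset.sum_congr rfl fun a _ => Finset.sum_congr rfl fun b _ =>
    Finset.sum_congr rfl fun e _ => ?_
  split_ifs <;> simp

theorem S3_congr {f g : ZMod N → ZMod N → ZMod N → R}
    (h : ∀ a b e, a ≠ b → a ≠ e → b ≠ e → f a b e = g a b e) : S3 f = S3 g := by
  unfold S3
  refine Finset.sum_congr rfl fun a _ => Finset.sum_congr rfl fun b _ =>
    Finset.sum_congr rfl fun e _ => ?_
  split_ifs with hc
  · exact h a b e hc.1 hc.2.1 hc.2.2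
  · rfl

set_option maxHeartbeats 1000000 in
theorem S3_main (hu : Good u p κ) (hκ : κ * κ = 0) (h2 : ∀ r : R, r + r = 0) :
    S3 (fun a b e => CT u v κ p Φ x a b b e) + S3 (fun a b e => CT u v κ p Φ x a b e a) +
    S3 (fun a b e => CT u v κ p Φ x a b a e) + S3 (fun a b e => CT u v κ p Φ x a b e b) = 0 := by
  -- the pieces
  set r3 := S3 (fun a b e => if cyc (x a) (x b) (x e) then CT u v κ p Φ x a b a e else 0) with hr3
  set r4 := S3 (fun a b e => if cyc (x a) (x b) (x e) then CT u v κ p Φ x a b e b else 0) with hr4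
  set q1 := S3 (fun a b e => if cyc a b e ∧ cyc (x a) (x b) (x e) ∧ a = p ∧ b = p + 1 then
        v * κ * CR u v Φ x a b b e else 0) with hq1
  set q2 := S3 (fun a b e => if cyc a b e ∧ ¬ cyc (x a) (x b) (x e) ∧ b = p ∧ e = p + 1 then
        v * κ * CR u v Φ x a b b e else 0) with hq2
  set q3 := S3 (fun a b e => if cyc a b e ∧ cyc (x a) (x b) (x e) ∧ a = p ∧ b = p + 1 then
        v * κ * CR u v Φ x a b e a else 0) with hq3
  set q4 := S3 (fun a b e => if cyc a b e ∧ ¬ cyc (x a) (x b) (x e) ∧ e = p ∧ a = p + 1 then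
        v * κ * CR u v Φ x a b e a else 0) with hq4
  have A1 := S3_congr (fun a b e h1 h2 h3 => M1 (v := v) (x := x) Φ hu hκ (a := a) (b := b) (e := e) h1 h2 h3)
  have A2 := S3_congr (fun a b e h1 h2 h3 => M2 (v := v) (x := x) Φ hu hκ (a := a) (b := b) (e := e) h1 h2 h3)
  have A3 := S3_congr (fun a b e h1 h2 h3 => M3 (v := v) (x := x) Φ hu hκ (a := a) (b := b) (e := e) h1 h2 h3)
  have A4 := S3_congr (fun a b e h1 h2 h3 => M4 (v := v) (x := x) Φ hu hκ (a := a) (b := b) (e := e) h1 h2 h3)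
  simp only [S3_add] at A1 A2 A3 A4
  rw [← hq1, ← hq2] at A1
  rw [← hq3, ← hq4] at A2
  rw [← hr3] at A3
  rw [← hr4] at A4
  have K1 : ∀ {a b e : ZMod N}, a ≠ b → a ≠ e → b ≠ e → (cyc b e a ↔ cyc a b e) ∧
      (cyc e a b ↔ cyc a b e) ∧ (cyc a e b ↔ ¬ cyc a b e) ∧ (cyc e b a ↔ ¬ cyc a b e) ∧
      (cyc b a e ↔ ¬ cyc a b e) := fun {a b e} h1 h2 h3 =>
    ⟨cyc_iff_rot.symm, cyc_iff_rot, cyc_flip h1 h2 h3, cyc_iff_rot.symm.trans (cyc_flip h1 h2 h3),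
      cyc_iff_rot.trans (cyc_flip h1 h2 h3)⟩
  have K2 : ∀ {a b e : ZMod N}, a ≠ b → a ≠ e → b ≠ e → _ := fun {a b e} h1 h2 h3 =>
    K1 (x.injective.ne h1) (x.injective.ne h2) (x.injective.ne h3)
  -- reindexings
  have B1 : S3 (fun a b e => if cyc a b e ∧ cyc (x a) (x b) (x e) then
      CT u v κ p Φ x b e a e else 0) =
      S3 (fun a b e => if cyc a b e ∧ cyc (x a) (x b) (x e) then
      CT u v κ p Φ x a b e b else 0) := by
    rw [← S3_rot (fun a b e => if cyc a b e ∧ cyc (x a) (x b) (x e) then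
      CT u v κ p Φ x a b e b else 0)]
    refine S3_congr fun a b e h1 h2 h3 => ?_
    have c1 := K1 h1 h2 h3
    have c2 := K2 h1 h2 h3
    clear A1 A2 A3 A4
    refine if_congr ?_ rfl rfl
    grind only
  have B2 : S3 (fun a b e => if cyc a b e ∧ ¬ cyc (x a) (x b) (x e) then
      CT u v κ p Φ x a e a b else 0) =
      S3 (fun a b e => if ¬ cyc a b e ∧ cyc (x a) (x b) (x e) then
      CT u v κ p Φ x a b a e else 0) := by
    rw [← S3_flip (fun a b e => if ¬ cyc a b e ∧ cyc (x a) (x b) (x e) then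
      CT u v κ p Φ x a b a e else 0)]
    refine S3_congr fun a b e h1 h2 h3 => ?_
    have c1 := K1 h1 h2 h3
    have c2 := K2 h1 h2 h3
    clear A1 A2 A3 A4
    refine if_congr ?_ rfl rfl
    grind only
  have B3 : S3 (fun a b e => if cyc a b e ∧ cyc (x a) (x b) (x e) then
      CT u v κ p Φ x e a e b else 0) =
      S3 (fun a b e => if cyc a b e ∧ cyc (x a) (x b) (x e) then
      CT u v κ p Φ x a b a e else 0) := by
    rw [← S3_rot]
    refine S3_congr fun a b e h1 h2 h3 => ?_
    have c1 := K1 h1 h2 h3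
    have c2 := K2 h1 h2 h3
    clear A1 A2 A3 A4
    refine if_congr ?_ rfl rfl
    grind only
  have B4 : S3 (fun a b e => if cyc a b e ∧ ¬ cyc (x a) (x b) (x e) then
      CT u v κ p Φ x e b a b else 0) =
      S3 (fun a b e => if ¬ cyc a b e ∧ cyc (x a) (x b) (x e) then
      CT u v κ p Φ x a b e b else 0) := by
    rw [← S3_flip (fun a b e => if ¬ cyc a b e ∧ cyc (x a) (x b) (x e) then
      CT u v κ p Φ x a b e b else 0), ← S3_rot]
    refine S3_congr fun a b e h1 h2 h3 => ?_
    have c1 := K1 h1 h2 h3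
    have c2 := K2 h1 h2 h3
    clear A1 A2 A3 A4
    refine if_congr ?_ rfl rfl
    grind only
  have C3 : r3 = S3 (fun a b e => if cyc a b e ∧ cyc (x a) (x b) (x e) then
      CT u v κ p Φ x a b a e else 0) + S3 (fun a b e => if ¬ cyc a b e ∧ cyc (x a) (x b) (x e) then
      CT u v κ p Φ x a b a e else 0) := by
    rw [← S3_add, hr3]
    refine S3_congr fun a b e h1 h2 h3 => ?_
    by_cases c : cyc a b e <;> simp [c]
  have C4 : r4 = S3 (fun a b e => if cyc a b e ∧ cyc (x a) (x b) (x e) then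
      CT u v κ p Φ x a b e b else 0) + S3 (fun a b e => if ¬ cyc a b e ∧ cyc (x a) (x b) (x e) then
      CT u v κ p Φ x a b e b else 0) := by
    rw [← S3_add, hr4]
    refine S3_congr fun a b e h1 h2 h3 => ?_
    by_cases c : cyc a b e <;> simp [c]
  have D1 : S3 (fun a b e => if cyc a b e ∧ ¬ cyc (x a) (x b) (x e) ∧ a = p ∧ b = p + 1 then
        v * κ * CR u v Φ x b e a b else 0) = q4 := by
    rw [hq4, ← S3_rot (fun a b e => if cyc a b e ∧ ¬ cyc (x a) (x b) (x e) ∧ e = p ∧ a = p + 1 then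
        v * κ * CR u v Φ x a b e a else 0)]
    refine S3_congr fun a b e h1 h2 h3 => ?_
    have c1 := K1 h1 h2 h3
    have c2 := K2 h1 h2 h3
    clear A1 A2 A3 A4
    refine if_congr ?_ rfl rfl
    grind only
  have D2 : S3 (fun a b e => if ¬ cyc a b e ∧ ¬ cyc (x a) (x b) (x e) ∧ a = p ∧ e = p + 1 then
        v * κ * CR u v Φ x a e e b else 0) = q1 := by
    rw [hq1, ← S3_flip (fun a b e => if cyc a b e ∧ cyc (x a) (x b) (x e) ∧ a = p ∧ b = p + 1 then
        v * κ * CR u v Φ x a b b e else 0)]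
    refine S3_congr fun a b e h1 h2 h3 => ?_
    have c1 := K1 h1 h2 h3
    have c2 := K2 h1 h2 h3
    clear A1 A2 A3 A4
    refine if_congr ?_ rfl rfl
    grind only
  have D3 : S3 (fun a b e => if cyc a b e ∧ ¬ cyc (x a) (x b) (x e) ∧ a = p ∧ b = p + 1 then
        v * κ * CR u v Φ x e a a b else 0) = q2 := by
    rw [hq2, ← S3_rot]
    refine S3_congr fun a b e h1 h2 h3 => ?_
    have c1 := K1 h1 h2 h3
    have c2 := K2 h1 h2 h3
    clear A1 A2 A3 A4
    refine if_congr ?_ rfl rfl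
    grind only
  have D4 : S3 (fun a b e => if ¬ cyc a b e ∧ ¬ cyc (x a) (x b) (x e) ∧ e = p ∧ b = p + 1 then
        v * κ * CR u v Φ x e b a e else 0) = q3 := by
    rw [hq3, ← S3_flip (fun a b e => if cyc a b e ∧ cyc (x a) (x b) (x e) ∧ a = p ∧ b = p + 1 then
        v * κ * CR u v Φ x a b e a else 0), ← S3_rot]
    refine S3_congr fun a b e h1 h2 h3 => ?_
    have c1 := K1 h1 h2 h3
    have c2 := K2 h1 h2 h3
    clear A1 A2 A3 A4
    refine if_congr ?_ rfl rfl
    grind only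
  rw [A1, A2, A3, A4, B1, B2, B3, B4, C3, C4, D1, D2, D3, D4]
  linear_combination h2 q1 + h2 q2 + h2 q3 + h2 q4 +
    h2 (S3 (fun a b e => if cyc a b e ∧ cyc (x a) (x b) (x e) then
      CT u v κ p Φ x a b a e else 0)) +
    h2 (S3 (fun a b e => if ¬ cyc a b e ∧ cyc (x a) (x b) (x e) then
      CT u v κ p Φ x a b a e else 0)) +
    h2 (S3 (fun a b e => if cyc a b e ∧ cyc (x a) (x b) (x e) then
      CT u v κ p Φ x a b e b else 0)) +
    h2 (S3 (fun a b e => if ¬ cyc a b e ∧ cyc (x a) (x b) (x e) then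
      CT u v κ p Φ x a b e b else 0))

end T4

section T5
set_option linter.unusedSectionVars false
variable {N : ℕ} [NeZero N] {R : Type*} [CommRing R]

theorem linkA {a b c d : ZMod N} (hab : a ≠ b) (hac : a ≠ c) (had : a ≠ d) (hbc : b ≠ c)
    (hbd : b ≠ d) (hcd : c ≠ d) :
    ((if inIoo c d a then 1 else 0 : ℤ) - (if inIoo c d b then 1 else 0)) =
      (if inIoo a b d then 1 else 0) - (if inIoo a b c then 1 else 0) := by
  have ha := ZMod.val_lt a
  have hb := ZMod.val_lt b
  have hc := ZMod.val_lt c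
  have hd := ZMod.val_lt d
  have hab := valNe hab
  have hac := valNe hac
  have had := valNe had
  have hbc := valNe hbc
  have hbd := valNe hbd
  have hcd := valNe hcd
  simp only [inIoo, valSub]
  generalize a.val = a at *
  generalize b.val = b at *
  generalize c.val = c at *
  generalize d.val = d at *
  rcases lt_or_gt_of_ne hab with h1 | h1 <;> rcases lt_or_gt_of_ne hac with h2 | h2 <;>
  rcases lt_or_gt_of_ne had with h3 | h3 <;> rcases lt_or_gt_of_ne hbc with h4 | h4 <;>
  rcases lt_or_gt_of_ne hbd with h5 | h5 <;> rcases lt_or_gt_of_ne hcd with h6 | h6 <;>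
  first
  | (exfalso; omega)
  | (simp only [h1.le, h2.le, h3.le, h4.le, h5.le, h6.le, h1.not_ge, h2.not_ge, h3.not_ge,
      h4.not_ge, h5.not_ge, h6.not_ge, if_true, if_false]
     split_ifs <;> omega)

theorem card4 {a b c d : ZMod N} (hab : a ≠ b) (hac : a ≠ c) (had : a ≠ d) (hbc : b ≠ c)
    (hbd : b ≠ d) (hcd : c ≠ d) (P : ZMod N → Prop) [DecidablePred P] :
    (({a, b, c, d} : Finset (ZMod N)).filter P).card =
      (if P a then 1 else 0) + (if P b then 1 else 0) + (if P c then 1 else 0) +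
        (if P d then 1 else 0) := by
  rw [Finset.card_filter, Finset.sum_insert (by simp [*]), Finset.sum_insert (by simp [*]),
    Finset.sum_insert (by simp [*]), Finset.sum_singleton]
  ring

theorem disj4 (u : ZMod N → ZMod N → R) (v : R) (x : GridState N)
    {a b c d : ZMod N} (hab : a ≠ b) (hac : a ≠ c) (had : a ≠ d) (hbc : b ≠ c)
    (hbd : b ≠ d) (hcd : c ≠ d) :
    WW u v x a b * WW u v (x * Equiv.swap a b) c d =
      WW u v x c d * WW u v (x * Equiv.swap c d) a b := by
  have f1 : ∀ k, k ∉ ({a, b, c, d} : Finset (ZMod N)) → (x * Equiv.swap a b) k = x k := by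
    intro k hk
    simp only [Finset.mem_insert, Finset.mem_singleton, not_or] at hk
    rw [Equiv.Perm.mul_apply, Equiv.swap_apply_of_ne_of_ne hk.1 hk.2.1]
  have f2 : ∀ k, k ∉ ({a, b, c, d} : Finset (ZMod N)) → (x * Equiv.swap c d) k = x k := by
    intro k hk
    simp only [Finset.mem_insert, Finset.mem_singleton, not_or] at hk
    rw [Equiv.Perm.mul_apply, Equiv.swap_apply_of_ne_of_ne hk.2.2.1 hk.2.2.2]
  rw [WW_eq u v {a, b, c, d} x x (fun _ _ => rfl) a b (by simp),
    WW_eq u v {a, b, c, d} x x (fun _ _ => rfl) c d (by simp),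
    WW_eq u v {a, b, c, d} x (x * Equiv.swap a b) f1 c d (by simp),
    WW_eq u v {a, b, c, d} x (x * Equiv.swap c d) f2 a b (by simp)]
  simp only [card4 hab hac had hbc hbd hcd, Equiv.Perm.mul_apply, Equiv.swap_apply_left,
    Equiv.swap_apply_right, Equiv.swap_apply_of_ne_of_ne hac.symm hbc.symm,
    Equiv.swap_apply_of_ne_of_ne had.symm hbd.symm, Equiv.swap_apply_of_ne_of_ne hac had,
    Equiv.swap_apply_of_ne_of_ne hbc hbd, not_ioo_left, not_ioo_right, false_and, if_false,
    zero_add, add_zero]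
  have e1 := linkA hab hac had hbc hbd hcd
  have i := fun {a b} (h : a ≠ b) => x.injective.ne (a₁ := a) (a₂ := b) h
  have e2 := linkA (i hab) (i hac) (i had) (i hbc) (i hbd) (i hcd)
  have key : ((if inIoo a b c ∧ inIoo (x a) (x b) (x c) then 1 else 0) +
      (if inIoo a b d ∧ inIoo (x a) (x b) (x d) then 1 else 0)) +
      ((if inIoo c d a ∧ inIoo (x c) (x d) (x b) then 1 else 0) +
      (if inIoo c d b ∧ inIoo (x c) (x d) (x a) then 1 else 0)) =
      ((if inIoo c d a ∧ inIoo (x c) (x d) (x a) then 1 else 0) +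
      (if inIoo c d b ∧ inIoo (x c) (x d) (x b) then 1 else 0)) +
      ((if inIoo a b c ∧ inIoo (x a) (x b) (x d) then 1 else 0) +
      (if inIoo a b d ∧ inIoo (x a) (x b) (x c) then 1 else 0) : ℕ) := by
    by_cases p1 : inIoo a b c <;> by_cases p2 : inIoo a b d <;> by_cases p3 : inIoo c d a <;>
    by_cases p4 : inIoo c d b <;> simp only [p1, p2, p3, p4, if_true, if_false] at e1 <;>
    first
    | (exfalso; omega)
    | (simp only [p1, p2, p3, p4, true_and, false_and, if_false]
       try (split_ifs at * <;> omega))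
  rw [mul_mul_mul_comm, ← pow_add, mul_mul_mul_comm, ← pow_add, key]
  ring

theorem same1 {u : ZMod N → ZMod N → R} {v κ : R} {p : ZMod N} (x : GridState N)
    (hu : Good u p κ) {a b : ZMod N} (h : a ≠ b) :
    WW u v x a b * WW u v (x * Equiv.swap a b) a b = if a = p ∧ b = p + 1 then κ else 0 := by
  have f1 : ∀ k, k ∉ ({a, b} : Finset (ZMod N)) → (x * Equiv.swap a b) k = x k := by
    intro k hk
    simp only [Finset.mem_insert, Finset.mem_singleton, not_or] at hk
    rw [Equiv.Perm.mul_apply, Equiv.swap_apply_of_ne_of_ne hk.1 hk.2]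
  rw [WW_eq u v {a, b} x x (fun _ _ => rfl) a b (by simp),
    WW_eq u v {a, b} x (x * Equiv.swap a b) f1 a b (by simp)]
  simp only [Equiv.Perm.mul_apply, Equiv.swap_apply_left, Equiv.swap_apply_right]
  have : ∀ (y : GridState N) s t, (({a, b} : Finset (ZMod N)).filter
      (fun k => inIoo a b k ∧ inIoo s t (y (Equiv.swap a b k)))).card = 0 := by
    intro y s t
    rw [Finset.card_eq_zero, Finset.filter_eq_empty_iff]
    intro k hk
    simp only [Finset.mem_insert, Finset.mem_singleton] at hk
    rcases hk with rfl | rfl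
    · exact fun h => not_ioo_left h.1
    · exact fun h => not_ioo_right h.1
  have h2 : ∀ (y : GridState N) s t, (({a, b} : Finset (ZMod N)).filter
      (fun k => inIoo a b k ∧ inIoo s t (y k))).card = 0 := by
    intro y s t
    rw [Finset.card_eq_zero, Finset.filter_eq_empty_iff]
    intro k hk
    simp only [Finset.mem_insert, Finset.mem_singleton] at hk
    rcases hk with rfl | rfl
    · exact fun h => not_ioo_left h.1
    · exact fun h => not_ioo_right h.1
  rw [this, h2, pow_zero, mul_one, mul_one, QK hu h (x.injective.ne h) (by simp)]

theorem same2 {u : ZMod N → ZMod N → R} {v κ : R} {p : ZMod N} (x : GridState N)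
    (hu : Good u p κ) {a b : ZMod N} (h : a ≠ b) :
    WW u v x a b * WW u v (x * Equiv.swap a b) b a = 0 := by
  have f1 : ∀ k, k ∉ ({a, b} : Finset (ZMod N)) → (x * Equiv.swap a b) k = x k := by
    intro k hk
    simp only [Finset.mem_insert, Finset.mem_singleton, not_or] at hk
    rw [Equiv.Perm.mul_apply, Equiv.swap_apply_of_ne_of_ne hk.1 hk.2]
  rw [WW_eq u v {a, b} x x (fun _ _ => rfl) a b (by simp),
    WW_eq u v {a, b} x (x * Equiv.swap a b) f1 b a (by simp)]
  simp only [Equiv.Perm.mul_apply, Equiv.swap_apply_left, Equiv.swap_apply_right]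
  rw [mul_mul_mul_comm, QZ hu h (x.injective.ne h), zero_mul]

theorem sum_split {a b : ZMod N} (h : a ≠ b) (g : ZMod N → R) :
    ∑ c, g c = g a + g b + ∑ c, if a ≠ c ∧ b ≠ c then g c else 0 := by
  have : ∀ c, g c = (if c = a then g a else 0) + (if c = b then g b else 0) +
      (if a ≠ c ∧ b ≠ c then g c else 0) := by
    intro c
    by_cases h1 : c = a
    · subst h1; simp [h]
    · by_cases h2 : c = b
      · subst h2; simp [h1]
      · simp [h1, h2, Ne.symm h1, Ne.symm h2]
  rw [Finset.sum_congr rfl fun c _ => this c]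
  simp [Finset.sum_add_distrib]

theorem square {u : ZMod N → ZMod N → R} {v κ : R} {p : ZMod N} (Φ : GridState N → R)
    (x : GridState N) (hu : Good u p κ) (hκ : κ * κ = 0) (h2 : ∀ r : R, r + r = 0)
    (hp : p ≠ p + 1) :
    (∑ a, ∑ b, if a ≠ b then ∑ c, ∑ d, if c ≠ d then CT u v κ p Φ x a b c d else 0 else 0)
      = κ * Φ x := by
  -- split the inner sum
  have hs : ∀ a b : ZMod N, a ≠ b →
      (∑ c, ∑ d, if c ≠ d then CT u v κ p Φ x a b c d else 0) =
      CT u v κ p Φ x a b a b + CT u v κ p Φ x a b b a +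
      (∑ e, if a ≠ e ∧ b ≠ e then CT u v κ p Φ x a b b e + CT u v κ p Φ x a b e a +
        CT u v κ p Φ x a b a e + CT u v κ p Φ x a b e b else 0) +
      (∑ c, ∑ d, if a ≠ c ∧ b ≠ c ∧ a ≠ d ∧ b ≠ d ∧ c ≠ d then
        CT u v κ p Φ x a b c d else 0) := by
    intro a b hab
    rw [sum_split hab, sum_split hab, sum_split hab (fun d => if b ≠ d then _ else _)]
    have : ∀ c, (if a ≠ c ∧ b ≠ c then ∑ d, if c ≠ d then CT u v κ p Φ x a b c d else 0 else 0)
      = (if a ≠ c ∧ b ≠ c then CT u v κ p Φ x a b c a else 0) +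
        (if a ≠ c ∧ b ≠ c then CT u v κ p Φ x a b c b else 0) +
        (∑ d, if a ≠ c ∧ b ≠ c ∧ a ≠ d ∧ b ≠ d ∧ c ≠ d then
        CT u v κ p Φ x a b c d else 0) := by
      intro c
      split_ifs with hc
      · rw [sum_split hab, if_pos hc.1.symm, if_pos hc.2.symm]
        congr 1
        refine Finset.sum_congr rfl fun d _ => ?_
        simp only [hc.1, hc.2, ne_eq, not_false_eq_true, true_and]
        by_cases q1 : a = d <;> by_cases q2 : b = d <;> simp [q1, q2]
      · rw [Finset.sum_eq_zero]
        · simp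
        · intro d _
          rw [if_neg]
          tauto
    rw [Finset.sum_congr rfl fun c _ => this c]
    simp only [ne_eq, not_true_eq_false, if_false, hab, hab.symm, not_false_eq_true, if_true,
      Finset.sum_add_distrib, zero_add, add_zero]
    have e1 : ∀ e, (if ¬ a = e ∧ ¬ b = e then CT u v κ p Φ x a b b e + CT u v κ p Φ x a b e a +
        CT u v κ p Φ x a b a e + CT u v κ p Φ x a b e b else 0) =
        (if ¬ a = e ∧ ¬ b = e then if ¬ b = e then CT u v κ p Φ x a b b e else 0 else 0) +
        (if ¬ a = e ∧ ¬ b = e then CT u v κ p Φ x a b e a else 0) +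
        (if ¬ a = e ∧ ¬ b = e then if ¬ a = e then CT u v κ p Φ x a b a e else 0 else 0) +
        (if ¬ a = e ∧ ¬ b = e then CT u v κ p Φ x a b e b else 0) := by
      intro e
      by_cases q1 : a = e <;> by_cases q2 : b = e <;> simp [q1, q2]
    rw [Finset.sum_congr rfl fun c _ => e1 c]
    simp only [Finset.sum_add_distrib]
    ring
  have hs' : ∀ a b : ZMod N,
      (if a ≠ b then ∑ c, ∑ d, if c ≠ d then CT u v κ p Φ x a b c d else 0 else 0) =
      (if a = p ∧ b = p + 1 then κ * Φ x else 0) +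
      (∑ e, if a ≠ b ∧ a ≠ e ∧ b ≠ e then CT u v κ p Φ x a b b e + CT u v κ p Φ x a b e a +
        CT u v κ p Φ x a b a e + CT u v κ p Φ x a b e b else 0) +
      (∑ c, ∑ d, if a ≠ b ∧ a ≠ c ∧ b ≠ c ∧ a ≠ d ∧ b ≠ d ∧ c ≠ d then
        CT u v κ p Φ x a b c d else 0) := by
    intro a b
    by_cases hab : a = b
    · subst hab
      have : ¬ (a = p ∧ a = p + 1) := by
        rintro ⟨h1, h2⟩
        exact hp (h1.symm.trans h2)
      simp [this]
    · rw [if_pos hab, hs a b hab]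
      have e1 : CT u v κ p Φ x a b a b = (if a = p ∧ b = p + 1 then κ * Φ x else 0) := by
        unfold CT CR
        rw [same1 x hu hab]
        have k1 := kphi v hκ p a b
        split_ifs
        · rw [Equiv.swap_mul_self, mul_one]
          linear_combination Φ x * (phi v κ p a b + 1) * k1
        · ring
      have e2 : CT u v κ p Φ x a b b a = 0 := by
        unfold CT CR
        rw [same2 x hu hab]
        ring
      rw [e1, e2]
      simp [hab]
  rw [Finset.sum_congr rfl fun a _ => Finset.sum_congr rfl fun b _ => hs' a b]
  simp only [Finset.sum_add_distrib]
  have t1 : (∑ a : ZMod N, ∑ b : ZMod N, if a = p ∧ b = p + 1 then κ * Φ x else 0) = κ * Φ x := by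
    simp [ite_and]
  have t2 := S3_main (v := v) (x := x) Φ hu hκ h2
  rw [← S3_add, ← S3_add, ← S3_add] at t2
  unfold S3 at t2
  have t3 : (∑ a : ZMod N, ∑ b : ZMod N, ∑ c : ZMod N, ∑ d : ZMod N,
      if a ≠ b ∧ a ≠ c ∧ b ≠ c ∧ a ≠ d ∧ b ≠ d ∧ c ≠ d then
        CT u v κ p Φ x a b c d else 0) = 0 := by
    have conv : (∑ a : ZMod N, ∑ b : ZMod N, ∑ c : ZMod N, ∑ d : ZMod N,
      if a ≠ b ∧ a ≠ c ∧ b ≠ c ∧ a ≠ d ∧ b ≠ d ∧ c ≠ d then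
        CT u v κ p Φ x a b c d else 0) =
        ∑ t : (ZMod N × ZMod N) × (ZMod N × ZMod N), if t.1.1 ≠ t.1.2 ∧ t.1.1 ≠ t.2.1 ∧
        t.1.2 ≠ t.2.1 ∧ t.1.1 ≠ t.2.2 ∧ t.1.2 ≠ t.2.2 ∧ t.2.1 ≠ t.2.2 then
        CT u v κ p Φ x t.1.1 t.1.2 t.2.1 t.2.2 else 0 := by
      simp only [Fintype.sum_prod_type]
    rw [conv]
    refine Finset.sum_involution (fun t _ => (t.2, t.1)) ?_ ?_ (fun _ _ => Finset.mem_univ _)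
      (fun _ _ => rfl)
    · rintro ⟨⟨a, b⟩, ⟨c, d⟩⟩ _
      dsimp only
      by_cases hc : a ≠ b ∧ a ≠ c ∧ b ≠ c ∧ a ≠ d ∧ b ≠ d ∧ c ≠ d
      · obtain ⟨hab, hac, hbc, had, hbd, hcd⟩ := hc
        rw [if_pos ⟨hab, hac, hbc, had, hbd, hcd⟩, if_pos ⟨hcd, hac.symm, had.symm, hbc.symm, hbd.symm, hab⟩]
        have : CT u v κ p Φ x c d a b = CT u v κ p Φ x a b c d := by
          unfold CT CR
          have hcomm : Equiv.swap c d * Equiv.swap a b = Equiv.swap a b * Equiv.swap c d := by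
            ext k : 1
            simp only [Equiv.Perm.mul_apply, Equiv.swap_apply_def]
            grind
          rw [disj4 u v x hab hac had hbc hbd hcd, hcomm]
          ring
        rw [this, h2]
      · rw [if_neg hc, if_neg (by tauto), add_zero]
    · rintro ⟨⟨a, b⟩, ⟨c, d⟩⟩ _ hne heq
      simp only [Prod.mk.injEq] at heq
      apply hne
      dsimp only
      rw [if_neg]
      rintro ⟨_, hac, _⟩
      exact hac heq.1.1.symm
  rw [t1, t2, t3, add_zero, add_zero]

end T5

section T6
set_option linter.unusedSectionVars false

/-! ### operators counting torus rectangles -/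
section ops
variable {N : ℕ} [NeZero N]

theorem basisMap_single {n : ℕ} (f : GridState n → GC n) (x : GridState n) (r : Rng n) :
    basisMap f (Finsupp.single x r) = r • f x := by
  simp [basisMap]

theorem GC_ext {n : ℕ} {f g : GC n →ₗ[Rng n] GC n}
    (h : ∀ x y, f (Finsupp.single x 1) y = g (Finsupp.single x 1) y) : f = g := by
  refine Finsupp.lhom_ext fun x r => ?_
  have : (Finsupp.single x r : GC n) = r • Finsupp.single x 1 := by simp
  rw [this, map_smul, map_smul]
  congr 1
  ext1 y
  exact h x y

/-- the operator with weights `w` on torus rectangles -/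
def op (w : GridState N → ZMod N → ZMod N → Rng N) : GC N →ₗ[Rng N] GC N :=
  basisMap fun x => ∑ a, ∑ b, if a ≠ b then Finsupp.single (x * Equiv.swap a b) (w x a b) else 0

theorem op_single (w : GridState N → ZMod N → ZMod N → Rng N) (x : GridState N) (r : Rng N) :
    op w (Finsupp.single x r) = r • ∑ a, ∑ b,
      if a ≠ b then Finsupp.single (x * Equiv.swap a b) (w x a b) else 0 := basisMap_single _ _ _

theorem op_congr {w w' : GridState N → ZMod N → ZMod N → Rng N}
    (h : ∀ x a b, a ≠ b → w x a b = w' x a b) : op w = op w' := by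
  unfold op
  congr 1
  ext1 x
  refine Finset.sum_congr rfl fun a _ => Finset.sum_congr rfl fun b _ => ?_
  split_ifs with hab
  · rw [h x a b hab]
  · rfl

theorem op_add (w w' : GridState N → ZMod N → ZMod N → Rng N) :
    op w + op w' = op (fun x a b => w x a b + w' x a b) := by
  refine GC_ext fun x y => ?_
  rw [LinearMap.add_apply, op_single, op_single, op_single, one_smul, one_smul, one_smul,
    ← Finset.sum_add_distrib]
  congr 1
  refine Finset.sum_congr rfl fun a _ => ?_
  rw [← Finset.sum_add_distrib]
  refine Finset.sum_congr rfl fun b _ => ?_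
  split_ifs <;> simp

theorem op_comp (w w' : GridState N → ZMod N → ZMod N → Rng N) (x y : GridState N) :
    (op w' ∘ₗ op w) (Finsupp.single x 1) y =
      ∑ a, ∑ b, if a ≠ b then ∑ c, ∑ d, if c ≠ d then
        w x a b * w' (x * Equiv.swap a b) c d *
          (if x * (Equiv.swap a b * Equiv.swap c d) = y then 1 else 0) else 0 else 0 := by
  rw [LinearMap.comp_apply, op_single, one_smul, map_sum, Finsupp.finset_sum_apply]
  refine Finset.sum_congr rfl fun a _ => ?_
  rw [map_sum, Finsupp.finset_sum_apply]
  refine Finset.sum_congr rfl fun b _ => ?_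
  split_ifs with hab
  · rw [op_single, Finsupp.smul_apply, Finsupp.finset_sum_apply, Finset.smul_sum]
    refine Finset.sum_congr rfl fun c _ => ?_
    rw [Finsupp.finset_sum_apply, Finset.smul_sum]
    refine Finset.sum_congr rfl fun d _ => ?_
    split_ifs with hcd h
    · rw [← mul_assoc] at h
      simp [h, Finsupp.single_apply]
    · rw [← mul_assoc] at h
      simp [h, Finsupp.single_apply]
    · simp
  · simp

/-- projection onto the span of the states satisfying `P` -/
def prj (P : GridState N → Prop) : GC N →ₗ[Rng N] GC N :=
  basisMap fun x => if P x then Finsupp.single x 1 else 0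

theorem prj_single (P : GridState N → Prop) (x : GridState N) (r : Rng N) :
    prj P (Finsupp.single x r) = if P x then Finsupp.single x r else 0 := by
  unfold prj
  rw [basisMap_single]
  split_ifs <;> simp

theorem prj_op_prj (P Q : GridState N → Prop) (w : GridState N → ZMod N → ZMod N → Rng N) :
    prj P ∘ₗ op w ∘ₗ prj Q =
      op (fun x a b => if Q x ∧ P (x * Equiv.swap a b) then w x a b else 0) := by
  refine GC_ext fun x y => ?_
  rw [LinearMap.comp_apply, LinearMap.comp_apply, prj_single, op_single, one_smul]
  split_ifs with hQ
  · rw [op_single, one_smul, map_sum]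
    congr 1
    refine Finset.sum_congr rfl fun a _ => ?_
    rw [map_sum]
    refine Finset.sum_congr rfl fun b _ => ?_
    by_cases hab : a ≠ b
    · rw [if_pos hab, if_pos hab, prj_single]
      by_cases hP : P (x * Equiv.swap a b) <;> simp [hP, hQ]
    · rw [if_neg hab, if_neg hab, map_zero]
  · simp [hQ]

theorem prj_prj (P Q : GridState N → Prop) : prj P ∘ₗ prj Q = prj (fun x => Q x ∧ P x) := by
  refine GC_ext fun x y => ?_
  rw [LinearMap.comp_apply, prj_single, prj_single]
  by_cases h1 : P x <;> by_cases h2 : Q x <;> simp [h1, h2, prj_single]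

theorem prj_id (P : GridState N → Prop) : prj P + prj (fun x => ¬ P x) = LinearMap.id := by
  refine GC_ext fun x y => ?_
  rw [LinearMap.add_apply, prj_single, prj_single]
  by_cases h1 : P x  <;> simp [h1]

end ops

/-! ### the ring of coefficients -/
abbrev D1 (A : Type*) [CommRing A] := DualNumber A
abbrev D2 (A : Type*) [CommRing A] := DualNumber (DualNumber A)

section D
variable {A : Type*} [CommRing A]

def jA (a : A) : D2 A := TrivSqZeroExt.inl (TrivSqZeroExt.inl a)
def eS : D2 A := TrivSqZeroExt.inr 1
def eT : D2 A := TrivSqZeroExt.inl (TrivSqZeroExt.inr 1)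

def c00 : D2 A →+ A where
  toFun z := z.fst.fst
  map_zero' := rfl
  map_add' _ _ := rfl
def c01 : D2 A →+ A where
  toFun z := z.fst.snd
  map_zero' := rfl
  map_add' _ _ := rfl
def c10 : D2 A →+ A where
  toFun z := z.snd.fst
  map_zero' := rfl
  map_add' _ _ := rfl
def c11 : D2 A →+ A where
  toFun z := z.snd.snd
  map_zero' := rfl
  map_add' _ _ := rfl

theorem c00_mul (y z : D2 A) : c00 (y * z) = c00 y * c00 z := by
  change (y * z).fst.fst = y.fst.fst * z.fst.fst
  simp
theorem c01_mul (y z : D2 A) : c01 (y * z) = c00 y * c01 z + c01 y * c00 z := by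
  change (y * z).fst.snd = y.fst.fst * z.fst.snd + y.fst.snd * z.fst.fst
  simp only [TrivSqZeroExt.fst_mul, TrivSqZeroExt.snd_mul, smul_eq_mul, MulOpposite.smul_eq_mul_unop,
    MulOpposite.unop_op]
theorem c10_mul (y z : D2 A) : c10 (y * z) = c00 y * c10 z + c10 y * c00 z := by
  change (y * z).snd.fst = y.fst.fst * z.snd.fst + y.snd.fst * z.fst.fst
  simp only [TrivSqZeroExt.fst_mul, TrivSqZeroExt.snd_mul, smul_eq_mul, MulOpposite.smul_eq_mul_unop,
    MulOpposite.unop_op, TrivSqZeroExt.fst_add]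
theorem c11_mul (y z : D2 A) : c11 (y * z) = c00 y * c11 z + c11 y * c00 z +
    c01 y * c10 z + c10 y * c01 z := by
  change (y * z).snd.snd = y.fst.fst * z.snd.snd + y.snd.snd * z.fst.fst +
    y.fst.snd * z.snd.fst + y.snd.fst * z.fst.snd
  simp only [TrivSqZeroExt.fst_mul, TrivSqZeroExt.snd_mul, smul_eq_mul, MulOpposite.smul_eq_mul_unop,
    MulOpposite.unop_op, TrivSqZeroExt.snd_add]
  ring

theorem jA_mul (a b : A) : jA (a * b) = jA a * jA b := by
  simp [jA]
theorem jA_one : jA (1 : A) = 1 := rfl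

theorem cj00 (a : A) : c00 (jA a) = a := rfl
theorem cj01 (a : A) : c01 (jA a) = 0 := rfl
theorem cj10 (a : A) : c10 (jA a) = 0 := rfl
theorem cj11 (a : A) : c11 (jA a) = 0 := rfl
theorem cS00 : c00 (eS : D2 A) = 0 := rfl
theorem cS01 : c01 (eS : D2 A) = 0 := rfl
theorem cS10 : c10 (eS : D2 A) = 1 := rfl
theorem cS11 : c11 (eS : D2 A) = 0 := rfl
theorem cT00 : c00 (eT : D2 A) = 0 := rfl
theorem cT01 : c01 (eT : D2 A) = 1 := rfl
theorem cT10 : c10 (eT : D2 A) = 0 := rfl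
theorem cT11 : c11 (eT : D2 A) = 0 := rfl

theorem D2_ext {y z : D2 A} (h0 : c00 y = c00 z) (h1 : c01 y = c01 z) (h2 : c10 y = c10 z)
    (h3 : c11 y = c11 z) : y = z :=
  TrivSqZeroExt.ext (TrivSqZeroExt.ext h0 h1) (TrivSqZeroExt.ext h2 h3)

theorem D2_two (h : ∀ a : A, a + a = 0) (z : D2 A) : z + z = 0 :=
  D2_ext (by rw [map_add, h, map_zero]) (by rw [map_add, h, map_zero])
    (by rw [map_add, h, map_zero]) (by rw [map_add, h, map_zero])

theorem ST_sq : (eS * eT : D2 A) * (eS * eT) = 0 := by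
  apply D2_ext <;>
  simp [c00_mul, c01_mul, c10_mul, c11_mul, cS00, cS01, cS10, cS11, cT00, cT01, cT10, cT11]

end D

theorem Rng_two {n : ℕ} (a : Rng n) : a + a = 0 := CharTwo.add_self_eq_zero a

end T6

section T7
set_option linter.unusedSectionVars false

section gen
variable {N : ℕ} [NeZero N]

/-- the square `(i,j)` lies in the torus rectangle from `x` with columns `a`, `b` -/
def inR (x : GridState N) (a b i j : ZMod N) : Prop := inIco a b i ∧ inIco (x a) (x b) j

theorem succVal (k : ZMod N) : (k + 1).val = if k.val + 1 = N then 0 else k.val + 1 := by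
  have hN : 0 < N := NeZero.pos N
  have hk := ZMod.val_lt k
  have : (k + 1) = ((k.val + 1 : ℕ) : ZMod N) := by push_cast; rw [ZMod.natCast_zmod_val]
  rw [this, ZMod.val_natCast]
  split_ifs with h
  · rw [h, Nat.mod_self]
  · exact Nat.mod_eq_of_lt (by omega)

/-- how membership in a cyclic interval changes at consecutive positions -/
theorem colFact {a b c : ZMod N} (h : a ≠ b) :
    (c + 1 = a ∧ inIco a b (c + 1) ∧ ¬ inIco a b c) ∨
    (c + 1 = b ∧ ¬ inIco a b (c + 1) ∧ inIco a b c) ∨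
    (c + 1 ≠ a ∧ c + 1 ≠ b ∧ (inIco a b (c + 1) ↔ inIco a b c)) := by
  unfold inIco
  have hN : 0 < N := NeZero.pos N
  have e : c + 1 - a = (c - a) + 1 := by ring
  have hb : (b - a).val ≠ 0 := by
    rw [Ne, ZMod.val_eq_zero, sub_eq_zero]; exact fun h' => h h'.symm
  have h1 : (c - a).val < N := ZMod.val_lt _
  have h2 : (b - a).val < N := ZMod.val_lt _
  have ea : c + 1 = a ↔ (c + 1 - a).val = 0 := by
    rw [ZMod.val_eq_zero, sub_eq_zero]
  have eb : c + 1 = b ↔ (c + 1 - a).val = (b - a).val := by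
    rw [(ZMod.val_injective N).eq_iff]; simp
  have e' := succVal (c - a)
  rw [← e] at e'
  simp only [Ne, ea, eb]
  clear ea eb
  split_ifs at e' with h3
  · omega
  · omega

variable {R : Type*} [CommRing R]

theorem PP_mul (u w : ZMod N → ZMod N → R) (a b s t : ZMod N) :
    PP (fun i j => u i j * w i j) a b s t = PP u a b s t * PP w a b s t := by
  unfold PP
  simp only [Finset.prod_mul_distrib]

theorem PP_ite (p q : ZMod N) (e : R) (a b s t : ZMod N) :
    PP (fun i j => if i = p ∧ j = q then e else 1) a b s t =
      if inIco a b p ∧ inIco s t q then e else 1 := by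
  unfold PP
  have : ∀ i, (∏ j ∈ arc s t, if i = p ∧ j = q then e else 1) =
      if i = p then (if q ∈ arc s t then e else 1) else 1 := by
    intro i
    by_cases hi : i = p
    · simp [hi]
    · simp [hi]
  simp only [this, Finset.prod_ite_eq', mem_arc]
  by_cases h1 : inIco a b p <;> simp [h1]

theorem PP_fun (Q : ZMod N → Prop) (f : ZMod N → ZMod N) (g : ZMod N → R) (a b s t : ZMod N) :
    PP (fun i j => if Q i ∧ j = f i then g i else 1) a b s t =
      ∏ i, if Q i ∧ inIco a b i ∧ inIco s t (f i) then g i else 1 := by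
  unfold PP
  have : ∀ i, (∏ j ∈ arc s t, if Q i ∧ j = f i then g i else 1) =
      if Q i ∧ inIco s t (f i) then g i else 1 := by
    intro i
    by_cases hi : Q i
    · simp [hi, mem_arc]
    · simp [hi]
  simp only [this]
  unfold arc
  rw [Finset.prod_filter]
  refine Finset.prod_congr rfl fun i _ => ?_
  by_cases h1 : inIco a b i <;> simp [h1]

theorem PP_jA {A : Type*} [CommRing A] (u : ZMod N → ZMod N → A) (a b s t : ZMod N) :
    PP (fun i j => jA (u i j)) a b s t = jA (PP u a b s t) := by
  unfold PP
  let φ : A →* D2 A := ⟨⟨jA, jA_one⟩, jA_mul⟩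
  change ∏ i ∈ _, ∏ j ∈ _, φ (u i j) = φ _
  simp only [map_prod]

end gen

theorem prod_zero' {ι R : Type*} [Fintype ι] [CommRing R] (f : ι → R) (i : ι) (h : f i = 0) :
    ∏ i, f i = 0 := Finset.prod_eq_zero (Finset.mem_univ i) h

section inst
set_option linter.unusedSimpArgs false
variable {n : ℕ} [NeZero n] {A : Type*} [CommRing A] (V : ZMod (n + 1) → A) (vv : A)
  (G' : GridDiagram (n + 1)) (c' r' : ZMod (n + 1))

def uA (i j : ZMod (n + 1)) : A :=
  (if i ≠ c' + 1 ∧ j = G'.Xrow i then 0 else 1) * (if i = c' ∧ j = r' then 0 else 1) *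
    (if i ≠ c' + 1 ∧ j = G'.Orow i then V i else 1)

def uD (i j : ZMod (n + 1)) : D2 A :=
  (if i = c' + 1 ∧ j = r' + 1 then (eS : D2 A) else 1) * (if i = c' + 1 ∧ j = r' then (eT : D2 A) else 1) *
    jA (uA V G' c' r' i j)

theorem succ_ne (c : ZMod (n + 1)) : c ≠ c + 1 := by
  have hn : n ≠ 0 := NeZero.ne n
  haveI : Fact (1 < n + 1) := ⟨by omega⟩
  intro h
  have : (1 : ZMod (n + 1)) = 0 := by
    have := congrArg (fun z => z - c) h
    simpa using this.symm
  exact one_ne_zero this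

theorem jA_zero {B : Type*} [CommRing B] : jA (0 : B) = 0 := rfl

theorem good_uD (h1 : G'.Xrow c' = r' + 1) (h2 : G'.Xrow (c' + 1) = r') :
    Good (uD V G' c' r') (c' + 1) (eS * eT) where
  row j := by
    obtain ⟨i, hi⟩ := G'.hX.2 j
    by_cases hp : i = c' + 1
    · have hj : j = r' := by rw [← hi, hp, h2]
      refine prod_zero' _ c' ?_
      simp [uD, uA, hj, jA_zero]
    · refine prod_zero' _ i ?_
      simp [uD, uA, hi, hp, jA_zero]
  col i hp := by
    refine prod_zero' _ (G'.Xrow i) ?_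
    simp [uD, uA, hp, jA_zero]
  colp := by
    unfold uD uA
    have := succ_ne c'
    simp only [Finset.prod_mul_distrib]
    simp [this.symm, jA_one]

def rNE (x : GridState (n + 1)) (a b : ZMod (n + 1)) : Prop := inR x a b (c' + 1) (r' + 1)
def rSE (x : GridState (n + 1)) (a b : ZMod (n + 1)) : Prop := inR x a b (c' + 1) r'

def m0 (x : GridState (n + 1)) (a b : ZMod (n + 1)) : A :=
  PP (uA V G' c' r') a b (x a) (x b) * vv ^ icnt x a b

def WT (x : GridState (n + 1)) (a b : ZMod (n + 1)) : D2 A :=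
  WW (uD V G' c' r') (jA vv) x a b * phi (jA vv) (eS * eT) (c' + 1) a b

theorem jA_pow {B : Type*} [CommRing B] (z : B) (k : ℕ) : jA (z ^ k) = jA z ^ k := by
  let φ : B →* D2 B := ⟨⟨jA, jA_one⟩, jA_mul⟩
  exact map_pow φ z k

theorem WT_eq (x : GridState (n + 1)) (a b : ZMod (n + 1)) :
    WT V vv G' c' r' x a b = (if rNE c' r' x a b then (eS : D2 A) else 1) *
      (if rSE c' r' x a b then (eT : D2 A) else 1) *
      jA (m0 V vv G' c' r' x a b) *
        (1 + if a = c' + 1 ∧ b = c' + 1 + 1 then (jA vv * (eS * eT) : D2 A) else 0) := by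
  unfold WT WW m0 phi
  have : uD V G' c' r' = fun i j => ((if i = c' + 1 ∧ j = r' + 1 then (eS : D2 A) else 1) *
    (if i = c' + 1 ∧ j = r' then (eT : D2 A) else 1)) * jA (uA V G' c' r' i j) := rfl
  rw [this, PP_mul, PP_mul, PP_ite, PP_ite, PP_jA, jA_mul, jA_pow]
  unfold rNE rSE inR
  ring

theorem c00_one {B : Type*} [CommRing B] : c00 (1 : D2 B) = 1 := rfl
theorem c01_one {B : Type*} [CommRing B] : c01 (1 : D2 B) = 0 := rfl
theorem c10_one {B : Type*} [CommRing B] : c10 (1 : D2 B) = 0 := rfl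
theorem c11_one {B : Type*} [CommRing B] : c11 (1 : D2 B) = 0 := rfl

def w00 (x : GridState (n + 1)) (a b : ZMod (n + 1)) := c00 (WT V vv G' c' r' x a b)
def w01 (x : GridState (n + 1)) (a b : ZMod (n + 1)) := c01 (WT V vv G' c' r' x a b)
def w10 (x : GridState (n + 1)) (a b : ZMod (n + 1)) := c10 (WT V vv G' c' r' x a b)
def w11 (x : GridState (n + 1)) (a b : ZMod (n + 1)) := c11 (WT V vv G' c' r' x a b)

theorem w00_eq (x : GridState (n + 1)) (a b : ZMod (n + 1)) : w00 V vv G' c' r' x a b =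
    if ¬ rNE c' r' x a b ∧ ¬ rSE c' r' x a b then m0 V vv G' c' r' x a b else 0 := by
  unfold w00
  rw [WT_eq]
  split_ifs <;>
  simp_all [c00_mul, c01_mul, c10_mul, c11_mul, cS00, cS01, cS10, cS11, cT00, cT01, cT10, cT11,
    cj00, cj01, cj10, cj11, c00_one, c01_one, c10_one, c11_one]

theorem w01_eq (x : GridState (n + 1)) (a b : ZMod (n + 1)) : w01 V vv G' c' r' x a b =
    if ¬ rNE c' r' x a b ∧ rSE c' r' x a b then m0 V vv G' c' r' x a b else 0 := by
  unfold w01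
  rw [WT_eq]
  split_ifs <;>
  simp_all [c00_mul, c01_mul, c10_mul, c11_mul, cS00, cS01, cS10, cS11, cT00, cT01, cT10, cT11,
    cj00, cj01, cj10, cj11, c00_one, c01_one, c10_one, c11_one]

theorem w10_eq (x : GridState (n + 1)) (a b : ZMod (n + 1)) : w10 V vv G' c' r' x a b =
    if rNE c' r' x a b ∧ ¬ rSE c' r' x a b then m0 V vv G' c' r' x a b else 0 := by
  unfold w10
  rw [WT_eq]
  split_ifs <;>
  simp_all [c00_mul, c01_mul, c10_mul, c11_mul, cS00, cS01, cS10, cS11, cT00, cT01, cT10, cT11,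
    cj00, cj01, cj10, cj11, c00_one, c01_one, c10_one, c11_one]

theorem w11_eq (x : GridState (n + 1)) (a b : ZMod (n + 1)) : w11 V vv G' c' r' x a b =
    (if rNE c' r' x a b ∧ rSE c' r' x a b then m0 V vv G' c' r' x a b else 0) +
    (if (¬ rNE c' r' x a b ∧ ¬ rSE c' r' x a b) ∧ a = c' + 1 ∧ b = c' + 1 + 1 then
      m0 V vv G' c' r' x a b * vv else 0) := by
  unfold w11
  rw [WT_eq]
  generalize rNE c' r' x a b = P
  generalize rSE c' r' x a b = Q
  generalize m0 V vv G' c' r' x a b = z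
  rw [ite_and (¬ P ∧ ¬ Q)]
  have key : (if a = c' + 1 ∧ b = c' + 1 + 1 then (jA vv * (eS * eT) : D2 A) else 0) =
      jA (if a = c' + 1 ∧ b = c' + 1 + 1 then vv else 0) * (eS * eT) := by
    by_cases hab : a = c' + 1 ∧ b = c' + 1 + 1
    · rw [if_pos hab, if_pos hab]
    · rw [if_neg hab, if_neg hab, jA_zero, zero_mul]
  have key2 : (if a = c' + 1 ∧ b = c' + 1 + 1 then z * vv else 0) =
      z * (if a = c' + 1 ∧ b = c' + 1 + 1 then vv else 0) := by
    by_cases hab : a = c' + 1 ∧ b = c' + 1 + 1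
    · rw [if_pos hab, if_pos hab]
    · rw [if_neg hab, if_neg hab, mul_zero]
  rw [key, key2]
  generalize (if a = c' + 1 ∧ b = c' + 1 + 1 then vv else 0) = w
  by_cases hN : P <;> by_cases hS : Q <;>
  simp [hN, hS, map_add, c00_mul, c01_mul, c10_mul, c11_mul, cS00, cS01, cS10, cS11, cT00, cT01, cT10, cT11,
    cj00, cj01, cj10, cj11, c00_one, c01_one, c10_one, c11_one]

/-- the square relation with `Φ` the indicator of a state -/
theorem sq_rel (hA : ∀ z : A, z + z = 0) (h1 : G'.Xrow c' = r' + 1) (h2 : G'.Xrow (c' + 1) = r')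
    (x y : GridState (n + 1)) :
    (∑ a, ∑ b, if a ≠ b then ∑ c, ∑ d, if c ≠ d then
        WT V vv G' c' r' x a b * WT V vv G' c' r' (x * Equiv.swap a b) c d *
          jA (if x * (Equiv.swap a b * Equiv.swap c d) = y then 1 else 0) else 0 else 0) =
      (eS * eT : D2 A) * jA (if x = y then 1 else 0) := by
  rw [← square (fun z => (jA (if z = y then 1 else 0) : D2 A)) x (good_uD V G' c' r' h1 h2) ST_sq
    (D2_two hA) (succ_ne (c' + 1)) (v := (jA vv : D2 A))]
  refine Finset.sum_congr rfl fun a _ => Finset.sum_congr rfl fun b _ => ?_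
  split_ifs with hab
  · refine Finset.sum_congr rfl fun c _ => Finset.sum_congr rfl fun d _ => ?_
    by_cases hcd : c ≠ d
    · rw [if_pos hcd, if_pos hcd]
      unfold CT CR WT
      ring
    · rw [if_neg hcd, if_neg hcd]
  · rfl

theorem rel_of (hA : ∀ z : A, z + z = 0) (c : D2 A →+ A)
    (hc : ∀ z w, c (z * jA w) = c z * w)
    (h1 : G'.Xrow c' = r' + 1) (h2 : G'.Xrow (c' + 1) = r')
    (x y : GridState (n + 1)) :
    (∑ a, ∑ b, if a ≠ b then ∑ c₁, ∑ d, if c₁ ≠ d then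
        c (WT V vv G' c' r' x a b * WT V vv G' c' r' (x * Equiv.swap a b) c₁ d) *
          (if x * (Equiv.swap a b * Equiv.swap c₁ d) = y then 1 else 0) else 0 else 0) =
      c (eS * eT) * (if x = y then 1 else 0) := by
  have := congrArg c (sq_rel V vv G' c' r' hA h1 h2 x y)
  rw [hc, map_sum] at this
  rw [← this]
  refine Finset.sum_congr rfl fun a _ => ?_
  rw [map_sum]
  refine Finset.sum_congr rfl fun b _ => ?_
  rw [apply_ite c, map_zero, map_sum]
  by_cases hab : a ≠ b
  · rw [if_pos hab, if_pos hab]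
    refine Finset.sum_congr rfl fun c₁ _ => ?_
    rw [map_sum]
    refine Finset.sum_congr rfl fun d _ => ?_
    rw [apply_ite c, map_zero, hc]
  · rw [if_neg hab, if_neg hab]

theorem qs_add {m : ℕ} [NeZero m] {B : Type*} [CommRing B]
    (F F' : ZMod m → ZMod m → ZMod m → ZMod m → B) :
    (∑ a, ∑ b, if a ≠ b then ∑ c, ∑ d, if c ≠ d then F a b c d else 0 else 0) +
    (∑ a, ∑ b, if a ≠ b then ∑ c, ∑ d, if c ≠ d then F' a b c d else 0 else 0) =
    ∑ a, ∑ b, if a ≠ b then ∑ c, ∑ d, if c ≠ d then F a b c d + F' a b c d else 0 else 0 := by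
  rw [← Finset.sum_add_distrib]
  refine Finset.sum_congr rfl fun a _ => ?_
  rw [← Finset.sum_add_distrib]
  refine Finset.sum_congr rfl fun b _ => ?_
  by_cases hab : a ≠ b
  · rw [if_pos hab, if_pos hab, if_pos hab, ← Finset.sum_add_distrib]
    refine Finset.sum_congr rfl fun c _ => ?_
    rw [← Finset.sum_add_distrib]
    refine Finset.sum_congr rfl fun d _ => ?_
    by_cases hcd : c ≠ d
    · rw [if_pos hcd, if_pos hcd, if_pos hcd]
    · rw [if_neg hcd, if_neg hcd, if_neg hcd, add_zero]
  · rw [if_neg hab, if_neg hab, if_neg hab, add_zero]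

theorem qs_congr {m : ℕ} [NeZero m] {B : Type*} [CommRing B]
    {F F' : ZMod m → ZMod m → ZMod m → ZMod m → B}
    (h : ∀ a b c d, F a b c d = F' a b c d) :
    (∑ a, ∑ b, if a ≠ b then ∑ c, ∑ d, if c ≠ d then F a b c d else 0 else 0) =
    (∑ a, ∑ b, if a ≠ b then ∑ c, ∑ d, if c ≠ d then F' a b c d else 0 else 0) := by
  have : F = F' := by funext a b c d; exact h a b c d
  rw [this]

theorem c00_ST {B : Type*} [CommRing B] : c00 (eS * eT : D2 B) = 0 := by
  simp [c00_mul, c01_mul, c10_mul, c11_mul, cS00, cS01, cS10, cS11, cT00, cT01, cT10, cT11, cj00, cj01, cj10, cj11]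
theorem c00_jA {B : Type*} [CommRing B] (z : D2 B) (w : B) : c00 (z * jA w) = c00 z * w := by
  simp [c00_mul, c01_mul, c10_mul, c11_mul, cS00, cS01, cS10, cS11, cT00, cT01, cT10, cT11, cj00, cj01, cj10, cj11]
theorem c01_ST {B : Type*} [CommRing B] : c01 (eS * eT : D2 B) = 0 := by
  simp [c00_mul, c01_mul, c10_mul, c11_mul, cS00, cS01, cS10, cS11, cT00, cT01, cT10, cT11, cj00, cj01, cj10, cj11]
theorem c01_jA {B : Type*} [CommRing B] (z : D2 B) (w : B) : c01 (z * jA w) = c01 z * w := by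
  simp [c00_mul, c01_mul, c10_mul, c11_mul, cS00, cS01, cS10, cS11, cT00, cT01, cT10, cT11, cj00, cj01, cj10, cj11]
theorem c10_ST {B : Type*} [CommRing B] : c10 (eS * eT : D2 B) = 0 := by
  simp [c00_mul, c01_mul, c10_mul, c11_mul, cS00, cS01, cS10, cS11, cT00, cT01, cT10, cT11, cj00, cj01, cj10, cj11]
theorem c10_jA {B : Type*} [CommRing B] (z : D2 B) (w : B) : c10 (z * jA w) = c10 z * w := by
  simp [c00_mul, c01_mul, c10_mul, c11_mul, cS00, cS01, cS10, cS11, cT00, cT01, cT10, cT11, cj00, cj01, cj10, cj11]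
theorem c11_ST {B : Type*} [CommRing B] : c11 (eS * eT : D2 B) = 1 := by
  simp [c00_mul, c01_mul, c10_mul, c11_mul, cS00, cS01, cS10, cS11, cT00, cT01, cT10, cT11, cj00, cj01, cj10, cj11]
theorem c11_jA {B : Type*} [CommRing B] (z : D2 B) (w : B) : c11 (z * jA w) = c11 z * w := by
  simp [c00_mul, c01_mul, c10_mul, c11_mul, cS00, cS01, cS10, cS11, cT00, cT01, cT10, cT11, cj00, cj01, cj10, cj11]
theorem rel00 (h1 : G'.Xrow c' = r' + 1) (h2 : G'.Xrow (c' + 1) = r') :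
    op (w00 Vv vV G' c' r') ∘ₗ op (w00 Vv vV G' c' r') = 0 := by
  refine GC_ext fun x y => ?_
  rw [op_comp]
  have := rel_of Vv vV G' c' r' Rng_two c00 c00_jA h1 h2 x y
  rw [c00_ST, zero_mul] at this
  rw [LinearMap.zero_apply, Finsupp.zero_apply]
  refine Eq.trans ?_ this
  exact qs_congr fun a b c d => by rw [c00_mul]; rfl

theorem rel01 (h1 : G'.Xrow c' = r' + 1) (h2 : G'.Xrow (c' + 1) = r') :
    op (w00 Vv vV G' c' r') ∘ₗ op (w01 Vv vV G' c' r') +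
      op (w01 Vv vV G' c' r') ∘ₗ op (w00 Vv vV G' c' r') = 0 := by
  refine GC_ext fun x y => ?_
  rw [LinearMap.add_apply, Finsupp.add_apply, op_comp, op_comp, qs_add]
  have := rel_of Vv vV G' c' r' Rng_two c01 c01_jA h1 h2 x y
  rw [c01_ST, zero_mul] at this
  rw [LinearMap.zero_apply, Finsupp.zero_apply]
  refine Eq.trans ?_ this
  exact qs_congr fun a b c d => by rw [c01_mul]; unfold w00 w01; ring

theorem rel10 (h1 : G'.Xrow c' = r' + 1) (h2 : G'.Xrow (c' + 1) = r') :
    op (w00 Vv vV G' c' r') ∘ₗ op (w10 Vv vV G' c' r') +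
      op (w10 Vv vV G' c' r') ∘ₗ op (w00 Vv vV G' c' r') = 0 := by
  refine GC_ext fun x y => ?_
  rw [LinearMap.add_apply, Finsupp.add_apply, op_comp, op_comp, qs_add]
  have := rel_of Vv vV G' c' r' Rng_two c10 c10_jA h1 h2 x y
  rw [c10_ST, zero_mul] at this
  rw [LinearMap.zero_apply, Finsupp.zero_apply]
  refine Eq.trans ?_ this
  exact qs_congr fun a b c d => by rw [c10_mul]; unfold w00 w10; ring

theorem rel11 (h1 : G'.Xrow c' = r' + 1) (h2 : G'.Xrow (c' + 1) = r') :
    op (w01 Vv vV G' c' r') ∘ₗ op (w10 Vv vV G' c' r') +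
      op (w10 Vv vV G' c' r') ∘ₗ op (w01 Vv vV G' c' r') +
    op (w00 Vv vV G' c' r') ∘ₗ op (w11 Vv vV G' c' r') +
      op (w11 Vv vV G' c' r') ∘ₗ op (w00 Vv vV G' c' r') = LinearMap.id := by
  refine GC_ext fun x y => ?_
  rw [LinearMap.add_apply, Finsupp.add_apply, LinearMap.add_apply, Finsupp.add_apply,
    LinearMap.add_apply, Finsupp.add_apply, op_comp, op_comp, op_comp, op_comp,
    qs_add, qs_add, qs_add]
  have := rel_of Vv vV G' c' r' Rng_two c11 c11_jA h1 h2 x y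
  rw [c11_ST, one_mul] at this
  rw [LinearMap.id_apply, Finsupp.single_apply, ← this]
  exact qs_congr fun a b c d => by rw [c11_mul]; unfold w00 w10 w01 w11; ring

end inst
end T7

section T8
set_option linter.unusedSectionVars false

/-! ### algebraic deduction -/
theorem alg_concl {R : Type*} [Ring R] (h2 : ∀ r : R, r + r = 0) {I N D H g k d : R}
    (hII : I * I = I) (hNN : N * N = N) (hIN : I * N = 0) (hNI : N * I = 0) (h1 : I + N = 1)
    (hH : H = I * H * N) (hg : g = N * g * I) (hk : k = N * k * N)
    (hd : d = I * D * I + N * D * N) (r1 : d * H + H * d = 0) (r2 : d * g + g * d = 0)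
    (r3 : H * g + g * H + d * k + k * d = 1) :
    ((I * D * I) * H + H * (N * D * N) = 0) ∧
    ((N * D * N) * g + g * (I * D * I) = 0) ∧ H * g = I ∧
    g * H + N = (N * D * N) * k + k * (N * D * N) := by
  have NH : N * H = 0 := by rw [hH, ← mul_assoc, ← mul_assoc, hNI, zero_mul, zero_mul]
  have IH : I * H = H := by rw [hH, ← mul_assoc, ← mul_assoc, hII]
  have HI : H * I = 0 := by rw [hH, mul_assoc, hNI, mul_zero]
  have HN : H * N = H := by rw [hH, mul_assoc, hNN]
  have Ng : N * g = g := by rw [hg, ← mul_assoc, ← mul_assoc, hNN]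
  have Ig : I * g = 0 := by rw [hg, ← mul_assoc, ← mul_assoc, hIN, zero_mul, zero_mul]
  have gN : g * N = 0 := by rw [hg, mul_assoc, hIN, mul_zero]
  have gI : g * I = g := by rw [hg, mul_assoc, hII]
  have Nk : N * k = k := by rw [hk, ← mul_assoc, ← mul_assoc, hNN]
  have Ik : I * k = 0 := by rw [hk, ← mul_assoc, ← mul_assoc, hIN, zero_mul, zero_mul]
  have kN : k * N = k := by rw [hk, mul_assoc, hNN]
  have kI : k * I = 0 := by rw [hk, mul_assoc, hNI, mul_zero]
  have dH : d * H = (I * D * I) * H := by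
    rw [hd, add_mul, mul_assoc (N * D), NH, mul_zero, add_zero]
  have Hd : H * d = H * (N * D * N) := by
    rw [hd, mul_add, ← mul_assoc H (I * D), ← mul_assoc H I, HI, zero_mul, zero_mul, zero_add]
  have dg : d * g = (N * D * N) * g := by
    rw [hd, add_mul, mul_assoc (I * D), Ig, mul_zero, zero_add]
  have gd : g * d = g * (I * D * I) := by
    rw [hd, mul_add, ← mul_assoc g (N * D), ← mul_assoc g N, gN, zero_mul, zero_mul, add_zero]
  have dk : d * k = (N * D * N) * k := by
    rw [hd, add_mul, mul_assoc (I * D), Ik, mul_zero, zero_add]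
  have kd : k * d = k * (N * D * N) := by
    rw [hd, mul_add, ← mul_assoc k (I * D), ← mul_assoc k I, kI, zero_mul, zero_mul, zero_add]
  rw [dH, Hd] at r1
  rw [dg, gd] at r2
  rw [dk, kd] at r3
  have e3 : I * (H * g + g * H + N * D * N * k + k * (N * D * N)) = I := by rw [r3, mul_one]
  have e3' : I * (H * g + g * H + N * D * N * k + k * (N * D * N)) = H * g := by
    simp only [mul_add, ← mul_assoc, IH, Ig, Ik, hIN, zero_mul, add_zero]
  have e4 : N * (H * g + g * H + N * D * N * k + k * (N * D * N)) = N := by rw [r3, mul_one]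
  have e4' : N * (H * g + g * H + N * D * N * k + k * (N * D * N)) =
      g * H + N * D * N * k + k * (N * D * N) := by
    simp only [mul_add, ← mul_assoc, NH, Ng, Nk, hNN, zero_mul, zero_add]
  refine ⟨r1, r2, by rw [← e3', e3], ?_⟩
  rw [e4] at e4'
  refine (congrArg (g * H + ·) e4').trans ?_
  have := h2 (g * H)
  show g * H + (g * H + N * D * N * k + k * (N * D * N)) = _
  rw [show g * H + (g * H + N * D * N * k + k * (N * D * N)) =
    (g * H + g * H) + (N * D * N * k + k * (N * D * N)) by abel, this, zero_add]

theorem alg_concl' {R : Type*} [Ring R] (h2 : ∀ r : R, r + r = 0) {I N D H g k d : R}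
    (hII : I * I = I) (hNN : N * N = N) (hIN : I * N = 0) (hNI : N * I = 0) (h1 : I + N = 1)
    (hH : H = I * (H * N)) (hg : N * (g * I) = g) (hk : N * (k * N) = k)
    (hd : d = I * (D * I) + N * (D * N)) (r1 : d * H + H * d = 0) (r2 : d * g + g * d = 0)
    (r3 : H * g + g * H + d * k + k * d = 1) :
    ((I * (D * I)) * H + H * (N * (D * N)) = 0) ∧
    ((N * (D * N)) * g + g * (I * (D * I)) = 0) ∧ H * g = I ∧
    g * H + N = (N * (D * N)) * k + k * (N * (D * N)) := by
  simp only [← mul_assoc I, ← mul_assoc N] at hH hg hk hd ⊢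
  exact alg_concl h2 hII hNN hIN hNI h1 hH hg.symm hk.symm hd r1 r2 r3

/-! ### torus weights -/
section tw
variable {N : ℕ} [NeZero N]

def mO (G : GridDiagram N) (x : GridState N) (a b : ZMod N) : Rng N :=
  ∏ i, Vv i ^ (if inR x a b i (G.Orow i) then 1 else 0)

def wd (G : GridDiagram N) (x : GridState N) (a b : ZMod N) : Rng N :=
  if ∀ i, ¬ inR x a b i (G.Xrow i) then mO G x a b * vV ^ icnt x a b else 0

def wh (G : GridDiagram N) (p q r : ZMod N) (x : GridState N) (a b : ZMod N) : Rng N :=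
  if (x p ≠ q ∧ (x * Equiv.swap a b) p = q) ∧ inR x a b p r ∧
    ∀ i, i ≠ p → ¬ inR x a b i (G.Xrow i) then mO G x a b * vV ^ icnt x a b else 0
end tw

section geo
variable {N : ℕ} [NeZero N] (x : GridState N) {a b : ZMod N} (c r : ZMod N)

theorem geo (h : a ≠ b) :
    (¬ inR x a b (c + 1) r → ¬ inR x a b c (r + 1) →
      ((¬ inR x a b (c + 1) (r + 1) ∧ ¬ inR x a b c r) ↔
        (x (c + 1) = r + 1 ↔ (x * Equiv.swap a b) (c + 1) = r + 1))) ∧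
    (inR x a b (c + 1) r → ¬ inR x a b c (r + 1) →
      ((¬ inR x a b (c + 1) (r + 1) ∧ ¬ inR x a b c r) ↔
        (x (c + 1) ≠ r + 1 ∧ (x * Equiv.swap a b) (c + 1) = r + 1))) ∧
    (inR x a b (c + 1) (r + 1) → ¬ inR x a b (c + 1) r → ¬ inR x a b c (r + 1) →
      ¬ inR x a b c r → (x (c + 1) = r + 1 ∧ ¬ (x * Equiv.swap a b) (c + 1) = r + 1)) ∧
    (inR x a b (c + 1) (r + 1) → inR x a b (c + 1) r → ¬ inR x a b c (r + 1) →
      ¬ inR x a b c r → (¬ x (c + 1) = r + 1 ∧ ¬ (x * Equiv.swap a b) (c + 1) = r + 1)) ∧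
    (¬ inR x a b (c + 1) (r + 1) → ¬ inR x a b (c + 1) r → a = c + 1 →
      (¬ x (c + 1) = r + 1 ∧ ¬ (x * Equiv.swap a b) (c + 1) = r + 1)) := by
  have hx : x a ≠ x b := fun h' => h (x.injective h')
  unfold inR
  rw [Equiv.Perm.mul_apply]
  have cf := colFact (c := c) h
  have rf := colFact (c := r) hx
  have sa : Equiv.swap a b a = b := Equiv.swap_apply_left a b
  have sb : Equiv.swap a b b = a := Equiv.swap_apply_right a b
  rcases cf with ⟨e, h1, h2⟩ | ⟨e, h1, h2⟩ | ⟨e, e', h1⟩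
  · have X : x (c + 1) = r + 1 ↔ r + 1 = x a := by rw [e]; exact eq_comm
    have Y : x (Equiv.swap a b (c + 1)) = r + 1 ↔ r + 1 = x b := by rw [e, sa]; exact eq_comm
    have Z : r + 1 = x a → ¬ r + 1 = x b := fun h3 h4 => hx (h3.symm.trans h4)
    rw [Ne, X, Y]
    simp only [h1, h2, true_and, false_and, not_false_eq_true, true_implies, and_true]
    clear X Y
    rcases rf with ⟨f, g1, g2⟩ | ⟨f, g1, g2⟩ | ⟨f, f', g1⟩
    · have := Z f
      simp only [g1, g2, eq_true f, eq_false this]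
      simp
    · have : ¬ r + 1 = x a := fun h => Z h f
      simp only [g1, g2, eq_true f, eq_false this]
      simp
    · simp only [g1, eq_false f, eq_false f']
      by_cases k : inIco (x a) (x b) r <;> simp [k]
  · have X : x (c + 1) = r + 1 ↔ r + 1 = x b := by rw [e]; exact eq_comm
    have Y : x (Equiv.swap a b (c + 1)) = r + 1 ↔ r + 1 = x a := by rw [e, sb]; exact eq_comm
    have Z : r + 1 = x a → ¬ r + 1 = x b := fun h3 h4 => hx (h3.symm.trans h4)
    have W : a ≠ c + 1 := by rw [e]; exact h
    rw [Ne, X, Y]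
    simp only [h1, h2, eq_false W, true_and, false_and, not_false_eq_true, true_implies, and_true]
    clear X Y
    rcases rf with ⟨f, g1, g2⟩ | ⟨f, g1, g2⟩ | ⟨f, f', g1⟩
    · have := Z f
      simp only [g1, g2, eq_true f, eq_false this]
      simp
    · have : ¬ r + 1 = x a := fun h => Z h f
      simp only [g1, g2, eq_true f, eq_false this]
      simp
    · simp only [g1, eq_false f, eq_false f']
      by_cases k : inIco (x a) (x b) r <;> simp [k]
  · rw [Equiv.swap_apply_of_ne_of_ne e e']
    have W : a ≠ c + 1 := fun h => e h.symm
    simp only [h1, eq_false W]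
    by_cases k0 : inIco a b c <;> by_cases k : inIco (x a) (x b) r <;>
    by_cases k2 : inIco (x a) (x b) (r + 1) <;> simp [k0, k, k2]
end geo

section fin
variable {n : ℕ} [NeZero n] (G' : GridDiagram (n + 1)) (c' r' : ZMod (n + 1))

theorem m0_eq (x : GridState (n + 1)) (a b : ZMod (n + 1)) :
    m0 Vv vV G' c' r' x a b =
      if (∀ i, i ≠ c' + 1 → ¬ inR x a b i (G'.Xrow i)) ∧ ¬ inR x a b c' r' then
      (∏ i, if i ≠ c' + 1 ∧ inR x a b i (G'.Orow i) then Vv i else 1) * vV ^ icnt x a b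
      else 0 := by
  unfold m0
  have : uA (A := Rng (n + 1)) Vv G' c' r' = fun i j =>
    ((if i ≠ c' + 1 ∧ j = G'.Xrow i then 0 else 1) * (if i = c' ∧ j = r' then 0 else 1)) *
    (if i ≠ c' + 1 ∧ j = G'.Orow i then Vv i else 1) := rfl
  have q1 : PP (fun i j => if i ≠ c' + 1 ∧ j = G'.Xrow i then (0 : Rng (n + 1)) else 1) a b
      (x a) (x b) = ∏ i, if i ≠ c' + 1 ∧ inIco a b i ∧ inIco (x a) (x b) (G'.Xrow i) then
      (0 : Rng (n + 1)) else 1 := by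
    convert PP_fun (fun i => i ≠ c' + 1) G'.Xrow (fun _ => (0 : Rng (n + 1))) a b (x a) (x b)
  have q2 : PP (fun i j => if i ≠ c' + 1 ∧ j = G'.Orow i then Vv i else 1) a b
      (x a) (x b) = ∏ i, if i ≠ c' + 1 ∧ inIco a b i ∧ inIco (x a) (x b) (G'.Orow i) then
      (Vv i : Rng (n + 1)) else 1 := by
    convert PP_fun (fun i => i ≠ c' + 1) G'.Orow (Vv (n := n + 1)) a b (x a) (x b)
  rw [this, PP_mul, PP_mul, PP_ite, q1, q2]
  by_cases h1 : ∀ i, i ≠ c' + 1 → ¬ inR x a b i (G'.Xrow i)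
  · have e1 : (∏ i, if i ≠ c' + 1 ∧ inIco a b i ∧ inIco (x a) (x b) (G'.Xrow i) then
        (0 : Rng (n + 1)) else 1) = 1 := by
      refine Finset.prod_eq_one fun i _ => ?_
      rw [if_neg]
      rintro ⟨h2, h3⟩
      exact h1 i h2 h3
    rw [e1]
    by_cases h2 : inR x a b c' r'
    · rw [if_pos (show inIco a b c' ∧ _ from h2), if_neg (fun h => h.2 h2)]
      ring
    · rw [if_neg (show ¬ (inIco a b c' ∧ _) from h2), if_pos ⟨h1, h2⟩, one_mul, one_mul]
      refine congrArg (· * _) (Finset.prod_congr rfl fun i _ => ?_)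
      by_cases hi : i ≠ c' + 1 ∧ inR x a b i (G'.Orow i)
      · rw [if_pos hi, if_pos (show _ ∧ inIco a b i ∧ _ from hi)]
      · rw [if_neg hi, if_neg (show ¬ (_ ∧ inIco a b i ∧ _) from hi)]
  · have hz : ¬ ((∀ i, i ≠ c' + 1 → ¬ inR x a b i (G'.Xrow i)) ∧ ¬ inR x a b c' r') :=
      fun h => h1 h.1
    rw [if_neg hz]
    clear hz
    push Not at h1
    obtain ⟨i, h2, h3⟩ := h1
    have e1 : (∏ i, if i ≠ c' + 1 ∧ inIco a b i ∧ inIco (x a) (x b) (G'.Xrow i) then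
        (0 : Rng (n + 1)) else 1) = 0 := by
      refine prod_zero' _ i ?_
      rw [if_pos ⟨h2, h3⟩]
    rw [e1]
    ring

theorem mO_eq (h0 : G'.Orow (c' + 1) = r' + 1) (x : GridState (n + 1)) (a b : ZMod (n + 1))
    (h : ¬ inR x a b (c' + 1) (r' + 1)) :
    (∏ i, if i ≠ c' + 1 ∧ inR x a b i (G'.Orow i) then Vv i else 1) = mO G' x a b := by
  unfold mO
  refine Finset.prod_congr rfl fun i _ => ?_
  by_cases hi : i = c' + 1
  · rw [if_neg (fun hh => hh.1 hi), hi, h0, if_neg h, pow_zero]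
  · by_cases h2 : inR x a b i (G'.Orow i)
    · rw [if_pos ⟨hi, h2⟩, if_pos h2, pow_one]
    · rw [if_neg (fun hh => h2 hh.2), if_neg h2, pow_zero]

theorem w00_wd (h0 : G'.Orow (c' + 1) = r' + 1) (h1 : G'.Xrow c' = r' + 1)
    (h2 : G'.Xrow (c' + 1) = r') (x : GridState (n + 1)) (a b : ZMod (n + 1)) (hab : a ≠ b) :
    w00 Vv vV G' c' r' x a b =
      if (x (c' + 1) = r' + 1 ↔ (x * Equiv.swap a b) (c' + 1) = r' + 1) then wd G' x a b
      else 0 := by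
  rw [w00_eq, m0_eq]
  unfold wd rNE rSE
  have hg := (geo x c' r' hab).1
  by_cases hX : ∀ i, ¬ inR x a b i (G'.Xrow i)
  · have hS := hX (c' + 1)
    have hW := hX c'
    rw [h2] at hS
    rw [h1] at hW
    have hg := hg hS hW
    rw [if_pos hX]
    by_cases hc : (x (c' + 1) = r' + 1 ↔ (x * Equiv.swap a b) (c' + 1) = r' + 1)
    · obtain ⟨g1, g2⟩ := hg.2 hc
      rw [if_pos hc, if_pos ⟨g1, hS⟩, if_pos ⟨fun i _ => hX i, g2⟩, mO_eq G' c' r' h0 x a b g1]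
    · rw [if_neg hc]
      by_cases g1 : inR x a b (c' + 1) (r' + 1)
      · rw [if_neg (fun h => h.1 g1)]
      · rw [if_neg (fun (h : _ ∧ ¬ inR x a b c' r') => hc (hg.1 ⟨g1, h.2⟩)), ite_self]
  · rw [if_neg hX, ite_self]
    by_cases hS : inR x a b (c' + 1) r'
    · rw [if_neg (fun h => h.2 hS)]
    · rw [if_neg (c := _ ∧ ¬ inR x a b c' r'), ite_self]
      rintro ⟨h3, -⟩
      apply hX
      intro i
      by_cases hi : i = c' + 1
      · rw [hi, h2]; exact hS
      · exact h3 i hi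

theorem w01_wh (h0 : G'.Orow (c' + 1) = r' + 1) (h1 : G'.Xrow c' = r' + 1)
    (x : GridState (n + 1)) (a b : ZMod (n + 1)) (hab : a ≠ b) :
    w01 Vv vV G' c' r' x a b = wh G' (c' + 1) (r' + 1) r' x a b := by
  rw [w01_eq, m0_eq]
  unfold wh rNE rSE
  have hg := (geo x c' r' hab).2.1
  by_cases hS : inR x a b (c' + 1) r'
  · by_cases hX : ∀ i, i ≠ c' + 1 → ¬ inR x a b i (G'.Xrow i)
    · have hW := hX c' (succ_ne c')
      rw [h1] at hW
      have hg := hg hS hW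
      by_cases hc : x (c' + 1) ≠ r' + 1 ∧ (x * Equiv.swap a b) (c' + 1) = r' + 1
      · obtain ⟨g1, g2⟩ := hg.2 hc
        rw [if_pos ⟨g1, hS⟩, if_pos ⟨hX, g2⟩, if_pos ⟨hc, hS, hX⟩, mO_eq G' c' r' h0 x a b g1]
      · rw [if_neg (c := (x (c' + 1) ≠ r' + 1 ∧ (x * Equiv.swap a b) (c' + 1) = r' + 1) ∧ _)
          (fun h => hc h.1)]
        by_cases g1 : inR x a b (c' + 1) (r' + 1)
        · rw [if_neg (fun h => h.1 g1)]
        · rw [if_neg (c := _ ∧ ¬ inR x a b c' r') (fun h => hc (hg.1 ⟨g1, h.2⟩)), ite_self]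
    · rw [if_neg (c := _ ∧ ¬ inR x a b c' r') (fun h => hX h.1), ite_self,
        if_neg (fun h => hX h.2.2)]
  · rw [if_neg (fun h => hS h.2), if_neg (fun h => hS h.2.1)]

theorem w10_supp (h1 : G'.Xrow c' = r' + 1)
    (x : GridState (n + 1)) (a b : ZMod (n + 1)) (hab : a ≠ b)
    (h : ¬ (x (c' + 1) = r' + 1 ∧ ¬ (x * Equiv.swap a b) (c' + 1) = r' + 1)) :
    w10 Vv vV G' c' r' x a b = 0 := by
  rw [w10_eq, m0_eq]
  unfold rNE rSE
  have hg := (geo x c' r' hab).2.2.1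
  by_cases h3 : inR x a b (c' + 1) (r' + 1) ∧ ¬ inR x a b (c' + 1) r'
  · rw [if_pos h3]
    rw [if_neg]
    rintro ⟨hX, g2⟩
    have hW := hX c' (succ_ne c')
    rw [h1] at hW
    exact h (hg h3.1 h3.2 hW g2)
  · rw [if_neg h3]

theorem w11_supp (h1 : G'.Xrow c' = r' + 1)
    (x : GridState (n + 1)) (a b : ZMod (n + 1)) (hab : a ≠ b)
    (h : ¬ (¬ x (c' + 1) = r' + 1 ∧ ¬ (x * Equiv.swap a b) (c' + 1) = r' + 1)) :
    w11 Vv vV G' c' r' x a b = 0 := by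
  rw [w11_eq, m0_eq]
  unfold rNE rSE
  have hg := (geo x c' r' hab).2.2.2
  have t1 : ¬ ((¬ inR x a b (c' + 1) (r' + 1) ∧ ¬ inR x a b (c' + 1) r') ∧
      a = c' + 1 ∧ b = c' + 1 + 1) := by
    rintro ⟨⟨g1, g2⟩, g3, -⟩
    exact h (hg.2 g1 g2 g3)
  rw [if_neg t1, add_zero]
  by_cases h3 : inR x a b (c' + 1) (r' + 1) ∧ inR x a b (c' + 1) r'
  · rw [if_pos h3]
    rw [if_neg]
    rintro ⟨hX, g2⟩
    have hW := hX c' (succ_ne c')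
    rw [h1] at hW
    exact h (hg.1 h3.1 h3.2 hW g2)
  · rw [if_neg h3]

theorem pI_prj : pI c' r' = prj (fun x : GridState (n + 1) => x (c' + 1) = r' + 1) := by
  unfold pI prj
  congr 1
  ext1 x
  by_cases h : x (c' + 1) = r' + 1 <;> simp [h]

theorem pN_prj : pN c' r' = prj (fun x : GridState (n + 1) => ¬ x (c' + 1) = r' + 1) := by
  unfold pN prj
  congr 1
  ext1 x
  by_cases h : x (c' + 1) = r' + 1 <;> simp [h]

set_option maxHeartbeats 2000000 in
theorem main_alg (h0 : G'.Orow (c' + 1) = r' + 1) (h1 : G'.Xrow c' = r' + 1)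
    (h2 : G'.Xrow (c' + 1) = r') (hd : diff4 G' = op (wd G'))
    (hh : hX2I G' c' r' = op (wh G' (c' + 1) (r' + 1) r')) :
    (dII G' c' r' ∘ₗ hX2I G' c' r' + hX2I G' c' r' ∘ₗ dNN G' c' r' = 0) ∧
    (∃ g k : GC (n + 1) →ₗ[Rng (n + 1)] GC (n + 1),
      pN c' r' ∘ₗ g ∘ₗ pI c' r' = g ∧
      pN c' r' ∘ₗ k ∘ₗ pN c' r' = k ∧
      dNN G' c' r' ∘ₗ g + g ∘ₗ dII G' c' r' = 0 ∧
      hX2I G' c' r' ∘ₗ g = pI c' r' ∧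
      g ∘ₗ hX2I G' c' r' + pN c' r' = dNN G' c' r' ∘ₗ k + k ∘ₗ dNN G' c' r') := by
  have hH : hX2I G' c' r' = op (w01 Vv vV G' c' r') := by
    rw [hh]
    exact op_congr fun x a b hab => (w01_wh G' c' r' h0 h1 x a b hab).symm
  have hg : pN c' r' ∘ₗ op (w10 Vv vV G' c' r') ∘ₗ pI c' r' = op (w10 Vv vV G' c' r') := by
    rw [pI_prj, pN_prj, prj_op_prj]
    refine op_congr fun x a b hab => ?_
    split_ifs with h
    · rfl
    · exact (w10_supp G' c' r' h1 x a b hab h).symm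
  have hk : pN c' r' ∘ₗ op (w11 Vv vV G' c' r') ∘ₗ pN c' r' = op (w11 Vv vV G' c' r') := by
    rw [pN_prj, prj_op_prj]
    refine op_congr fun x a b hab => ?_
    split_ifs with h
    · rfl
    · exact (w11_supp G' c' r' h1 x a b hab h).symm
  have hII : pI c' r' ∘ₗ pI c' r' = pI c' r' := by
    rw [pI_prj, prj_prj]; simp only [and_self]
  have hNN : pN c' r' ∘ₗ pN c' r' = pN c' r' := by
    rw [pN_prj, prj_prj]; simp only [and_self]
  have hIN : pI c' r' ∘ₗ pN c' r' = 0 := by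
    rw [pN_prj, pI_prj, prj_prj]; simp only [not_and_self]
    refine GC_ext fun x y => ?_
    rw [prj_single]; simp
  have hNI : pN c' r' ∘ₗ pI c' r' = 0 := by
    rw [pN_prj, pI_prj, prj_prj]; simp only [and_not_self]
    refine GC_ext fun x y => ?_
    rw [prj_single]; simp
  have hH2 : op (w01 Vv vV G' c' r') = pI c' r' ∘ₗ op (w01 Vv vV G' c' r') ∘ₗ pN c' r' := by
    rw [← hH]
    refine LinearMap.ext fun z => ?_
    have q1 := fun z => LinearMap.congr_fun hII z
    have q2 := fun z => LinearMap.congr_fun hNN z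
    simp only [LinearMap.comp_apply] at q1 q2
    simp only [hX2I, LinearMap.comp_apply, q1, q2]
  have h1' : pI c' r' + pN c' r' = LinearMap.id := by rw [pI_prj, pN_prj, prj_id]
  have hd' : op (w00 Vv vV G' c' r') = pI c' r' ∘ₗ diff4 G' ∘ₗ pI c' r' +
      pN c' r' ∘ₗ diff4 G' ∘ₗ pN c' r' := by
    rw [hd, pI_prj, pN_prj, prj_op_prj, prj_op_prj, op_add]
    refine op_congr fun x a b hab => ?_
    rw [w00_wd G' c' r' h0 h1 h2 x a b hab]
    by_cases u1 : x (c' + 1) = r' + 1 <;>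
    by_cases u2 : (x * Equiv.swap a b) (c' + 1) = r' + 1 <;> simp only [u1, u2] <;> simp
  have two : ∀ r : Module.End (Rng (n + 1)) (GC (n + 1)), r + r = 0 := by
    intro r
    refine GC_ext fun x y => ?_
    rw [LinearMap.add_apply, Finsupp.add_apply, Rng_two]
    rfl
  have em : ∀ f g : Module.End (Rng (n + 1)) (GC (n + 1)), f ∘ₗ g = f * g := fun _ _ => rfl
  have r1 := rel01 G' c' r' h1 h2
  have r2 := rel10 G' c' r' h1 h2
  have r3 := rel11 G' c' r' h1 h2
  rw [hH]
  clear hH hh hd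
  unfold dII dNN
  generalize op (w01 Vv vV G' c' r') = H at *
  generalize op (w10 Vv vV G' c' r') = g at *
  generalize op (w11 Vv vV G' c' r') = k at *
  generalize op (w00 Vv vV G' c' r') = d at *
  generalize diff4 G' = D at *
  generalize pI c' r' = I at *
  generalize pN c' r' = M at *
  simp only [em] at hII hNN hIN hNI hH2 hg hk hd' r1 r2 r3 ⊢
  have e1 : (LinearMap.id : GC (n + 1) →ₗ[Rng (n + 1)] GC (n + 1)) =
    (1 : Module.End (Rng (n + 1)) (GC (n + 1))) := rfl
  rw [e1] at h1' r3
  obtain ⟨k1, k2, k3, k4⟩ := alg_concl' (R := Module.End (Rng (n + 1)) (GC (n + 1))) two hII hNN hIN hNI h1' hH2 hg hk hd' r1 r2 r3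
  exact ⟨k1, g, k, hg, hk, k2, k3, k4⟩

end fin
end T8

section T9
set_option linter.unusedSectionVars false
variable {N : ℕ} [NeZero N]

/-! ### the covering projection -/
theorem pr_add (u v : ZMod (2 * N)) : pr (u + v) = pr u + pr v := map_add _ _ _
theorem pr_sub (u v : ZMod (2 * N)) : pr (u - v) = pr u - pr v := map_sub _ _ _
theorem pr_one : pr (1 : ZMod (2 * N)) = 1 := map_one _
theorem pr_cast (k : ℕ) : pr (k : ZMod (2 * N)) = (k : ZMod N) := map_natCast _ _

theorem pr_val (u : ZMod (2 * N)) : (pr u).val = u.val % N := by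
  have h : pr u = ((u.val : ℕ) : ZMod N) := by
    rw [← pr_cast, ZMod.natCast_zmod_val]
  rw [h, ZMod.val_natCast]

def lf (a : ZMod N) : ZMod (2 * N) := (a.val : ZMod (2 * N))

theorem pr_lf (a : ZMod N) : pr (lf a) = a := by
  unfold lf
  rw [pr_cast, ZMod.natCast_zmod_val]

theorem lf_val (a : ZMod N) : (lf a).val = a.val := by
  unfold lf
  rw [ZMod.val_natCast, Nat.mod_eq_of_lt]
  have := ZMod.val_lt a
  omega

theorem lf_pr (u : ZMod (2 * N)) (h : u.val < N) : lf (pr u) = u := by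
  unfold lf
  rw [pr_val, Nat.mod_eq_of_lt h, ZMod.natCast_zmod_val]

theorem half_val : ((N : ℕ) : ZMod (2 * N)).val = N := by
  have hN : 0 < N := NeZero.pos N
  rw [ZMod.val_natCast, Nat.mod_eq_of_lt (by omega)]

theorem half_ne : ((N : ℕ) : ZMod (2 * N)) ≠ 0 := by
  have hN : 0 < N := NeZero.pos N
  intro h
  have := half_val (N := N)
  rw [h, ZMod.val_zero] at this
  omega

theorem pr_eq_zero (u : ZMod (2 * N)) : pr u = 0 ↔ u = 0 ∨ u = (N : ℕ) := by
  have hN : 0 < N := NeZero.pos N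
  constructor
  · intro h
    have h1 := pr_val u
    rw [h, ZMod.val_zero] at h1
    have h2 := ZMod.val_lt u
    have h3 : u.val = 0 ∨ u.val = N := by
      obtain ⟨q, hq⟩ := Nat.dvd_of_mod_eq_zero h1.symm
      have : q < 2 := by
        by_contra h4
        have : N * 2 ≤ N * q := Nat.mul_le_mul_left _ (by omega)
        omega
      interval_cases q <;> omega
    rcases h3 with h3 | h3
    · left; exact (ZMod.val_eq_zero u).1 h3
    · right
      have h4 := ZMod.natCast_zmod_val u
      rw [← h4]
      exact congrArg _ h3
  · rintro (h | h)
    · rw [h]; exact map_zero _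
    · rw [h, pr_cast]; exact ZMod.natCast_self N

theorem pr_eq_iff (u v : ZMod (2 * N)) : pr u = pr v ↔ u = v ∨ u = v + (N : ℕ) := by
  rw [← sub_eq_zero, ← pr_sub, pr_eq_zero, sub_eq_zero, sub_eq_iff_eq_add, add_comm v]

theorem ind4 (a b : ZMod (2 * N)) (p : ZMod (2 * N) × ZMod (2 * N)) :
    ((if p = (a, b) then 1 else 0) + (if p = (a, b + (N : ℕ)) then 1 else 0) +
    (if p = (a + (N : ℕ), b) then 1 else 0) +
    (if p = (a + (N : ℕ), b + (N : ℕ)) then 1 else 0) : ℤ) =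
    if pr p.1 = pr a ∧ pr p.2 = pr b then 1 else 0 := by
  obtain ⟨u, v⟩ := p
  simp only [Prod.mk.injEq, pr_eq_iff]
  have h1 : ∀ c : ZMod (2 * N), ¬ c = c + (N : ℕ) := fun c h => half_ne (N := N) (by simpa using h)
  have h1' : ∀ c : ZMod (2 * N), ¬ c + (N : ℕ) = c := fun c h => half_ne (N := N) (by simpa using h)
  by_cases ha : u = a
  · subst ha
    by_cases hb : v = b
    · subst hb; simp [half_ne]
    · by_cases hb' : v = b + (N : ℕ) 
      · subst hb'; simp [half_ne]
      · simp [hb, hb', half_ne]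
  · by_cases ha' : u = a + (N : ℕ)
    · subst ha'
      by_cases hb : v = b
      · subst hb; simp [half_ne]
      · by_cases hb' : v = b + (N : ℕ) 
        · subst hb'; simp [half_ne]
        · simp [hb, hb', half_ne]
    · simp [ha, ha']

/-- torus version of the corner function -/
def ctor (W E S T k j : ZMod N) : ℤ :=
  (if k = E ∧ j = S then 1 else 0) + (if k = W ∧ j = T then 1 else 0)
    - (if k = W ∧ j = S then 1 else 0) - (if k = E ∧ j = T then 1 else 0)

theorem cornerA_sum (r : Rect (2 * N)) (p : ZMod (2 * N) × ZMod (2 * N)) :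
    cornerA r p + cornerA (trN r) p + cornerA (trE r) p + cornerA (trN (trE r)) p =
    ctor (pr r.cW) (pr r.cE) (pr r.rS) (pr r.rN) (pr p.1) (pr p.2) := by
  unfold ctor cornerA trN trE
  rw [← ind4, ← ind4, ← ind4, ← ind4]
  ring

theorem cornerB_neg (r : Rect (2 * N)) (p : ZMod (2 * N) × ZMod (2 * N)) :
    cornerB r p = - cornerA r p := by
  unfold cornerA cornerB
  ring

theorem isRect4_iff (x y : GridState N) (r : Rect (2 * N)) :
    IsRect4From x y r ↔ r.cW ≠ r.cE ∧ r.rS ≠ r.rN ∧ ∀ k j,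
      ctor (pr r.cW) (pr r.cE) (pr r.rS) (pr r.rN) k j =
        (if y k = j then 1 else 0) - (if x k = j then 1 else 0) := by
  unfold IsRect4From
  constructor
  · rintro ⟨h1, h2, h3, -⟩
    refine ⟨h1, h2, fun k j => ?_⟩
    have := h3 (lf k, lf j)
    rw [cornerA_sum] at this
    simpa [stInd, pr_lf] using this
  · rintro ⟨h1, h2, h3⟩
    have h4 : ∀ p, cornerA r p + cornerA (trN r) p + cornerA (trE r) p + cornerA (trN (trE r)) p
      = stInd y p - stInd x p := by
      intro p
      rw [cornerA_sum, h3]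
      rfl
    refine ⟨h1, h2, h4, fun p => ?_⟩
    have := h4 p
    simp only [cornerB_neg]
    linarith

theorem ctor_state {x y : GridState N} {W E S T : ZMod N} (hWE : W ≠ E) (hST : S ≠ T)
    (h : ∀ k j, ctor W E S T k j = (if y k = j then 1 else 0) - (if x k = j then 1 else 0)) :
    x W = S ∧ x E = T ∧ y = x * Equiv.swap W E := by
  have e1 := h W S
  have e2 := h E T
  have e3 := h W T
  have e4 := h E S
  have hEW := hWE.symm
  have hTS := hST.symm
  simp only [ctor, hWE, hST, hEW, hTS, true_and, and_true, and_false, false_and, and_self,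
    if_true, if_false] at e1 e2 e3 e4
  have x1 : x W = S := by
    by_contra hh
    rw [if_neg hh] at e1
    split_ifs at e1 <;> omega
  have x2 : x E = T := by
    by_contra hh
    rw [if_neg hh] at e2
    split_ifs at e2 <;> omega
  have y1 : y W = T := by
    by_contra hh
    rw [if_neg hh] at e3
    split_ifs at e3 <;> omega
  have y2 : y E = S := by
    by_contra hh
    rw [if_neg hh] at e4
    split_ifs at e4 <;> omega
  refine ⟨x1, x2, Equiv.ext fun k => ?_⟩
  rw [Equiv.Perm.mul_apply]
  by_cases k1 : k = W
  · rw [k1, Equiv.swap_apply_left, x2, y1]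
  by_cases k2 : k = E
  · rw [k2, Equiv.swap_apply_right, x1, y2]
  rw [Equiv.swap_apply_of_ne_of_ne k1 k2]
  have e5 := h k (x k)
  simp only [ctor, k1, k2, false_and, if_false, if_true] at e5
  by_contra hh
  rw [if_neg hh] at e5
  omega

theorem state_ctor (x : GridState N) {W E : ZMod N} (hWE : W ≠ E) (k j : ZMod N) :
    ctor W E (x W) (x E) k j =
      (if (x * Equiv.swap W E) k = j then 1 else 0) - (if x k = j then 1 else 0) := by
  rw [Equiv.Perm.mul_apply]
  unfold ctor
  have hEW := hWE.symm
  by_cases k1 : k = W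
  · subst k1
    rw [Equiv.swap_apply_left]
    simp only [hWE, true_and, false_and, if_false, eq_comm (a := j)]
    ring
  by_cases k2 : k = E
  · subst k2
    rw [Equiv.swap_apply_right]
    simp only [hEW, true_and, false_and, if_false, eq_comm (a := j)]
    ring
  rw [Equiv.swap_apply_of_ne_of_ne k1 k2]
  simp [k1, k2]

/-! ### counting lifts -/
def wid (u v : ZMod (2 * N)) : ℕ := (v - u).val

def cnt1 (u v : ZMod (2 * N)) (i : ZMod N) : ℕ :=
  ∑ t : ZMod (2 * N), if pr t = i ∧ inIco u v t then 1 else 0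

theorem cnt1_eq (u v : ZMod (2 * N)) (i : ZMod N) :
    cnt1 u v i = (if (i - pr u).val < wid u v then 1 else 0) +
      (if (i - pr u).val + N < wid u v then 1 else 0) := by
  have hN : 0 < N := NeZero.pos N
  unfold cnt1
  set d : ZMod (2 * N) := lf (i - pr u) with hd
  have hdv : d.val = (i - pr u).val := lf_val _
  have hlt : (i - pr u).val < N := ZMod.val_lt _
  have hdv' : (d + (N : ℕ)).val = (i - pr u).val + N := by
    rw [ZMod.val_add_of_lt, hdv, half_val]
    rw [hdv, half_val]; omega
  have key : ∀ t : ZMod (2 * N), (if pr t = i ∧ inIco u v t then 1 else 0 : ℕ) =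
      (if t = u + d then (if (i - pr u).val < wid u v then 1 else 0) else 0) +
      (if t = u + d + (N : ℕ) then (if (i - pr u).val + N < wid u v then 1 else 0) else 0) := by
    intro t
    have hp : pr t = i ↔ t = u + d ∨ t = u + d + (N : ℕ) := by
      rw [← pr_eq_iff, pr_add, hd, pr_lf, add_sub_cancel]
    have hne : u + d ≠ u + d + (N : ℕ) := fun h => half_ne (N := N) (by simpa using h)
    by_cases t1 : t = u + d
    · rw [if_pos t1, if_neg (fun h => hne (t1.symm.trans h)), add_zero]
      have : inIco u v t ↔ (i - pr u).val < wid u v := by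
        unfold inIco wid
        rw [t1, add_sub_cancel_left, hdv]
      simp only [hp.2 (Or.inl t1), true_and, this]
    · by_cases t2 : t = u + d + (N : ℕ)
      · rw [if_neg t1, if_pos t2, zero_add]
        have : inIco u v t ↔ (i - pr u).val + N < wid u v := by
          unfold inIco wid
          rw [t2, add_assoc, add_sub_cancel_left, hdv']
        simp only [hp.2 (Or.inr t2), true_and, this]
      · rw [if_neg t1, if_neg t2, if_neg]
        rintro ⟨h, -⟩
        exact (hp.1 h).elim t1 t2
  simp only [key, Finset.sum_add_distrib, Finset.sum_ite_eq', Finset.mem_univ, if_true]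

theorem wid_narrow {u v : ZMod (2 * N)} (h : wid u v < N) : (pr v - pr u).val = wid u v := by
  rw [← pr_sub, pr_val]
  exact Nat.mod_eq_of_lt h

theorem cnt1_narrow {u v : ZMod (2 * N)} (h : wid u v < N) (i : ZMod N) :
    cnt1 u v i = if inIco (pr u) (pr v) i then 1 else 0 := by
  rw [cnt1_eq, if_neg (show ¬ (i - pr u).val + N < wid u v by omega), add_zero]
  have : inIco (pr u) (pr v) i ↔ (i - pr u).val < wid u v := by
    unfold inIco
    rw [wid_narrow h]
  simp only [this]

theorem mult_sum (r : Rect (2 * N)) (i j : ZMod N) :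
    (∑ p : ZMod (2 * N) × ZMod (2 * N), if pr p.1 = i ∧ pr p.2 = j then r.mult p else 0) =
    cnt1 r.cW r.cE i * cnt1 r.rS r.rN j := by
  rw [Fintype.sum_prod_type]
  unfold cnt1
  rw [Finset.sum_mul_sum]
  refine Finset.sum_congr rfl fun s _ => Finset.sum_congr rfl fun t _ => ?_
  unfold Rect.mult
  by_cases h1 : pr s = i <;> by_cases h2 : pr t = j <;> by_cases h3 : inIco r.cW r.cE s <;>
  by_cases h4 : inIco r.rS r.rN t <;> simp [h1, h2, h3, h4]

theorem O4_eq (G : GridDiagram N) (r : Rect (2 * N)) (i : ZMod N) :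
    O4count G r i = cnt1 r.cW r.cE i * cnt1 r.rS r.rN (G.Orow i) := mult_sum r i _

theorem X4_eq (G : GridDiagram N) (r : Rect (2 * N)) (i : ZMod N) :
    X4count G r i = cnt1 r.cW r.cE i * cnt1 r.rS r.rN (G.Xrow i) := mult_sum r i _

theorem wid_pos {u v : ZMod (2 * N)} (h : u ≠ v) : 0 < wid u v := by
  unfold wid
  rw [Nat.pos_iff_ne_zero, Ne, ZMod.val_eq_zero, sub_eq_zero]
  exact fun h' => h h'.symm

theorem cnt1_self {u v : ZMod (2 * N)} (h : u ≠ v) : cnt1 u v (pr u) ≠ 0 := by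
  rw [cnt1_eq, sub_self, ZMod.val_zero, if_pos (wid_pos h)]
  omega

theorem cnt1_wide {u v : ZMod (2 * N)} (h : N ≤ wid u v) (i : ZMod N) : cnt1 u v i ≠ 0 := by
  have hlt : (i - pr u).val < N := ZMod.val_lt _
  rw [cnt1_eq, if_pos (by omega)]
  omega

theorem narrow_of_disj {G : GridDiagram N} {x y : GridState N} {r : Rect (2 * N)}
    (h : IsRect4From x y r) (hX : XDisjoint4 G r) : wid r.cW r.cE < N ∧ wid r.rS r.rN < N := by
  obtain ⟨h1, h2, -⟩ := h
  constructor
  · by_contra hc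
    obtain ⟨i, hi⟩ := G.hX.2 (pr r.rS)
    have := hX i
    rw [X4_eq, hi] at this
    exact (mul_ne_zero (cnt1_wide (by omega) i) (cnt1_self h2)) this
  · by_contra hc
    have := hX (pr r.cW)
    rw [X4_eq] at this
    exact (mul_ne_zero (cnt1_self h1) (cnt1_wide (by omega) _)) this

/-! ### lifts -/
def lift4 (x : GridState N) (a b : ZMod N) : Rect (2 * N) :=
  ⟨lf a, lf a + lf (b - a), lf (x a), lf (x a) + lf (x b - x a)⟩

theorem wid_lift (a b : ZMod N) : wid (lf a) (lf a + lf (b - a)) = (b - a).val := by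
  unfold wid
  rw [add_sub_cancel_left, lf_val]

theorem pr_lift (a b : ZMod N) : pr (lf a + lf (b - a)) = b := by
  rw [pr_add, pr_lf, pr_lf, add_sub_cancel]

theorem lift_eq (u v : ZMod (2 * N)) (h : wid u v < N) (h' : u.val < N) :
    u = lf (pr u) ∧ v = lf (pr u) + lf (pr v - pr u) := by
  rw [lf_pr u h', ← pr_sub, lf_pr (v - u) h, add_sub_cancel]
  exact ⟨rfl, rfl⟩

theorem narrow_iff (x y : GridState N) (r : Rect (2 * N)) :
    (IsRect4From x y r ∧ normal4 r ∧ wid r.cW r.cE < N ∧ wid r.rS r.rN < N) ↔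
    ∃ a b, a ≠ b ∧ y = x * Equiv.swap a b ∧ r = lift4 x a b := by
  rw [isRect4_iff]
  constructor
  · rintro ⟨⟨h1, h2, h3⟩, ⟨n1, n2⟩, w1, w2⟩
    have hWE : pr r.cW ≠ pr r.cE := by
      intro h
      have := wid_narrow w1
      rw [h, sub_self, ZMod.val_zero] at this
      exact absurd this (wid_pos h1).ne
    have hST : pr r.rS ≠ pr r.rN := by
      intro h
      have := wid_narrow w2
      rw [h, sub_self, ZMod.val_zero] at this
      exact absurd this (wid_pos h2).ne
    obtain ⟨x1, x2, hy⟩ := ctor_state hWE hST h3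
    refine ⟨pr r.cW, pr r.cE, hWE, hy, ?_⟩
    unfold lift4
    rw [x1, x2]
    obtain ⟨a1, a2⟩ := lift_eq r.cW r.cE w1 n1
    obtain ⟨b1, b2⟩ := lift_eq r.rS r.rN w2 n2
    rw [← a2, ← b2, ← a1, ← b1]
  · rintro ⟨a, b, hab, rfl, rfl⟩
    have hx : x a ≠ x b := fun h' => hab (x.injective h')
    unfold lift4 normal4
    simp only [wid_lift, pr_lift, lf_val, pr_lf]
    refine ⟨⟨?_, ?_, fun k j => state_ctor x hab k j⟩, ⟨ZMod.val_lt _, ZMod.val_lt _⟩,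
      ZMod.val_lt _, ZMod.val_lt _⟩
    · intro h
      apply hab
      have := congrArg pr h
      rwa [pr_lift, pr_lf] at this
    · intro h
      apply hx
      have := congrArg pr h
      rwa [pr_lift, pr_lf] at this

theorem lift_inj {x : GridState N} {a b a' b' : ZMod N} (h : lift4 x a b = lift4 x a' b') :
    a = a' ∧ b = b' := by
  unfold lift4 at h
  rw [Rect.mk.injEq] at h
  obtain ⟨h1, h2, -⟩ := h
  have e1 := congrArg pr h1
  have e2 := congrArg pr h2
  rw [pr_lf, pr_lf] at e1
  rw [pr_lift, pr_lift] at e2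
  exact ⟨e1, e2⟩

theorem sum_lift {M : Type*} [AddCommMonoid M] (x : GridState N)
    (C : GridState N → Rect (2 * N) → Prop) (f : GridState N → Rect (2 * N) → M)
    (hC : ∀ y r, IsRect4From x y r → C y r → wid r.cW r.cE < N ∧ wid r.rS r.rN < N) :
    (∑ y : GridState N, ∑ r ∈ Finset.univ.filter
      (fun r : Rect (2 * N) => IsRect4From x y r ∧ normal4 r ∧ C y r), f y r) =
    ∑ a, ∑ b, if a ≠ b then (if C (x * Equiv.swap a b) (lift4 x a b) then
      f (x * Equiv.swap a b) (lift4 x a b) else 0) else 0 := by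
  rw [← Fintype.sum_prod_type' (f := fun a b => if a ≠ b then
    (if C (x * Equiv.swap a b) (lift4 x a b) then
      f (x * Equiv.swap a b) (lift4 x a b) else 0) else 0)]
  simp only [Finset.sum_filter]
  rw [← Fintype.sum_prod_type' (f := fun y r => if IsRect4From x y r ∧ normal4 r ∧ C y r then
    f y r else 0)]
  have e : ∀ p : ZMod N × ZMod N, (if p.1 ≠ p.2 then
    (if C (x * Equiv.swap p.1 p.2) (lift4 x p.1 p.2) then
      f (x * Equiv.swap p.1 p.2) (lift4 x p.1 p.2) else 0) else 0) =
      if p.1 ≠ p.2 ∧ C (x * Equiv.swap p.1 p.2) (lift4 x p.1 p.2) then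
        f (x * Equiv.swap p.1 p.2) (lift4 x p.1 p.2) else 0 := by
    intro p
    by_cases h1 : p.1 ≠ p.2 <;>
    by_cases h2 : C (x * Equiv.swap p.1 p.2) (lift4 x p.1 p.2) <;> simp [h1, h2]
  simp only [e]
  rw [← Finset.sum_filter, ← Finset.sum_filter]
  symm
  refine Finset.sum_bij (fun p _ => (x * Equiv.swap p.1 p.2, lift4 x p.1 p.2)) ?_ ?_ ?_ ?_
  · rintro ⟨a, b⟩ h
    rw [Finset.mem_filter] at h ⊢
    obtain ⟨-, h1, h2⟩ := h
    have := (narrow_iff x (x * Equiv.swap a b) (lift4 x a b)).2 ⟨a, b, h1, rfl, rfl⟩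
    exact ⟨Finset.mem_univ _, this.1, this.2.1, h2⟩
  · rintro ⟨a, b⟩ _ ⟨a', b'⟩ _ h
    rw [Prod.mk.injEq] at h
    obtain ⟨h1, h2⟩ := lift_inj h.2
    simp only at h1 h2
    rw [h1, h2]
  · rintro ⟨y, r⟩ h
    rw [Finset.mem_filter] at h
    obtain ⟨-, h1, h2, h3⟩ := h
    obtain ⟨a, b, hab, hy, hr⟩ := (narrow_iff x y r).1 ⟨h1, h2, hC y r h1 h3⟩
    simp only at hy hr h3
    refine ⟨(a, b), ?_, ?_⟩
    · rw [Finset.mem_filter]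
      refine ⟨Finset.mem_univ _, hab, ?_⟩
      rw [hy, hr] at h3
      exact h3
    · rw [hy, hr]
  · rintro ⟨a, b⟩ _
    rfl

end T9

section TA
set_option linter.unusedSectionVars false
variable {N : ℕ} [NeZero N]

theorem edge_wt {a b : ZMod N} (h : a ≠ b) (k : ZMod N) :
    ((if inIco a b (k - 1) then 1 else 0) + (if inIco a b k then 1 else 0) : ℕ) =
      if k = a ∨ k = b then 1 else if inIoo a b k then 2 else 0 := by
  have e : k - 1 + 1 = k := by ring
  have hf := colFact (c := k - 1) h
  rw [e] at hf
  rcases hf with ⟨h0, h1, h2⟩ | ⟨h0, h1, h2⟩ | ⟨h0, h0', h1⟩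
  · simp [h0, h1, h2]
    rw [h0] at h1 h2
    simp [h1, h2]
  · rw [if_pos h2, if_neg h1, if_pos (Or.inr h0)]
  · have : inIoo a b k ↔ inIco a b k := ioo_iff_ico h0
    by_cases h2 : inIco a b k
    · simp [h0, h0', h1.symm, h2, this]
    · simp [h0, h0', h1.symm, h2, this]

theorem pmTerm (r : Rect (2 * N)) (w : GridState N) (δ ε : ZMod (2 * N)) :
    (∑ p : ZMod (2 * N) × ZMod (2 * N), if w (pr p.1) = pr p.2 then r.mult (p.1 - δ, p.2 - ε)
      else 0) = ∑ k : ZMod N, cnt1 r.cW r.cE (k - pr δ) * cnt1 r.rS r.rN (w k - pr ε) := by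
  simp only [← mult_sum]
  rw [Finset.sum_comm]
  have e := Fintype.sum_equiv (Equiv.addRight ((δ, ε) : ZMod (2 * N) × ZMod (2 * N)))
    (fun p => if w (pr (p + (δ, ε)).1) = pr (p + (δ, ε)).2 then r.mult p else 0)
    (fun p => if w (pr p.1) = pr p.2 then r.mult (p.1 - δ, p.2 - ε) else 0) (by
      intro p
      simp)
  rw [← e]
  refine Finset.sum_congr rfl fun p _ => ?_
  rw [Finset.sum_eq_single (pr (p + (δ, ε)).1)]
  · simp only [Prod.fst_add, Prod.snd_add, pr_add, add_sub_cancel_right, true_and]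
    simp only [eq_sub_iff_add_eq, eq_comm]
  · intro k _ hk
    rw [if_neg]
    rintro ⟨h1, -⟩
    apply hk
    rw [Prod.fst_add, pr_add, h1, sub_add_cancel]
  · intro h
    exact absurd (Finset.mem_univ _) h

theorem rpm4_eq (r : Rect (2 * N)) (w : GridState N) :
    rpm4 w r = ((∑ k : ZMod N, (cnt1 r.cW r.cE (k - 1) + cnt1 r.cW r.cE k) *
      (cnt1 r.rS r.rN (w k - 1) + cnt1 r.rS r.rN (w k)) : ℕ) : ℚ) / 4 := by
  unfold rpm4 pm4
  congr 1
  have e : ∀ p : ZMod (2 * N) × ZMod (2 * N), (if w (pr p.1) = pr p.2 then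
      ((r.dom4 (p.1 - 1, p.2 - 1) + r.dom4 (p.1, p.2 - 1) + r.dom4 (p.1 - 1, p.2) + r.dom4 p : ℤ) : ℚ)
    else 0) = (((if w (pr p.1) = pr p.2 then r.mult (p.1 - 1, p.2 - 1) else 0) +
      (if w (pr p.1) = pr p.2 then r.mult (p.1 - 0, p.2 - 1) else 0) +
      (if w (pr p.1) = pr p.2 then r.mult (p.1 - 1, p.2 - 0) else 0) +
      (if w (pr p.1) = pr p.2 then r.mult (p.1 - 0, p.2 - 0) else 0) : ℕ) : ℚ) := by
    intro p
    unfold Rect.dom4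
    split_ifs
    · push_cast
      simp
    · simp
  simp only [e]
  rw [← Nat.cast_sum]
  congr 1
  simp only [Finset.sum_add_distrib, pmTerm]
  rw [← Finset.sum_add_distrib, ← Finset.sum_add_distrib, ← Finset.sum_add_distrib]
  refine Finset.sum_congr rfl fun k _ => ?_
  have h0 : pr (0 : ZMod (2 * N)) = 0 := map_zero _
  rw [pr_one, h0, sub_zero, sub_zero]
  ring

theorem rpm4_lift (x w : GridState N) {a b : ZMod N} (hab : a ≠ b)
    (ha : w a = x a ∨ w a = x b) (hb : w b = x a ∨ w b = x b)
    (hw : ∀ k, k ≠ a → k ≠ b → w k = x k) :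
    rpm4 w (lift4 x a b) = icnt x a b + 1 / 2 := by
  have hx : x a ≠ x b := fun h' => hab (x.injective h')
  rw [rpm4_eq]
  have w1 : wid (lift4 x a b).cW (lift4 x a b).cE < N := by
    unfold lift4; simp only [wid_lift]; exact ZMod.val_lt _
  have w2 : wid (lift4 x a b).rS (lift4 x a b).rN < N := by
    unfold lift4; simp only [wid_lift]; exact ZMod.val_lt _
  have e1 : ∀ i, cnt1 (lift4 x a b).cW (lift4 x a b).cE i = if inIco a b i then 1 else 0 := by
    intro i
    rw [cnt1_narrow w1]
    unfold lift4
    simp only [pr_lift, pr_lf]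
  have e2 : ∀ i, cnt1 (lift4 x a b).rS (lift4 x a b).rN i =
      if inIco (x a) (x b) i then 1 else 0 := by
    intro i
    rw [cnt1_narrow w2]
    unfold lift4
    simp only [pr_lift, pr_lf]
  simp only [e1, e2, edge_wt hab, edge_wt hx]
  have key : (∑ k : ZMod N, (if k = a ∨ k = b then 1 else if inIoo a b k then 2 else 0) *
      (if w k = x a ∨ w k = x b then 1 else if inIoo (x a) (x b) (w k) then 2 else 0) : ℕ) =
      2 + 4 * icnt x a b := by
    have t : ∀ k : ZMod N, ((if k = a ∨ k = b then 1 else if inIoo a b k then 2 else 0) *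
      (if w k = x a ∨ w k = x b then 1 else if inIoo (x a) (x b) (w k) then 2 else 0) : ℕ) =
      (if k = a then 1 else 0) + (if k = b then 1 else 0) +
        4 * (if inIoo a b k ∧ inIoo (x a) (x b) (x k) then 1 else 0) := by
      intro k
      by_cases ka : k = a
      · have : ¬ inIoo a b k := by rw [ka]; exact not_ioo_left
        have kb : ¬ k = b := fun h => hab (ka.symm.trans h)
        rw [if_pos (Or.inl ka), if_pos (by rw [ka]; exact ha), if_pos ka, if_neg kb,
          if_neg (fun h => this h.1)]
      · by_cases kb : k = b
        · have : ¬ inIoo a b k := by rw [kb]; exact not_ioo_right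
          rw [if_pos (Or.inr kb), if_pos (by rw [kb]; exact hb), if_neg ka, if_pos kb,
            if_neg (fun h => this h.1)]
        · have h1 : ¬ (x k = x a ∨ x k = x b) := by
            rintro (h | h)
            · exact ka (x.injective h)
            · exact kb (x.injective h)
          rw [hw k ka kb, if_neg h1, if_neg (not_or.2 ⟨ka, kb⟩), if_neg ka, if_neg kb]
          by_cases u1 : inIoo a b k <;> by_cases u2 : inIoo (x a) (x b) (x k) <;> simp [u1, u2]
    simp only [t, Finset.sum_add_distrib, ← Finset.mul_sum, Finset.sum_ite_eq', Finset.mem_univ,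
      if_true]
    unfold icnt
    rw [Finset.card_filter]
  rw [key]
  push_cast
  ring

theorem m4_lift (x : GridState N) {a b : ZMod N} (hab : a ≠ b) :
    m4 x (x * Equiv.swap a b) (lift4 x a b) = icnt x a b := by
  unfold m4 mQ4
  rw [rpm4_lift x x hab (Or.inl rfl) (Or.inr rfl) (fun _ _ _ => rfl),
    rpm4_lift x (x * Equiv.swap a b) hab (Or.inr (by simp)) (Or.inl (by simp))
      (fun k h1 h2 => by rw [Equiv.Perm.mul_apply, Equiv.swap_apply_of_ne_of_ne h1 h2])]
  have : ((icnt x a b : ℚ) + 1 / 2 + (icnt x a b + 1 / 2) - 1) / 2 = ((icnt x a b : ℤ) : ℚ) := by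
    push_cast; ring
  rw [this, Int.floor_intCast]
  simp

theorem cnt_lift (x : GridState N) (a b i j : ZMod N) :
    cnt1 (lift4 x a b).cW (lift4 x a b).cE i * cnt1 (lift4 x a b).rS (lift4 x a b).rN j =
      if inR x a b i j then 1 else 0 := by
  have w1 : wid (lift4 x a b).cW (lift4 x a b).cE < N := by
    unfold lift4; simp only [wid_lift]; exact ZMod.val_lt _
  have w2 : wid (lift4 x a b).rS (lift4 x a b).rN < N := by
    unfold lift4; simp only [wid_lift]; exact ZMod.val_lt _
  rw [cnt1_narrow w1, cnt1_narrow w2]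
  unfold lift4 inR
  simp only [pr_lift, pr_lf]
  by_cases h1 : inIco a b i <;> by_cases h2 : inIco (x a) (x b) j <;> simp [h1, h2]

theorem wt4_lift (G : GridDiagram N) (x : GridState N) {a b : ZMod N} (hab : a ≠ b) :
    wt4 G x (x * Equiv.swap a b) (lift4 x a b) = mO G x a b * vV ^ icnt x a b := by
  unfold wt4 mO
  rw [m4_lift x hab]
  simp only [O4_eq, cnt_lift]

theorem disj_lift (G : GridDiagram N) (x : GridState N) (a b : ZMod N) :
    XDisjoint4 G (lift4 x a b) ↔ ∀ i, ¬ inR x a b i (G.Xrow i) := by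
  unfold XDisjoint4
  simp only [X4_eq, cnt_lift]
  refine forall_congr' fun i => ?_
  by_cases h : inR x a b i (G.Xrow i) <;> simp [h]

theorem diff4_eq (G : GridDiagram N) : diff4 G = op (wd G) := by
  unfold diff4 op
  congr 1
  ext1 x
  rw [sum_lift x (fun _ r => XDisjoint4 G r) (fun y r => Finsupp.single y (wt4 G x y r))
    (fun y r h1 h2 => narrow_of_disj h1 h2)]
  refine Finset.sum_congr rfl fun a _ => Finset.sum_congr rfl fun b _ => ?_
  by_cases hab : a ≠ b
  · rw [if_pos hab, if_pos hab, wt4_lift G x hab]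
    unfold wd
    by_cases h : ∀ i, ¬ inR x a b i (G.Xrow i)
    · rw [if_pos h, if_pos ((disj_lift G x a b).2 h)]
    · rw [if_neg h, if_neg (fun hh => h ((disj_lift G x a b).1 hh)), Finsupp.single_zero]
  · rw [if_neg hab, if_neg hab]

end TA

section TB
set_option linter.unusedSectionVars false
variable {n : ℕ} [NeZero n] (G' : GridDiagram (n + 1)) (c' r' : ZMod (n + 1))

def XC (r : Rect (2 * (n + 1))) : Prop :=
  X4count G' r (c' + 1) = 1 ∧ ∀ k, k ≠ c' + 1 → X4count G' r k = 0

def CC (x y : GridState (n + 1)) (r : Rect (2 * (n + 1))) : Prop :=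
  (x (c' + 1) ≠ r' + 1 ∧ y (c' + 1) = r' + 1) ∧ XC G' c' r

theorem cnt1_pred {N : ℕ} [NeZero N] {u v : ZMod (2 * N)} (h : u ≠ v) :
    cnt1 u v (pr v - 1) ≠ 0 ∧ (N < wid u v → cnt1 u v (pr v - 1) = 2) := by
  have hN : 0 < N := NeZero.pos N
  have hp := wid_pos h
  have hlt : wid u v < 2 * N := ZMod.val_lt _
  have e : (pr v - 1 - pr u).val = (wid u v - 1) % N := by
    have : pr v - 1 - pr u = ((wid u v - 1 : ℕ) : ZMod N) := by
      rw [Nat.cast_sub (by omega)]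
      rw [← pr_cast]
      unfold wid
      rw [ZMod.natCast_zmod_val, pr_sub]
      push_cast
      ring
    rw [this, ZMod.val_natCast]
  have h1 : (wid u v - 1) % N ≤ wid u v - 1 := Nat.mod_le _ _
  rw [cnt1_eq, e]
  refine ⟨?_, fun hw => ?_⟩
  · rw [if_pos (by omega)]; omega
  · have : (wid u v - 1) % N = wid u v - 1 - N := by
      rw [Nat.mod_eq_sub_mod (by omega), Nat.mod_eq_of_lt (by omega)]
    rw [this, if_pos (by omega), if_pos (by omega)]

theorem cnt1_two {N : ℕ} [NeZero N] {u v : ZMod (2 * N)} (h : N < wid u v) :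
    cnt1 u v (pr u) = 2 := by
  rw [cnt1_eq, sub_self, ZMod.val_zero, if_pos (by omega), if_pos (by omega)]

theorem wid_half {N : ℕ} [NeZero N] {u v : ZMod (2 * N)} (h : wid u v = N) : pr u = pr v := by
  have := pr_val (v - u)
  rw [show (v - u).val = N from h, Nat.mod_self, ZMod.val_eq_zero, pr_sub, sub_eq_zero] at this
  exact this.symm

theorem narrow_of_CC (h1 : G'.Xrow c' = r' + 1) (h2 : G'.Xrow (c' + 1) = r')
    {x y : GridState (n + 1)} {r : Rect (2 * (n + 1))}
    (h : IsRect4From x y r) (hC : CC G' c' r' x y r) :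
    wid r.cW r.cE < n + 1 ∧ wid r.rS r.rN < n + 1 := by
  rw [isRect4_iff] at h
  obtain ⟨hW, hS, h3⟩ := h
  obtain ⟨⟨c1, c2⟩, x1, x2⟩ := hC
  have h4 := h3 (c' + 1) (r' + 1)
  rw [if_pos c2, if_neg c1] at h4
  have nW : wid r.cW r.cE ≠ n + 1 := by
    intro hw
    unfold ctor at h4
    rw [wid_half hw] at h4
    split_ifs at h4 <;> omega
  have nS : wid r.rS r.rN ≠ n + 1 := by
    intro hw
    unfold ctor at h4
    rw [wid_half hw] at h4
    split_ifs at h4 <;> omega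
  have h5 : (c' + 1 = pr r.cE ∧ r' + 1 = pr r.rS) ∨ (c' + 1 = pr r.cW ∧ r' + 1 = pr r.rN) := by
    by_contra hh
    rw [not_or] at hh
    unfold ctor at h4
    rw [if_neg hh.1, if_neg hh.2] at h4
    split_ifs at h4 <;> omega
  rcases h5 with ⟨e1, e2⟩ | ⟨e1, e2⟩
  · exfalso
    have h6 := x2 c' (succ_ne c')
    rw [X4_eq, h1, e2] at h6
    have e3 : c' = pr r.cE - 1 := by rw [← e1]; ring
    rw [e3] at h6
    exact mul_ne_zero (cnt1_pred hW).1 (cnt1_self hS) h6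
  · rw [X4_eq, h2] at x1
    have e3 : r' = pr r.rN - 1 := by rw [← e2]; ring
    rw [e1, e3] at x1
    constructor
    · by_contra hc
      rw [cnt1_two (by omega)] at x1
      omega
    · by_contra hc
      rw [(cnt1_pred hS).2 (by omega)] at x1
      omega

theorem hX2I_eq (h1 : G'.Xrow c' = r' + 1) (h2 : G'.Xrow (c' + 1) = r') :
    hX2I G' c' r' = op (wh G' (c' + 1) (r' + 1) r') := by
  have hx : ∀ x, hX2I G' c' r' (Finsupp.single x 1) = ∑ y : GridState (n + 1),
      ∑ r ∈ Finset.univ.filter (fun r : Rect (2 * (n + 1)) =>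
        IsRect4From x y r ∧ normal4 r ∧ CC G' c' r' x y r), Finsupp.single y (wt4 G' x y r) := by
    intro x
    unfold hX2I
    rw [LinearMap.comp_apply, LinearMap.comp_apply, pN_prj, pI_prj, prj_single]
    by_cases hx : x (c' + 1) = r' + 1
    · rw [if_neg (not_not.2 hx), map_zero, map_zero]
      symm
      refine Finset.sum_eq_zero fun y _ => ?_
      rw [Finset.filter_false_of_mem, Finset.sum_empty]
      rintro r - ⟨-, -, h⟩
      exact h.1.1 hx
    · rw [if_pos hx]
      unfold HX2map
      rw [basisMap_single, one_smul, map_sum]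
      refine Finset.sum_congr rfl fun y _ => ?_
      rw [map_sum]
      by_cases hy : y (c' + 1) = r' + 1
      · refine Finset.sum_congr ?_ fun r _ => ?_
        · refine Finset.filter_congr fun r _ => ?_
          unfold CC XC
          simp only [ne_eq, hx, hy, not_false_eq_true, true_and, and_self]
        · rw [prj_single, if_pos hy]
      · rw [Finset.sum_eq_zero, Finset.filter_false_of_mem, Finset.sum_empty]
        · rintro r - ⟨-, -, h⟩
          exact hy h.1.2
        · intro r _
          rw [prj_single, if_neg hy]
  refine GC_ext fun x y => ?_
  rw [hx, op_single, one_smul]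
  congr 1
  rw [sum_lift x (fun y r => CC G' c' r' x y r) (fun y r => Finsupp.single y (wt4 G' x y r))
    (fun y r q1 q2 => narrow_of_CC G' c' r' h1 h2 q1 q2)]
  refine Finset.sum_congr rfl fun a _ => Finset.sum_congr rfl fun b _ => ?_
  by_cases hab : a ≠ b
  · rw [if_pos hab, if_pos hab, wt4_lift G' x hab]
    have hiff : CC G' c' r' x (x * Equiv.swap a b) (lift4 x a b) ↔
      (x (c' + 1) ≠ r' + 1 ∧ (x * Equiv.swap a b) (c' + 1) = r' + 1) ∧
      inR x a b (c' + 1) r' ∧ ∀ i, i ≠ c' + 1 → ¬ inR x a b i (G'.Xrow i) := by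
      unfold CC XC
      simp only [X4_eq, cnt_lift, h2]
      simp
    unfold wh
    by_cases hc : CC G' c' r' x (x * Equiv.swap a b) (lift4 x a b)
    · rw [if_pos hc, if_pos (hiff.1 hc)]
    · rw [if_neg hc, if_neg (fun hh => hc (hiff.2 hh)), Finsupp.single_zero]
  · rw [if_neg hab, if_neg hab]

end TB


/-- rational indicator of a proposition -/
def ind (p : Prop) : ℚ := if p then 1 else 0

theorem ind_and (p q : Prop) : ind (p ∧ q) = ind p * ind q := by
  unfold ind; by_cases p <;> by_cases q <;> simp [*]

theorem ind_eq (p : Prop) [Decidable p] : (if p then (1 : ℚ) else 0) = ind p := by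
  unfold ind; by_cases h : p <;> simp [h]

theorem ind_congr {p q : Prop} (h : p ↔ q) : ind p = ind q := by rw [h]

theorem Icnt_pts {m : ℕ} [NeZero m] (f g : ZMod m → ZMod m) (o o' : ℕ) :
    (Icnt (ptsOf f o) (ptsOf g o') : ℚ) =
      ∑ k, ∑ i, ind (2 * k.val + o < 2 * i.val + o') *
        ind (2 * (f k).val + o < 2 * (g i).val + o') := by
  have inj : ∀ (f : ZMod m → ZMod m) (o : ℕ), Function.Injective
      (fun k : ZMod m => (2 * k.val + o, 2 * (f k).val + o)) := by
    intro f o k l h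
    have h1 := (Prod.ext_iff.1 h).1
    simp only at h1
    exact ZMod.val_injective m (by omega)
  unfold Icnt ptsOf
  rw [Finset.sum_image (fun _ _ _ _ h => inj f o h)]
  push_cast
  refine Finset.sum_congr rfl fun k _ => ?_
  rw [Finset.card_filter, Finset.sum_image (fun _ _ _ _ h => inj g o' h)]
  push_cast
  refine Finset.sum_congr rfl fun i _ => ?_
  rw [← ind_and, ind_eq]

theorem sum_swap {m : ℕ} [NeZero m] (x : GridState m) (a b : ZMod m) (hab : a ≠ b)
    (g : ZMod m → ZMod m → ℚ) :
    ∑ k, g k ((x * Equiv.swap a b) k) =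
      ∑ k, g k (x k) + (g a (x b) + g b (x a) - g a (x a) - g b (x b)) := by
  have h : ∑ k, (g k ((x * Equiv.swap a b) k) - g k (x k)) =
      ∑ k ∈ ({a, b} : Finset (ZMod m)), (g k ((x * Equiv.swap a b) k) - g k (x k)) := by
    symm
    refine Finset.sum_subset (Finset.subset_univ _) fun k _ hk => ?_
    simp only [Finset.mem_insert, Finset.mem_singleton, not_or] at hk
    simp [Equiv.swap_apply_of_ne_of_ne hk.1 hk.2]
  rw [Finset.sum_pair hab, Finset.sum_sub_distrib] at h
  simp only [Equiv.Perm.mul_apply, Equiv.swap_apply_left, Equiv.swap_apply_right] at h ⊢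
  linarith

/-- the indicator of `u ≤ k` on representatives -/
def lei {m : ℕ} (u k : ZMod m) : ℚ := ind (u.val ≤ k.val)

/-- the planar correlation of a rectangle with the graph of `f` -/
def Tt {m : ℕ} [NeZero m] (f : ZMod m → ZMod m) (x : GridState m) (a b : ZMod m) : ℚ :=
  ∑ i, (lei a i - lei b i) * (lei (x a) (f i) - lei (x b) (f i))

theorem ind_ico {m : ℕ} [NeZero m] (a b k : ZMod m) :
    ind (inIco a b k) = lei a k - lei b k + ind (b.val < a.val) := by
  unfold ind lei ind inIco
  rw [valSub, valSub]
  have := ZMod.val_lt a; have := ZMod.val_lt b; have := ZMod.val_lt k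
  split_ifs <;> first | (exfalso; omega) | norm_num

theorem S_eq {m : ℕ} [NeZero m] (f : ZMod m → ZMod m) (hf : Function.Bijective f)
    (x : GridState m) (a b : ZMod m) :
    ∑ i, ind (inR x a b i (f i)) = Tt f x a b +
      (ind ((x b).val < (x a).val) * ∑ i, (lei a i - lei b i) +
       ind (b.val < a.val) * ∑ i, (lei (x a) i - lei (x b) i) +
       m * (ind (b.val < a.val) * ind ((x b).val < (x a).val))) := by
  rw [← hf.sum_comp (fun i => lei (x a) i - lei (x b) i)]
  have : (m : ℚ) * (ind (b.val < a.val) * ind ((x b).val < (x a).val)) =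
      ∑ _i : ZMod m, (ind (b.val < a.val) * ind ((x b).val < (x a).val)) := by
    simp [ZMod.card]
  rw [this, Tt, Finset.mul_sum, Finset.mul_sum, ← Finset.sum_add_distrib,
    ← Finset.sum_add_distrib, ← Finset.sum_add_distrib]
  refine Finset.sum_congr rfl fun i _ => ?_
  rw [inR, ind_and, ind_ico, ind_ico]
  ring

theorem S_self {m : ℕ} [NeZero m] (x : GridState m) (a b : ZMod m) (hab : a ≠ b) :
    ∑ i, ind (inR x a b i (x i)) = icnt x a b + 1 := by
  have h1 : ∀ i, ind (inR x a b i (x i)) =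
      ind (inIoo a b i ∧ inIoo (x a) (x b) (x i)) + ind (i = a) := by
    intro i
    by_cases h : i = a
    · subst h
      have hx : x i ≠ x b := fun h => hab (x.injective h)
      have e1 : inR x i b i (x i) := by
        constructor
        · unfold inIco
          simpa [ZMod.val_pos] using sub_ne_zero.2 hab.symm
        · unfold inIco
          simpa [ZMod.val_pos] using sub_ne_zero.2 hx.symm
      have e2 : ¬ inIoo i b i := not_ioo_left
      simp [ind, e1, e2]
    · have hx : x i ≠ x a := fun h' => h (x.injective h')
      have h0 : ind (i = a) = 0 := if_neg h
      rw [h0, add_zero]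
      exact ind_congr (by rw [inR, ioo_iff_ico h, ioo_iff_ico hx])
  simp only [h1, Finset.sum_add_distrib]
  congr 1
  · unfold icnt
    rw [Finset.card_filter]
    push_cast
    simp only [ind_eq]
  · rw [Finset.sum_eq_single a]
    · simp [ind]
    · intro k _ hk
      exact if_neg hk
    · simp

theorem J_marks {m : ℕ} [NeZero m] (f : ZMod m → ZMod m)
    (x : GridState m) (a b : ZMod m) (hab : a ≠ b) :
    2 * Jq (ptsOf (⇑x) 0) (ptsOf f 1) - 2 * Jq (ptsOf (⇑(x * Equiv.swap a b)) 0) (ptsOf f 1)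
      = 2 * Tt f x a b := by
  have key : ∀ y : GridState m, 2 * Jq (ptsOf (⇑y) 0) (ptsOf f 1) =
      ∑ k, ∑ i, (lei k i * lei (y k) (f i) + (1 - lei k i) * (1 - lei (y k) (f i))) := by
    intro y
    have e : ∀ u v : ZMod m, ind (2 * u.val + 0 < 2 * v.val + 1) = lei u v := by
      intro u v
      unfold lei ind
      split_ifs <;> first | (exfalso; omega) | rfl
    have e' : ∀ u v : ZMod m, ind (2 * v.val + 1 < 2 * u.val + 0) = 1 - lei u v := by
      intro u v
      unfold lei ind
      split_ifs <;> first | (exfalso; omega) | norm_num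
    unfold Jq
    rw [Icnt_pts, Icnt_pts]
    simp only [e, e']
    rw [Finset.sum_comm (f := fun k i => (1 - lei i k) * (1 - lei (y i) (f k)))]
    simp only [Finset.sum_add_distrib]
    ring
  rw [key, key, sum_swap x a b hab (fun k r => ∑ i, (lei k i * lei r (f i) +
    (1 - lei k i) * (1 - lei r (f i))))]
  rw [sub_add_cancel_left]
  simp only [← Finset.sum_add_distrib, ← Finset.sum_sub_distrib, Tt]
  rw [Finset.mul_sum, ← Finset.sum_neg_distrib]
  refine Finset.sum_congr rfl fun i _ => ?_
  ring

/-- the indicator of `u < k` on representatives -/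
def lti {m : ℕ} (u k : ZMod m) : ℚ := ind (u.val < k.val)

theorem lti_eq {m : ℕ} (u k : ZMod m) : lti u k = 1 - lei k u := by
  unfold lti lei ind
  split_ifs <;> first | (exfalso; omega) | norm_num

theorem lei_eq {m : ℕ} [NeZero m] (u k : ZMod m) : lti u k = lei u k - ind (k = u) := by
  have : k = u ↔ k.val = u.val := (ZMod.val_injective m).eq_iff.symm
  unfold lti lei ind
  rw [this]
  split_ifs <;> first | (exfalso; omega) | norm_num

theorem lti_lei {m : ℕ} [NeZero m] (u v : ZMod m) (h : u ≠ v) : lti u v + lti v u = 1 := by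
  rw [lti_eq, lei_eq]
  simp [ind, h]

theorem J_self {m : ℕ} [NeZero m] (x : GridState m) (a b : ZMod m) (hab : a ≠ b) :
    Jq (ptsOf (⇑x) 0) (ptsOf (⇑x) 0) -
      Jq (ptsOf (⇑(x * Equiv.swap a b)) 0) (ptsOf (⇑(x * Equiv.swap a b)) 0)
      = 2 * Tt x x a b - 1 := by
  have key : ∀ y : GridState m, Jq (ptsOf (⇑y) 0) (ptsOf (⇑y) 0) =
      ∑ k, ∑ i, lti k i * lti (y k) (y i) := by
    intro y
    have e : ∀ u v : ZMod m, ind (2 * u.val + 0 < 2 * v.val + 0) = lti u v := by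
      intro u v
      unfold lti ind
      split_ifs <;> first | (exfalso; omega) | rfl
    unfold Jq
    rw [Icnt_pts]
    simp only [e]
    ring
  have hx : x a ≠ x b := fun h => hab (x.injective h)
  have l0 : ∀ u : ZMod m, lti u u = 0 := fun u => by simp [lti, ind]
  have p1 := lti_lei a b hab
  have p2 := lti_lei (x a) (x b) hx
  have t1 : ∑ k, (lti k a - lti k b) * (lti (x k) (x a) - lti (x k) (x b)) = Tt x x a b := by
    unfold Tt
    refine Finset.sum_congr rfl fun k _ => ?_
    simp only [lti_eq]; ring
  have t2 : ∑ k, (lti a k - lti b k) * (lti (x a) (x k) - lti (x b) (x k)) = Tt x x a b := by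
    have h : ∑ k, ((lti a k - lti b k) * (lti (x a) (x k) - lti (x b) (x k)) -
        (lei a k - lei b k) * (lei (x a) (x k) - lei (x b) (x k))) =
        ∑ k ∈ ({a, b} : Finset (ZMod m)),
          ((lti a k - lti b k) * (lti (x a) (x k) - lti (x b) (x k)) -
        (lei a k - lei b k) * (lei (x a) (x k) - lei (x b) (x k))) := by
      symm
      refine Finset.sum_subset (Finset.subset_univ _) fun k _ hk => ?_
      simp only [Finset.mem_insert, Finset.mem_singleton, not_or] at hk
      have h1 : x k ≠ x a := fun h => hk.1 (x.injective h)
      have h2 : x k ≠ x b := fun h => hk.2 (x.injective h)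
      simp [lei_eq, ind, hk.1, hk.2, h1, h2]
    have g1 : lei a b = lti a b := by rw [lei_eq]; simp [ind, hab.symm]
    have g2 : lei b a = lti b a := by rw [lei_eq]; simp [ind, hab]
    have g3 : lei (x a) (x b) = lti (x a) (x b) := by rw [lei_eq]; simp [ind, hx.symm]
    have g4 : lei (x b) (x a) = lti (x b) (x a) := by rw [lei_eq]; simp [ind, hx]
    have g5 : ∀ u : ZMod m, lei u u = 1 := fun u => by simp [lei, ind]
    rw [Finset.sum_pair hab, Finset.sum_sub_distrib] at h
    simp only [g1, g2, g3, g4, g5, l0] at h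
    have p1' : lti a b = 1 - lti b a := by linarith
    have p2' : lti (x a) (x b) = 1 - lti (x b) (x a) := by linarith
    rw [p1', p2'] at h
    unfold Tt
    linarith
  rw [key, key]
  rw [sum_swap x a b hab (fun k r => ∑ i, lti k i * lti r ((x * Equiv.swap a b) i))]
  have q1 : ∀ k r, ∑ i, lti k i * lti r ((x * Equiv.swap a b) i) =
      ∑ i, lti k i * lti r (x i) - (lti k a - lti k b) * (lti r (x a) - lti r (x b)) := by
    intro k r
    rw [sum_swap x a b hab (fun i s => lti k i * lti r s)]
    ring
  simp only [q1, Finset.sum_sub_distrib, t1, l0]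
  have t3 : ∑ i, lti a i * lti (x b) (x i) + ∑ i, lti b i * lti (x a) (x i) -
      ∑ i, lti a i * lti (x a) (x i) - ∑ i, lti b i * lti (x b) (x i) = - Tt x x a b := by
    rw [← t2]
    simp only [← Finset.sum_add_distrib, ← Finset.sum_sub_distrib, ← Finset.sum_neg_distrib]
    refine Finset.sum_congr rfl fun i _ => ?_
    ring
  have p1' : lti a b = 1 - lti b a := by linarith
  have p2' : lti (x a) (x b) = 1 - lti (x b) (x a) := by linarith
  rw [p1', p2']
  linarith

theorem maslov_diff {m : ℕ} [NeZero m] (f : ZMod m → ZMod m) (hf : Function.Bijective f)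
    (x : GridState m) (a b : ZMod m) (hab : a ≠ b) :
    MaslovOf f x - MaslovOf f (x * Equiv.swap a b) =
      1 - 2 * ∑ i, ind (inR x a b i (f i)) + 2 * icnt x a b := by
  have h1 := J_self x a b hab
  have h2 := J_marks f x a b hab
  have h3 := S_eq f hf x a b
  have h4 := S_eq x x.bijective x a b
  have h5 := S_self x a b hab
  unfold MaslovOf
  linarith

/-- the exponent vector of a rectangle weight -/
def expo {N : ℕ} [NeZero N] (G : GridDiagram N) (x : GridState N) (a b : ZMod N) :
    Option (ZMod N) →₀ ℕ :=
  ∑ i, Finsupp.single (some i) (if inR x a b i (G.Orow i) then 1 else 0) +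
    Finsupp.single none (icnt x a b)

theorem weight_monomial {N : ℕ} [NeZero N] (G : GridDiagram N) (x : GridState N) (a b : ZMod N) :
    mO G x a b * vV ^ icnt x a b = MvPolynomial.monomial (expo G x a b) (1 : F) := by
  have : ∀ (s : Finset (ZMod N)) (e : ZMod N → ℕ), ∏ i ∈ s, (Vv i : Rng N) ^ e i =
      MvPolynomial.monomial (∑ i ∈ s, Finsupp.single (some i) (e i)) (1 : F) := by
    intro s e
    induction s using Finset.induction_on with
    | empty => simp
    | insert i s hi ih =>
      rw [Finset.prod_insert hi, Finset.sum_insert hi, ih, Vv, MvPolynomial.X_pow_eq_monomial,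
        MvPolynomial.monomial_mul, mul_one]
  rw [mO, this, vV, MvPolynomial.X_pow_eq_monomial, MvPolynomial.monomial_mul, mul_one, expo]

theorem expo_none {N : ℕ} [NeZero N] (G : GridDiagram N) (x : GridState N) (a b : ZMod N) :
    expo G x a b none = icnt x a b := by
  simp [expo, Finsupp.finset_sum_apply]

theorem expo_some {N : ℕ} [NeZero N] (G : GridDiagram N) (x : GridState N) (a b i : ZMod N) :
    (expo G x a b (some i) : ℚ) = ind (inR x a b i (G.Orow i)) := by
  rw [expo, Finsupp.add_apply, Finsupp.finset_sum_apply, Finset.sum_eq_single i]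
  · have h0 : Finsupp.single (none : Option (ZMod N)) (icnt x a b) (some i) = 0 := by
      simp
    rw [Finsupp.single_eq_same, h0]
    push_cast
    rw [ind_eq, add_zero]
  · intro j _ hj
    rw [Finsupp.single_apply, if_neg (by simpa using hj)]
  · simp

theorem homog_add {N : ℕ} [NeZero N] (G : GridDiagram N) {z w : GC N} {d s : ℚ}
    (hz : IsHomog G z d s) (hw : IsHomog G w d s) : IsHomog G (z + w) d s := by
  intro y k h
  by_cases h1 : MvPolynomial.coeff k (z y) = 0
  · refine hw y k fun h2 => h ?_
    rw [Finsupp.add_apply, MvPolynomial.coeff_add, h1, h2, add_zero]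
  · exact hz y k h1

theorem homog_zero {N : ℕ} [NeZero N] (G : GridDiagram N) (d s : ℚ) :
    IsHomog G (0 : GC N) d s := by
  intro y k h
  simp at h

theorem homog_sum {N : ℕ} [NeZero N] (G : GridDiagram N) {ι : Type*} (t : Finset ι)
    (f : ι → GC N) {d s : ℚ} (h : ∀ i ∈ t, IsHomog G (f i) d s) :
    IsHomog G (∑ i ∈ t, f i) d s := by
  induction t using Finset.induction_on with
  | empty => simpa using homog_zero G d s
  | insert i t hi ih =>
    rw [Finset.sum_insert hi]
    exact homog_add G (h i (by simp)) (ih fun j hj => h j (by simp [hj]))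

theorem hX2I_homog {N : ℕ} [NeZero N] (G : GridDiagram N) (p q r : ZMod N) (h2 : G.Xrow p = r)
    (z : GC N) (d s : ℚ) (hz : IsHomog G z d s) :
    IsHomog G (op (wh G p q r) z) (d - 1) (s - 1) := by
  have e : op (wh G p q r) z = ∑ x ∈ z.support, op (wh G p q r) (Finsupp.single x (z x)) := by
    rw [← map_sum]
    congr 1
    exact (Finsupp.sum_single z).symm
  rw [e]
  refine homog_sum G _ _ fun x _ => ?_
  rw [op_single, Finset.smul_sum]
  refine homog_sum G _ _ fun a _ => ?_
  rw [Finset.smul_sum]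
  refine homog_sum G _ _ fun b _ => ?_
  by_cases hab : a ≠ b
  swap
  · rw [if_neg hab, smul_zero]
    exact homog_zero G _ _
  rw [if_pos hab]
  unfold wh
  split_ifs with hc
  swap
  · rw [Finsupp.single_zero, smul_zero]
    exact homog_zero G _ _
  rw [weight_monomial, Finsupp.smul_single, smul_eq_mul]
  intro y k hk
  rw [Finsupp.single_apply] at hk
  split_ifs at hk with hy
  swap
  · simp at hk
  subst hy
  rw [MvPolynomial.coeff_mul_monomial'] at hk
  split_ifs at hk with hle
  swap
  · exact absurd rfl hk
  rw [mul_one] at hk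
  obtain ⟨k', rfl⟩ := exists_add_of_le hle
  rw [add_tsub_cancel_left] at hk
  obtain ⟨hM, hA⟩ := hz x k' hk
  have mO' := maslov_diff G.Orow G.hO x a b hab
  have mX' := maslov_diff G.Xrow G.hX x a b hab
  have hX1 : ∑ i, ind (inR x a b i (G.Xrow i)) = 1 := by
    rw [Finset.sum_eq_single p]
    · rw [h2]
      exact if_pos hc.2.1
    · intro i _ hi
      exact if_neg (hc.2.2 i hi)
    · simp
  rw [hX1] at mX'
  have hs : ∑ i, (((expo G x a b + k') (some i) : ℕ) : ℚ) =
      ∑ i, ind (inR x a b i (G.Orow i)) + ∑ i, (k' (some i) : ℚ) := by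
    rw [← Finset.sum_add_distrib]
    refine Finset.sum_congr rfl fun i _ => ?_
    rw [Finsupp.add_apply, Nat.cast_add, expo_some]
  have hn : (((expo G x a b + k') none : ℕ) : ℚ) = icnt x a b + k' none := by
    rw [Finsupp.add_apply, Nat.cast_add, expo_none]
  rw [hs, hn]
  unfold Alex MaslovO MaslovX at *
  constructor <;> linarith


/-- For a stabilization of type `X:SW`, the map
`𝓗_{X₂}^{I₄} : (N₄, ∂_{N₄}^{N₄}) → (I₄, ∂_{I₄}^{I₄})⟦−1,−1⟧` is a chain homotopy
equivalence of bigraded chain complexes: it is a chain map, homogeneous of degree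
`(−1,−1)`, and it has a chain-homotopy inverse `g : I₄ → N₄`. -/
theorem statement15 (n : ℕ) [NeZero n] (G : GridDiagram n) (G' : GridDiagram (n + 1))
    (c' r' : ZMod (n + 1)) (hst : IsStabAt G G' c' r' false false true) :
    (dII G' c' r' ∘ₗ hX2I G' c' r' + hX2I G' c' r' ∘ₗ dNN G' c' r' = 0) ∧
    (∀ z d s, IsHomog G' z d s → IsHomog G' (hX2I G' c' r' z) (d - 1) (s - 1)) ∧
    (∃ g k : GC (n + 1) →ₗ[Rng (n + 1)] GC (n + 1),
      pN c' r' ∘ₗ g ∘ₗ pI c' r' = g ∧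
      pN c' r' ∘ₗ k ∘ₗ pN c' r' = k ∧
      dNN G' c' r' ∘ₗ g + g ∘ₗ dII G' c' r' = 0 ∧
      hX2I G' c' r' ∘ₗ g = pI c' r' ∧
      g ∘ₗ hX2I G' c' r' + pN c' r' = dNN G' c' r' ∘ₗ k + k ∘ₗ dNN G' c' r') := by
  have hst' := hst
  simp [IsStabAt] at hst'
  have h0 : G'.Orow (c' + 1) = r' + 1 := by tauto
  have h1 : G'.Xrow c' = r' + 1 := by tauto
  have h2 : G'.Xrow (c' + 1) = r' := by tauto
  have hh := hX2I_eq G' c' r' h1 h2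
  obtain ⟨m1, m2⟩ := main_alg G' c' r' h0 h1 h2 (diff4_eq G') hh
  refine ⟨m1, ?_, m2⟩
  intro z d s hz
  rw [hh]
  exact hX2I_homog G' _ _ _ h2 z d s hz

end GridHomology
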